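/- arXiv:1111.6820 — 4 statements merged into one kernel-verified Lean document; each statement's English description precedes it below -/
import Mathlib

section
/- Suppose H and K are residually finite p-groups, A ≤ Z(H) and B ≤ Z(K) are central subgroups, φ : A → B is an isomorphism, and A, B as well as every subgroup of finite p-power index of A and of B are p-separable in H and K respectively. Then the amalgamated free product G = (H * K; A = B, φ) is a residually finite p-group. -/
/-- A subset `M` of a group `G` is `p`-separable if every `a ∈ G` with `a ∉ M` can be
separated from `M` by a homomorphism of `G` onto a finite `p`-group. -/
def PSep (p : ℕ) {G : Type} [Group G] (M : Set G) : Prop :=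
  ∀ a : G, a ∉ M →
    ∃ (X : Type) (_ : Group X), Finite X ∧ IsPGroup p X ∧
      ∃ φ : G →* X, Function.Surjective φ ∧ φ a ∉ φ '' M

/-- A group `G` is residually a finite `p`-group if every `g ≠ 1` survives in some
finite `p`-group quotient. -/
def ResidP (p : ℕ) (G : Type) [Group G] : Prop :=
  ∀ g : G, g ≠ 1 →
    ∃ (X : Type) (_ : Group X), Finite X ∧ IsPGroup p X ∧
      ∃ φ : G →* X, Function.Surjective φ ∧ φ g ≠ 1

/-- A group `G` is conjugacy `p`-separable if any two non-conjugate elements of `G`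
have non-conjugate images under some homomorphism of `G` onto a finite `p`-group. -/
def ConjPSep (p : ℕ) (G : Type) [Group G] : Prop :=
  ∀ a b : G, ¬ IsConj a b →
    ∃ (X : Type) (_ : Group X), Finite X ∧ IsPGroup p X ∧
      ∃ φ : G →* X, Function.Surjective φ ∧ ¬ IsConj (φ a) (φ b)

/-- `G` together with `ιH, ιK` is the pushout of `f : A →* H` and `g : A →* K`,
characterized by its universal property. -/
def IsPushout {A H K G : Type} [Group A] [Group H] [Group K] [Group G]
    (f : A →* H) (g : A →* K) (ιH : H →* G) (ιK : K →* G) : Prop :=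
  (∀ a : A, ιH (f a) = ιK (g a)) ∧
  ∀ (X : Type) [Group X], ∀ (fH : H →* X) (fK : K →* X),
    (∀ a : A, fH (f a) = fK (g a)) →
      ∃! ρ : G →* X, ρ.comp ιH = fH ∧ ρ.comp ιK = fK

/-- `G` together with `ιH, ιK` is the free product of `H` and `K` with the subgroups
`A ≤ H` and `B ≤ K` amalgamated via the isomorphism `φ : A ≃* B`. -/
def IsAmalgam {H K G : Type} [Group H] [Group K] [Group G]
    (A : Subgroup H) (B : Subgroup K) (φ : A ≃* B)
    (ιH : H →* G) (ιK : K →* G) : Prop :=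
  IsPushout A.subtype (B.subtype.comp φ.toMonoidHom) ιH ιK

/-- The element `g` has nontrivial image under some homomorphism to a finite `p`-group. -/
def SurvivesP (p : ℕ) {G : Type} [Group G] (g : G) : Prop :=
  ∃ (X : Type) (_ : Group X), Finite X ∧ IsPGroup p X ∧ ∃ φ : G →* X, φ g ≠ 1

theorem ResidP.of_survivesP {p : ℕ} {G : Type} [Group G]
    (h : ∀ g : G, g ≠ 1 → SurvivesP p g) : ResidP p G := by
  intro g hg
  obtain ⟨X, _, _, hX, φ, hφ⟩ := h g hg
  refine ⟨φ.range, inferInstance, inferInstance, hX.to_subgroup _, φ.rangeRestrict,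
    φ.rangeRestrict_surjective, fun h1 => hφ ?_⟩
  simpa using congrArg Subtype.val h1

theorem IsPGroup.prod_group {p : ℕ} {X Y : Type} [Group X] [Group Y]
    (hX : IsPGroup p X) (hY : IsPGroup p Y) : IsPGroup p (X × Y) := by
  rintro ⟨x, y⟩
  obtain ⟨k, hk⟩ := hX x
  obtain ⟨l, hl⟩ := hY y
  refine ⟨k + l, Prod.ext ?_ ?_⟩
  · simp [pow_add, pow_mul, hk]
  · simp [pow_add, mul_comm (p ^ k), pow_mul, hl]

theorem MonoidHom.map_mem_center_of_surjective {H X : Type} [Group H] [Group X] {u : H →* X}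
    (hu : Function.Surjective u) {z : H} (hz : z ∈ Subgroup.center H) :
    u z ∈ Subgroup.center X := by
  rw [Subgroup.mem_center_iff]
  intro y
  obtain ⟨k, rfl⟩ := hu y
  rw [← map_mul, ← map_mul, Subgroup.mem_center_iff.1 hz k]

theorem Subgroup.normal_of_le_center {X : Type} [Group X] {D : Subgroup X}
    (hD : D ≤ Subgroup.center X) : D.Normal :=
  ⟨fun n hn g => by
    rw [Subgroup.mem_center_iff.1 (hD hn) g, mul_assoc, mul_inv_cancel, mul_one]
    exact hn⟩

/-- A `p`-separable central subgroup can be separated from an outside element by a homomorphism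
to a finite `p`-group that kills the subgroup. -/
theorem PSep.exists_hom_killing {p : ℕ} {K : Type} [Group K] {V : Subgroup K}
    (hV : V ≤ Subgroup.center K) (hsep : PSep p (V : Set K)) {a : K} (ha : a ∉ V) :
    ∃ (X : Type) (_ : Group X), Finite X ∧ IsPGroup p X ∧
      ∃ φ : K →* X, Function.Surjective φ ∧ (∀ v ∈ V, φ v = 1) ∧ φ a ≠ 1 := by
  obtain ⟨X, _, _, hX, φ, hφ, hφa⟩ := hsep a ha
  have hle : V.map φ ≤ Subgroup.center X := by
    rintro _ ⟨v, hv, rfl⟩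
    exact MonoidHom.map_mem_center_of_surjective hφ (hV hv)
  have : (V.map φ).Normal := Subgroup.normal_of_le_center hle
  refine ⟨X ⧸ V.map φ, inferInstance, inferInstance, hX.to_quotient _,
    (QuotientGroup.mk' _).comp φ,
    (QuotientGroup.mk'_surjective _).comp hφ, fun v hv => ?_, fun h => hφa ?_⟩
  · exact (QuotientGroup.eq_one_iff _).2 ⟨v, hv, rfl⟩
  · exact (QuotientGroup.eq_one_iff _).1 h

/-- Products of `m` letters satisfying `L`, of alternating kinds and multiplied from the left,
starting with an element of `C`; the first letter has kind `b₀`. -/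
inductive AlternatingProd {G : Type} [Group G] (L : Bool → G → Prop) (C : Subgroup G) (b₀ : Bool) :
    ℕ → G → Prop
  | base (c : G) : c ∈ C → AlternatingProd L C b₀ 0 c
  | cons (m : ℕ) (x g : G) : L (not^[m] b₀) x → AlternatingProd L C b₀ m g →
      AlternatingProd L C b₀ (m + 1) (x * g)

namespace AlternatingProd

variable {G : Type} [Group G] {C : Subgroup G} {b₀ : Bool} {m : ℕ} {g : G}

theorem mono {L L' : Bool → G → Prop} (hL : ∀ b x, L b x → L' b x)
    (h : AlternatingProd L C b₀ m g) : AlternatingProd L' C b₀ m g := by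
  induction h with
  | base c hc => exact base c hc
  | cons m x g hx _ ih => exact cons m x g (hL _ _ hx) ih

theorem base_mul {S : Bool → Subgroup G} (hC : ∀ b, C ≤ S b) {c : G} (hc : c ∈ C)
    (h : AlternatingProd (fun b x => x ∈ S b ∧ x ∉ C) C b₀ m g) :
    AlternatingProd (fun b x => x ∈ S b ∧ x ∉ C) C b₀ m (c * g) := by
  cases h with
  | base g hg => exact base _ (C.mul_mem hc hg)
  | cons m x g hx h =>
    rw [← mul_assoc]
    exact cons m _ g
      ⟨(S _).mul_mem (hC _ hc) hx.1, fun h' => hx.2 ((C.mul_mem_cancel_left hc).1 h')⟩ h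

theorem exists_mul {S : Bool → Subgroup G} (hC : ∀ b, C ≤ S b) {b : Bool} {s : G} (hs : s ∈ S b)
    (h : AlternatingProd (fun b x => x ∈ S b ∧ x ∉ C) C b₀ m g) :
    ∃ b₁ k, AlternatingProd (fun b x => x ∈ S b ∧ x ∉ C) C b₁ k (s * g) := by
  by_cases hsC : s ∈ C
  · exact ⟨_, _, base_mul hC hsC h⟩
  cases h with
  | base g hg => exact ⟨b, 1, cons 0 s g ⟨hs, hsC⟩ (base g hg)⟩
  | cons m x g hx h =>
    by_cases hb : b = not^[m] b₀
    · subst hb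
      rw [← mul_assoc]
      by_cases hsx : s * x ∈ C
      · exact ⟨_, _, base_mul hC hsx h⟩
      · exact ⟨_, _, cons m _ g ⟨(S _).mul_mem hs hx.1, hsx⟩ h⟩
    · refine ⟨b₀, m + 2, cons (m + 1) s _ ⟨?_, hsC⟩ (cons m x g hx h)⟩
      rw [Function.iterate_succ_apply']
      rwa [← Bool.eq_not_of_ne hb]

theorem exists_of_iSup_eq_top {S : Bool → Subgroup G} (hC : ∀ b, C ≤ S b) (hS : ⨆ b, S b = ⊤)
    (g : G) : ∃ b₁ k, AlternatingProd (fun b x => x ∈ S b ∧ x ∉ C) C b₁ k g := by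
  have hg : g ∈ ⨆ b, S b := hS ▸ Subgroup.mem_top g
  rw [Subgroup.iSup_eq_closure] at hg
  induction hg using Subgroup.closure_induction_left with
  | one => exact ⟨true, 0, base _ C.one_mem⟩
  | mul_left x hx y _ ih =>
    obtain ⟨b, hb⟩ := Set.mem_iUnion.1 hx
    obtain ⟨_, _, h⟩ := ih
    exact exists_mul hC hb h
  | inv_mul_cancel x hx y _ ih =>
    obtain ⟨b, hb⟩ := Set.mem_iUnion.1 hx
    obtain ⟨_, _, h⟩ := ih
    exact exists_mul hC ((S b).inv_mem hb) h

end AlternatingProd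

section Bidiagonal

variable {p n : ℕ} {R : Type} [Ring R] [Algebra (ZMod p) R]

/-- The lower bidiagonal operator with diagonal `d` whose subdiagonal entry in column `i` is
`d i - 1`. -/
def bidiagonal (p : ℕ) [Algebra (ZMod p) R] (d : Fin (n + 1) → R) :
    Module.End (ZMod p) (Fin (n + 1) → R) where
  toFun v := Fin.cons (d 0 * v 0) fun i : Fin n =>
    d i.succ * v i.succ + (d i.castSucc - 1) * v i.castSucc
  map_add' v w := by
    ext i
    cases i using Fin.cases with
    | zero => simp [mul_add]
    | succ i => simp only [Fin.cons_succ, Pi.add_apply, mul_add]; abel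
  map_smul' c v := by
    ext i
    cases i using Fin.cases <;> simp

@[simp]
theorem bidiagonal_apply_zero (d v : Fin (n + 1) → R) : bidiagonal p d v 0 = d 0 * v 0 := rfl

@[simp]
theorem bidiagonal_apply_succ (d v : Fin (n + 1) → R) (i : Fin n) :
    bidiagonal p d v i.succ = d i.succ * v i.succ + (d i.castSucc - 1) * v i.castSucc := rfl

theorem bidiagonal_one : bidiagonal p (1 : Fin (n + 1) → R) = 1 := by
  refine LinearMap.ext fun v => funext fun i => ?_
  cases i using Fin.cases <;> simp

theorem bidiagonal_mul {d e : Fin (n + 1) → R}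
    (h : ∀ i : Fin n, (d i.succ - 1) * (e i.castSucc - 1) = 0) :
    bidiagonal p (d * e) = bidiagonal p d * bidiagonal p e := by
  refine LinearMap.ext fun v => funext fun i => ?_
  have hkey : ∀ j, (d j - 1) * bidiagonal p e v j = (d j - 1) * (e j * v j) := by
    intro j
    cases j using Fin.cases with
    | zero => simp
    | succ j => rw [bidiagonal_apply_succ, mul_add, ← mul_assoc (d j.succ - 1) (e j.castSucc - 1),
        h, zero_mul, add_zero]
  cases i using Fin.cases with
  | zero => simp [mul_assoc]
  | succ i =>
    have hi := congrArg (· * v i.castSucc) (h i)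
    rw [Module.End.mul_apply, bidiagonal_apply_succ, bidiagonal_apply_succ, hkey,
      bidiagonal_apply_succ]
    simp only [Pi.mul_apply, sub_mul, mul_sub, mul_add, one_mul, mul_one, zero_mul,
      mul_assoc] at hi ⊢
    rw [← sub_eq_zero, ← neg_eq_zero, ← hi]
    abel

/-- The operator `T` is lower triangular with diagonal `d`. -/
def IsLowerTriangular (T : Module.End (ZMod p) (Fin (n + 1) → R)) (d : Fin (n + 1) → R) : Prop :=
  ∀ i v, (∀ j < i, v j = 0) → T v i = d i * v i

theorem isLowerTriangular_bidiagonal (d : Fin (n + 1) → R) :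
    IsLowerTriangular (bidiagonal p d) d := by
  intro i v hv
  cases i using Fin.cases with
  | zero => simp
  | succ i => simp [hv _ i.castSucc_lt_succ]

theorem IsLowerTriangular.one : IsLowerTriangular (1 : Module.End (ZMod p) (Fin (n + 1) → R)) 1 :=
  fun i v _ => by simp

theorem IsLowerTriangular.mul {T U : Module.End (ZMod p) (Fin (n + 1) → R)}
    {d e : Fin (n + 1) → R} (hT : IsLowerTriangular T d) (hU : IsLowerTriangular U e) :
    IsLowerTriangular (T * U) (d * e) := by
  intro i v hv
  have hUv : ∀ j ≤ i, U v j = e j * v j := fun j hj => hU j v fun k hk => hv k (hk.trans_le hj)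
  rw [Module.End.mul_apply, hT i (U v) fun j hj => by rw [hUv j hj.le, hv j hj, mul_zero],
    hUv i le_rfl, Pi.mul_apply, mul_assoc]

theorem IsLowerTriangular.pow {T : Module.End (ZMod p) (Fin (n + 1) → R)}
    {d : Fin (n + 1) → R} (hT : IsLowerTriangular T d) (k : ℕ) :
    IsLowerTriangular (T ^ k) (d ^ k) := by
  induction k with
  | zero => simpa using IsLowerTriangular.one
  | succ k ih => simpa only [pow_succ] using ih.mul hT

theorem IsLowerTriangular.pow_eq_one [Fact p.Prime] [Nontrivial R]
    {T : Module.End (ZMod p) (Fin (n + 1) → R)}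
    (hT : IsLowerTriangular T 1) : T ^ p ^ (n + 1) = 1 := by
  have : CharP (Module.End (ZMod p) (Fin (n + 1) → R)) p :=
    charP_of_injective_algebraMap (algebraMap (ZMod p) _).injective p
  have hN : ∀ i v, (∀ j < i, v j = 0) → (T - 1) v i = 0 := fun i v hv => by simp [hT i v hv]
  have hpow : ∀ (k : ℕ) v (i : Fin (n + 1)), (i : ℕ) < k → ((T - 1) ^ k) v i = 0 := by
    intro k
    induction k with
    | zero => simp
    | succ k ih =>
      intro v i hi
      rw [pow_succ', Module.End.mul_apply]
      exact hN i _ fun j hj => ih v j (by omega)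
  have hzero : (T - 1) ^ (n + 1) = 0 := LinearMap.ext fun v => funext fun i => hpow _ v i i.2
  have hle : n + 1 ≤ p ^ (n + 1) := (Nat.lt_pow_self (Fact.out : p.Prime).one_lt).le
  have h := sub_pow_char_pow_of_commute p (n + 1) (Commute.one_right T)
  rw [pow_eq_zero_of_le hle hzero, one_pow] at h
  exact (sub_eq_zero.1 h.symm)

end Bidiagonal

theorem MonoidAlgebra.of_sub_one_mul_ne_zero {k n : ℕ} {F Z : Type} [Ring F] [Group Z]
    {z : MonoidAlgebra F (Fin (n + 1) → Z)} (hz : z ≠ 0)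
    (hsupp : ∀ π, z.coeff π ≠ 0 → ∀ j : Fin (n + 1), k ≤ j → π j = 1) {i : Fin (n + 1)}
    (hi : (i : ℕ) = k) {x : Z} (hx : x ≠ 1) :
    (MonoidAlgebra.of F _ (Pi.mulSingle i x) - 1) * z ≠ 0 ∧
      ∀ π, ((MonoidAlgebra.of F _ (Pi.mulSingle i x) - 1) * z).coeff π ≠ 0 →
        ∀ j : Fin (n + 1), k + 1 ≤ j → π j = 1 := by
  have hcoeff : ∀ π, ((MonoidAlgebra.of F _ (Pi.mulSingle i x) - 1) * z).coeff π =
      z.coeff ((Pi.mulSingle i x)⁻¹ * π) - z.coeff π := by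
    intro π
    simp [sub_mul, MonoidAlgebra.coeff_single_mul_apply]
  constructor
  · obtain ⟨π, hπ⟩ : ∃ π, z.coeff π ≠ 0 := by
      by_contra! h
      exact hz (MonoidAlgebra.ext (by simpa [DFunLike.ext_iff] using h))
    intro h0
    have h1 := hcoeff (Pi.mulSingle i x * π)
    rw [h0, inv_mul_cancel_left] at h1
    have h2 : z.coeff (Pi.mulSingle i x * π) ≠ 0 := by
      intro h2
      rw [h2] at h1
      exact hπ (by simpa using h1.symm)
    have h3 := hsupp _ h2 i hi.ge
    rw [Pi.mul_apply, hsupp _ hπ i hi.ge] at h3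
    exact hx (by simpa using h3)
  · intro π hπ j hj
    have hij : j ≠ i := by
      rintro rfl
      omega
    by_cases h : z.coeff π = 0
    · rw [hcoeff, h, sub_zero] at hπ
      simpa [hij] using hsupp _ hπ j (by omega)
    · exact hsupp _ h j (by omega)

namespace IsPushout

variable {A H K G : Type} [Group A] [Group H] [Group K] [Group G]
  {f : A →* H} {g : A →* K} {ιH : H →* G} {ιK : K →* G}

theorem range_sup_range (hG : IsPushout f g ιH ιK) : ιH.range ⊔ ιK.range = ⊤ := by
  set L := ιH.range ⊔ ιK.range
  have hH : ∀ h, ιH h ∈ L := fun h => Subgroup.mem_sup_left ⟨h, rfl⟩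
  have hK : ∀ k, ιK k ∈ L := fun k => Subgroup.mem_sup_right ⟨k, rfl⟩
  obtain ⟨ρ, ⟨h1, h2⟩, -⟩ := hG.2 L (ιH.codRestrict L hH) (ιK.codRestrict L hK)
    fun a => Subtype.ext (hG.1 a)
  have hid : L.subtype.comp ρ = MonoidHom.id G := by
    refine (hG.2 G ιH ιK hG.1).unique ⟨?_, ?_⟩ ⟨rfl, rfl⟩
    · rw [MonoidHom.comp_assoc, h1]; rfl
    · rw [MonoidHom.comp_assoc, h2]; rfl
  refine top_le_iff.1 fun x _ => ?_
  have := DFunLike.congr_fun hid x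
  rw [← show (ρ x : G) = x from this]
  exact (ρ x).2

theorem exists_hom (hG : IsPushout f g ιH ιK) {X : Type} [Group X] (fH : H →* X) (fK : K →* X)
    (h : ∀ a, fH (f a) = fK (g a)) :
    ∃ ρ : G →* X, (∀ x, ρ (ιH x) = fH x) ∧ ∀ x, ρ (ιK x) = fK x := by
  obtain ⟨ρ, ⟨h1, h2⟩, -⟩ := hG.2 X fH fK h
  exact ⟨ρ, DFunLike.congr_fun h1, DFunLike.congr_fun h2⟩

/-- The images of the two factors, indexed by `Bool`. -/
def factor (ιH : H →* G) (ιK : K →* G) (b : Bool) : Subgroup G := cond b ιH.range ιK.range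

theorem iSup_factor (hG : IsPushout f g ιH ιK) : ⨆ b, factor ιH ιK b = ⊤ := by
  rw [iSup_bool_eq]
  exact hG.range_sup_range

theorem range_le_factor (hG : IsPushout f g ιH ιK) (b : Bool) :
    (ιH.comp f).range ≤ factor ιH ιK b := by
  rintro _ ⟨a, rfl⟩
  cases b
  · exact ⟨g a, (hG.1 a).symm⟩
  · exact ⟨f a, rfl⟩

theorem exists_representation (hG : IsPushout f g ιH ιK) {p n : ℕ} {R : Type} [Ring R]
    [Algebra (ZMod p) R] (s : G →* (Fin (n + 1) → R))
    (hs : ∀ b, ∀ x ∈ factor ιH ιK b, ∀ y ∈ factor ιH ιK b, ∀ i : Fin n,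
      (s x i.succ - 1) * (s y i.castSucc - 1) = 0) :
    ∃ T : G →* (Module.End (ZMod p) (Fin (n + 1) → R))ˣ,
      ∀ b, ∀ x ∈ factor ιH ιK b, (T x : Module.End _ _) = bidiagonal p (s x) := by
  let tH : H →* Module.End (ZMod p) (Fin (n + 1) → R) :=
    { toFun := fun h => bidiagonal p (s (ιH h))
      map_one' := by rw [map_one, map_one, bidiagonal_one]
      map_mul' := fun x y => by
        rw [map_mul, map_mul, bidiagonal_mul (hs true _ ⟨x, rfl⟩ _ ⟨y, rfl⟩)] }
  let tK : K →* Module.End (ZMod p) (Fin (n + 1) → R) :=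
    { toFun := fun h => bidiagonal p (s (ιK h))
      map_one' := by rw [map_one, map_one, bidiagonal_one]
      map_mul' := fun x y => by
        rw [map_mul, map_mul, bidiagonal_mul (hs false _ ⟨x, rfl⟩ _ ⟨y, rfl⟩)] }
  obtain ⟨T, h1, h2⟩ := hG.exists_hom tH.toHomUnits tK.toHomUnits fun a => Units.ext <|
    show bidiagonal p (s (ιH (f a))) = bidiagonal p (s (ιK (g a))) by rw [hG.1]
  refine ⟨T, fun b x hx => ?_⟩
  cases b <;> obtain ⟨y, rfl⟩ := hx
  · rw [h2]; rfl
  · rw [h1]; rfl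

theorem survivesP_of_alternatingProd (hG : IsPushout f g ιH ιK) {p : ℕ} [Fact p.Prime]
    {Z : Type} [Group Z] [Finite Z] (hZ : IsPGroup p Z) (α : Bool → G →* Z)
    (hα : ∀ b, ∀ x ∈ factor ιH ιK (!b), α b x = 1) {b₀ : Bool} {n : ℕ} (hn : n ≠ 0) {w : G}
    (hw : AlternatingProd (fun b x => x ∈ factor ιH ιK b ∧ α b x ≠ 1) (ιH.comp f).range b₀ n w) :
    SurvivesP p w := by
  let R := MonoidAlgebra (ZMod p) (Fin (n + 1) → Z)
  have : Finite R := Finite.of_injective (fun z : R => (z.coeff : _ → ZMod p))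
    fun _ _ h => MonoidAlgebra.ext (DFunLike.coe_injective h)
  let V := Fin (n + 1) → R
  have : Finite (Module.End (ZMod p) V) := Finite.of_injective _ DFunLike.coe_injective
  let s : G →* V := MonoidHom.pi fun i => (MonoidAlgebra.of (ZMod p) (Fin (n + 1) → Z)).comp
    ((MonoidHom.mulSingle (fun _ => Z) i).comp (α (not^[i] b₀)))
  have hs_apply : ∀ x i, s x i = MonoidAlgebra.of (ZMod p) (Fin (n + 1) → Z)
    (Pi.mulSingle i (α (not^[i] b₀) x)) := fun x i => rfl
  have hs_one : ∀ x (i : Fin (n + 1)), α (not^[i] b₀) x = 1 → s x i = 1 := by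
    intro x i h
    rw [hs_apply, h, Pi.mulSingle_one, map_one]
  obtain ⟨T, hT⟩ := hG.exists_representation (p := p) s (by
    intro b x hx y hy i
    by_cases hb : b = not^[i] b₀
    · rw [hs_one x i.succ, sub_self, zero_mul]
      rw [Fin.val_succ, Function.iterate_succ_apply', ← hb]
      exact hα _ _ (by rwa [Bool.not_not])
    · rw [hs_one y i.castSucc, sub_self, mul_zero]
      refine hα _ _ ?_
      rwa [Fin.val_castSucc, ← Bool.eq_not_of_ne hb])
  have htri : ∀ x : G, IsLowerTriangular (T x : Module.End (ZMod p) V) (s x) := by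
    intro x
    have hx : x ∈ ⨆ b, factor ιH ιK b := hG.iSup_factor ▸ Subgroup.mem_top x
    induction hx using Subgroup.iSup_induction' with
    | hp b x hx => rw [hT b x hx]; exact isLowerTriangular_bidiagonal _
    | h1 => rw [map_one, map_one]; exact IsLowerTriangular.one
    | hmul x y _ _ hx hy => rw [map_mul, map_mul]; exact hx.mul hy
  have hrange : IsPGroup p T.range := by
    rintro ⟨_, x, rfl⟩
    obtain ⟨N, hN⟩ := IsPGroup.iff_card.1 hZ
    refine ⟨N + (n + 1), Subtype.ext (Units.ext ?_)⟩
    have hsx : s x ^ p ^ N = 1 := by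
      rw [← map_pow]
      refine funext fun i => hs_one _ _ ?_
      rw [map_pow, ← hN, pow_card_eq_one']
    have h := (htri x).pow (p ^ N)
    rw [hsx] at h
    simpa [pow_add, pow_mul] using h.pow_eq_one
  let e : V := Pi.single 0 1
  have key : ∀ m u, AlternatingProd (fun b x => x ∈ factor ιH ιK b ∧ α b x ≠ 1)
      (ιH.comp f).range b₀ m u → m ≤ n → ∃ z : R, z ≠ 0 ∧
        (∀ π, z.coeff π ≠ 0 → ∀ j : Fin (n + 1), m ≤ j → π j = 1) ∧
        (∀ j : Fin (n + 1), m < j → (T u : Module.End (ZMod p) V) e j = 0) ∧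
        ∀ j : Fin (n + 1), (j : ℕ) = m → (T u : Module.End (ZMod p) V) e j = z := by
    intro m u hu
    induction hu with
    | base c hc =>
      intro _
      have hsc : s c = 1 :=
        funext fun i => hs_one _ _ (hα _ _ (hG.range_le_factor _ hc))
      rw [hT true c (hG.range_le_factor _ hc), hsc, bidiagonal_one]
      refine ⟨1, one_ne_zero, ?_, ?_, ?_⟩
      · intro π hπ j _
        by_contra hj
        refine hπ ?_
        rw [MonoidAlgebra.one_def]
        simp only [MonoidAlgebra.coeff_single]
        exact Finsupp.single_eq_of_ne fun h => hj (by rw [h, Pi.one_apply])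
      · intro j hj
        exact Pi.single_eq_of_ne (fun h => by simp [h] at hj) _
      · intro j hj
        obtain rfl : j = 0 := Fin.ext hj
        exact Pi.single_eq_same (M := fun _ : Fin (n + 1) => R) 0 1
    | cons m x u hx _ ih =>
      intro hm
      obtain ⟨z, hz0, hz, hbelow, hat⟩ := ih (by omega)
      let i : Fin (n + 1) := ⟨m, by omega⟩
      obtain ⟨h1, h2⟩ := MonoidAlgebra.of_sub_one_mul_ne_zero hz0 hz (i := i) rfl hx.2
      refine ⟨_, h1, h2, ?_, ?_⟩
      · intro j hj
        rw [map_mul, Units.val_mul, Module.End.mul_apply, hT _ x hx.1]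
        cases j using Fin.cases with
        | zero => simp at hj
        | succ j =>
          rw [Fin.val_succ] at hj
          rw [bidiagonal_apply_succ, hbelow _ (by rw [Fin.val_succ]; omega),
            hbelow j.castSucc (by rw [Fin.val_castSucc]; omega), mul_zero, mul_zero, add_zero]
      · intro j hj
        rw [map_mul, Units.val_mul, Module.End.mul_apply, hT _ x hx.1]
        cases j using Fin.cases with
        | zero => simp at hj
        | succ j =>
          rw [Fin.val_succ] at hj
          have hji : j.castSucc = i := Fin.ext (by rw [Fin.val_castSucc]; simp only [i]; omega)
          rw [bidiagonal_apply_succ, hbelow _ (by rw [Fin.val_succ]; omega), hji, hat i rfl,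
            mul_zero, zero_add]
          rfl
  obtain ⟨z, hz0, -, -, hz⟩ := key n w hw le_rfl
  refine ⟨T.range, inferInstance, inferInstance, hrange, T.rangeRestrict, fun h => hz0 ?_⟩
  have hTw : T w = 1 := by simpa using congrArg Subtype.val h
  rw [← hz (Fin.last n) rfl, hTw]
  exact Pi.single_eq_of_ne (by simpa [Fin.ext_iff] using hn) _

theorem survivesP_of_notMem_range (hG : IsPushout f g ιH ιK) {p : ℕ} [Fact p.Prime]
    (hf : f.range ≤ Subgroup.center H) (hg : g.range ≤ Subgroup.center K)
    (hfsep : PSep p (f.range : Set H)) (hgsep : PSep p (g.range : Set K)) {w : G}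
    (hw : w ∉ (ιH.comp f).range) : SurvivesP p w := by
  have hletter : ∀ b, ∀ x ∈ factor ιH ιK b, x ∉ (ιH.comp f).range →
      ∃ (Z : Type) (_ : Group Z), Finite Z ∧ IsPGroup p Z ∧ ∃ α : G →* Z,
        (∀ y ∈ factor ιH ιK (!b), α y = 1) ∧ α x ≠ 1 := by
    intro b x hx hxC
    cases b <;> obtain ⟨y, rfl⟩ := hx
    · obtain ⟨Z, _, hfin, hZ, φ, -, hφ, hφy⟩ := hgsep.exists_hom_killing hg (a := y) (by
        rintro ⟨a, rfl⟩
        exact hxC ⟨a, hG.1 a⟩)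
      obtain ⟨ρ, h1, h2⟩ := hG.exists_hom (1 : H →* Z) φ fun a => (hφ _ ⟨a, rfl⟩).symm
      refine ⟨Z, _, hfin, hZ, ρ, ?_, by rwa [h2]⟩
      rintro _ ⟨k, rfl⟩
      exact h1 k
    · obtain ⟨Z, _, hfin, hZ, φ, -, hφ, hφy⟩ := hfsep.exists_hom_killing hf (a := y) (by
        rintro ⟨a, rfl⟩
        exact hxC ⟨a, rfl⟩)
      obtain ⟨ρ, h1, h2⟩ := hG.exists_hom φ (1 : K →* Z) fun a => hφ _ ⟨a, rfl⟩
      refine ⟨Z, _, hfin, hZ, ρ, ?_, by rwa [h1]⟩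
      rintro _ ⟨k, rfl⟩
      exact h2 k
  have hall : ∀ (b₀ : Bool) (m : ℕ) (u : G),
      AlternatingProd (fun b x => x ∈ factor ιH ιK b ∧ x ∉ (ιH.comp f).range)
        (ιH.comp f).range b₀ m u →
      ∃ (Z : Type) (_ : Group Z), Finite Z ∧ IsPGroup p Z ∧ ∃ α : Bool → G →* Z,
        (∀ b, ∀ y ∈ factor ιH ιK (!b), α b y = 1) ∧
        AlternatingProd (fun b x => x ∈ factor ιH ιK b ∧ α b x ≠ 1)
          (ιH.comp f).range b₀ m u := by
    intro b₀ m u hu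
    induction hu with
    | base c hc =>
      exact ⟨Unit, inferInstance, inferInstance, fun _ => ⟨0, rfl⟩, fun _ => 1,
        fun _ _ _ => rfl, .base c hc⟩
    | cons m x u hx _ ih =>
      obtain ⟨Z, _, _, hZ, α, hα, hu⟩ := ih
      obtain ⟨Y, _, _, hY, β, hβ, hβx⟩ := hletter _ x hx.1 hx.2
      refine ⟨Z × Y, inferInstance, inferInstance, hZ.prod_group hY,
        fun b => (α b).prod (if b = not^[m] b₀ then β else 1), ?_, .cons m x u ⟨hx.1, ?_⟩
          (hu.mono fun b x h => ⟨h.1, fun h' => h.2 (congrArg Prod.fst h')⟩)⟩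
      · intro b y hy
        refine Prod.ext (hα b y hy) ?_
        by_cases hb : b = not^[m] b₀
        · simpa [hb] using hβ y (hb ▸ hy)
        · simp [hb]
      · intro h
        exact hβx (by simpa using congrArg Prod.snd h)
  obtain ⟨b₀, n, hn⟩ := AlternatingProd.exists_of_iSup_eq_top hG.range_le_factor hG.iSup_factor w
  obtain ⟨Z, _, _, hZ, α, hα, hα'⟩ := hall b₀ n w hn
  refine hG.survivesP_of_alternatingProd hZ α hα ?_ hα'
  rintro rfl
  cases hn
  contradiction

/-- If the quotients `u` and `v` satisfy `huv`, then elements of the amalgamated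
subgroup that survive in `X` survive in the central product of `X` and `Y`. -/
theorem survivesP_of_central_maps (hG : IsPushout f g ιH ιK) {p : ℕ}
    (hf : f.range ≤ Subgroup.center H) (hg : g.range ≤ Subgroup.center K)
    {X Y : Type} [Group X] [Group Y] [Finite X] [Finite Y] (hX : IsPGroup p X) (hY : IsPGroup p Y)
    {u : H →* X} {v : K →* Y} (hu : Function.Surjective u) (hv : Function.Surjective v)
    (huv : ∀ a, v (g a) = 1 → u (f a) = 1) {a : A} (ha : u (f a) ≠ 1) :
    SurvivesP p (ιH (f a)) := by
  have hucenter : ∀ c, u (f c) ∈ Subgroup.center X := fun c =>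
    MonoidHom.map_mem_center_of_surjective hu (hf ⟨c, rfl⟩)
  have hvcenter : ∀ c, v (g c) ∈ Subgroup.center Y := fun c =>
    MonoidHom.map_mem_center_of_surjective hv (hg ⟨c, rfl⟩)
  let δ : A →* X × Y :=
    { toFun := fun c => (u (f c), (v (g c))⁻¹)
      map_one' := by simp
      map_mul' := fun c d => by
        refine Prod.ext (by simp) ?_
        simp only [map_mul, Prod.mk_mul_mk, mul_inv_rev]
        exact (Subgroup.mem_center_iff.1 ((Subgroup.center Y).inv_mem (hvcenter c)) _) }
  have hle : δ.range ≤ Subgroup.center (X × Y) := by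
    rintro _ ⟨c, rfl⟩
    rw [Subgroup.mem_center_iff]
    rintro ⟨x, y⟩
    exact Prod.ext (Subgroup.mem_center_iff.1 (hucenter c) x)
      (Subgroup.mem_center_iff.1 ((Subgroup.center Y).inv_mem (hvcenter c)) y)
  have : δ.range.Normal := Subgroup.normal_of_le_center hle
  obtain ⟨ρ, hρ, -⟩ := hG.exists_hom
    ((QuotientGroup.mk' δ.range).comp ((MonoidHom.inl X Y).comp u))
    ((QuotientGroup.mk' δ.range).comp ((MonoidHom.inr X Y).comp v)) fun c =>
      (QuotientGroup.eq.2 ⟨c⁻¹, by simp [δ]⟩)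
  refine ⟨(X × Y) ⧸ δ.range, inferInstance, inferInstance,
    (hX.prod_group hY).to_quotient _, ρ, fun h => ha ?_⟩
  rw [hρ] at h
  obtain ⟨c, hc⟩ := (QuotientGroup.eq_one_iff _).1 h
  have h1 : u (f c) = u (f a) := congrArg Prod.fst hc
  have h2 : (v (g c))⁻¹ = 1 := congrArg Prod.snd hc
  rw [← h1, huv c (inv_eq_one.1 h2)]

end IsPushout

theorem Subgroup.exists_maximal_prime_pow_index {p : ℕ} (hp : p.Prime) {A : Type} [Group A] {a : A}
    (h : ∃ U : Subgroup A, a ∉ U ∧ ∃ n, U.index = p ^ n) :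
    ∃ U : Subgroup A, a ∉ U ∧ (∃ n, U.index = p ^ n) ∧ ∀ W : Subgroup A, U ≤ W → a ∉ W → W ≤ U := by
  classical
  have h' : ∃ n, ∃ U : Subgroup A, a ∉ U ∧ U.index = p ^ n :=
    let ⟨U, ha, n, hn⟩ := h; ⟨n, U, ha, hn⟩
  obtain ⟨U, ha, hU⟩ := Nat.find_spec h'
  refine ⟨U, ha, ⟨_, hU⟩, fun W hUW haW => ?_⟩
  have hmul := Subgroup.relIndex_mul_index hUW
  rw [hU] at hmul
  obtain ⟨m, hm, hW⟩ := (Nat.dvd_prime_pow hp).1 ⟨_, (mul_comm _ _).trans hmul |>.symm⟩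
  have hmin := Nat.find_min' h' ⟨W, haW, hW⟩
  obtain rfl := le_antisymm hm hmin
  rw [hW] at hmul
  exact Subgroup.relIndex_eq_one.1
    (Nat.eq_of_mul_eq_mul_right (pow_pos hp.pos _) (by rw [hmul, one_mul]))

/-- Proposition 3.3: an amalgam of residually finite `p`-groups over central subgroups
satisfying the separability hypotheses is a residually finite `p`-group. -/
theorem residP_amalgam (p : ℕ) (hp : p.Prime)
    {H K G : Type} [Group H] [Group K] [Group G]
    (A : Subgroup H) (B : Subgroup K) (φ : A ≃* B)
    (hA : A ≤ Subgroup.center H) (hB : B ≤ Subgroup.center K)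
    (ιH : H →* G) (ιK : K →* G) (hG : IsAmalgam A B φ ιH ιK)
    (hH : ResidP p H) (hK : ResidP p K)
    (hAsep : PSep p (A : Set H)) (hBsep : PSep p (B : Set K))
    (hAsub : ∀ U : Subgroup A, (∃ n : ℕ, U.index = p ^ n) →
      PSep p ((U.map A.subtype : Subgroup H) : Set H))
    (hBsub : ∀ V : Subgroup B, (∃ n : ℕ, V.index = p ^ n) →
      PSep p ((V.map B.subtype : Subgroup K) : Set K)) :
    ResidP p G := by
  have := Fact.mk hp
  have hfr : A.subtype.range = A := A.range_subtype
  have hgr : (B.subtype.comp φ.toMonoidHom).range = B := by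
    rw [MonoidHom.range_comp, MonoidHom.range_eq_top.2 φ.surjective, ← MonoidHom.range_eq_map,
      B.range_subtype]
  refine ResidP.of_survivesP fun w hw => ?_
  by_cases hwA : w ∈ (ιH.comp A.subtype).range
  swap
  · exact hG.survivesP_of_notMem_range (hfr.le.trans hA) (hgr.le.trans hB) (by rwa [hfr])
      (by rwa [hgr]) hwA
  obtain ⟨a, rfl⟩ := hwA
  have ha : (a : H) ≠ 1 := fun h => hw (by simp [h])
  obtain ⟨X₀, _, _, hX₀, u₀, -, hu₀⟩ := hH a ha
  obtain ⟨U, haU, hU, hmax⟩ := Subgroup.exists_maximal_prime_pow_index hp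
    ⟨(u₀.comp A.subtype).ker, hu₀, by
      obtain ⟨n, hn⟩ := IsPGroup.iff_card.1 (hX₀.to_subgroup (u₀.comp A.subtype).range)
      exact ⟨n, by rw [Subgroup.index_ker, hn]⟩⟩
  obtain ⟨X, _, _, hX, u, hu, huU, hua⟩ := (hAsub U hU).exists_hom_killing
    ((Subgroup.map_subtype_le U).trans hA) (a := a) (by
      rintro ⟨c, hc, h⟩
      exact haU (Subtype.ext h ▸ hc))
  obtain ⟨Y, _, _, hY, v, hv, hvU, hva⟩ := (hBsub (U.map φ.toMonoidHom) (by
      obtain ⟨n, hn⟩ := hU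
      exact ⟨n, by rw [← hn]; exact Subgroup.index_map_equiv U φ⟩)).exists_hom_killing
    ((Subgroup.map_subtype_le _).trans hB) (a := φ a) (by
      rintro ⟨_, ⟨c, hc, rfl⟩, h⟩
      exact haU (φ.injective (Subtype.ext h) ▸ hc))
  refine hG.survivesP_of_central_maps (hfr.le.trans hA) (hgr.le.trans hB) hX hY hu hv ?_ hua
  have hle := hmax (v.comp (B.subtype.comp φ.toMonoidHom)).ker
    (fun c hc => hvU _ ⟨_, ⟨c, hc, rfl⟩, rfl⟩) hva
  exact fun c hc => huU _ ⟨c, hle hc, rfl⟩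
end

section
/- Let G = (H * K; A = B, φ) be a free product of two finite p-groups H and K with subgroups A ≤ H, B ≤ K amalgamated via an isomorphism φ. Then G is conjugacy p-separable if and only if G is a residually finite p-group. -/
/-- `a` and `b` have conjugate images under every homomorphism of `G` whose range is a finite
`p`-group. -/
def ConjInPQuotients (p : ℕ) {G : Type} [Group G] (a b : G) : Prop :=
  ∀ (X : Type) [Group X] (ψ : G →* X), Finite ψ.range → IsPGroup p ψ.range →
    ∃ g : G, ψ (g * a * g⁻¹) = ψ b

namespace ConjInPQuotients

variable {p : ℕ} {G : Type} [Group G] {a b a' b' : G}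

theorem symm (h : ConjInPQuotients p a b) : ConjInPQuotients p b a := fun X _ ψ hfin hψ => by
  obtain ⟨g, hg⟩ := h X ψ hfin hψ
  refine ⟨g⁻¹, ?_⟩
  rw [map_mul, map_mul, ← hg]
  simp [mul_assoc]

theorem congr (h : ConjInPQuotients p a b) (ha : IsConj a' a) (hb : IsConj b' b) :
    ConjInPQuotients p a' b' := fun X _ ψ hfin hψ => by
  obtain ⟨g, hg⟩ := h X ψ hfin hψ
  obtain ⟨c, rfl⟩ := isConj_iff.1 ha
  obtain ⟨d, rfl⟩ := isConj_iff.1 hb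
  refine ⟨d⁻¹ * g * c, ?_⟩
  calc ψ (d⁻¹ * g * c * a' * (d⁻¹ * g * c)⁻¹)
      = (ψ d)⁻¹ * ψ (g * (c * a' * c⁻¹) * g⁻¹) * ψ d := by simp [mul_assoc]
    _ = ψ b' := by rw [hg]; simp [mul_assoc]

end ConjInPQuotients

/-- A homomorphism `θ` which is injective on the union of two subgroups `S`, `T` generating `G`,
together with the part of the universal property of an amalgam of `S` and `T` which allows one to
twist `θ` on `S` by an element centralizing `θ S ⊓ θ T`. -/
structure IsTwistable {G P : Type} [Group G] [Group P] (S T : Subgroup G) (θ : G →* P) :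
    Prop where
  sup_eq_top : S ⊔ T = ⊤
  injOn : Set.InjOn θ (S ∪ T)
  extend : ∀ (X : Type) [Group X] (τ : P →* X) (v : X),
    (∀ x ∈ S.map θ ⊓ T.map θ, Commute v (τ x)) →
      ∃ ψ : G →* X, (∀ s ∈ S, ψ s = v * τ (θ s) * v⁻¹) ∧ ∀ t ∈ T, ψ t = τ (θ t)

theorem sum_eq_zero_of_smul_invariant {p : ℕ} [Fact p.Prime] {P Ω : Type} [Group P]
    [MulAction P Ω] [Fintype Ω] (hP : IsPGroup p P) (b : P) (F : Ω → ZMod p)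
    (hF : ∀ ω, F (b • ω) = F ω) (hfix : ∀ ω, b • ω = ω → F ω = 0) : ∑ ω, F ω = 0 := by
  classical
  obtain ⟨n, hn⟩ := hP b
  have key : ∀ v : ZMod p, v ≠ 0 → ((Finset.univ.filter fun ω => F ω = v).card : ZMod p) = 0 := by
    intro v hv
    let f : Function.End {ω // F ω = v} := fun ω => ⟨b • ω.1, by rw [hF]; exact ω.2⟩
    have hpow : ∀ (k : ℕ) (ω : {ω // F ω = v}), ((f ^ k) ω).1 = b ^ k • ω.1 := by
      intro k
      induction k with
      | zero => intro ω; rw [pow_zero, pow_zero, one_smul]; rfl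
      | succ k ih =>
        intro ω
        rw [pow_succ, pow_succ, mul_smul]
        exact ih (f ω)
    have h1 : f ^ p ^ n = 1 := by
      funext ω
      apply Subtype.ext
      rw [hpow, hn, one_smul]
      rfl
    have h2 := Equiv.Perm.card_fixedPoints_modEq h1
    have h3 : IsEmpty (Function.fixedPoints f) := by
      refine ⟨fun ω => hv ?_⟩
      have h4 : b • ω.1.1 = ω.1.1 := congrArg Subtype.val ω.2
      rw [← ω.1.2, hfix _ h4]
    rw [Fintype.card_eq_zero (α := Function.fixedPoints f), Fintype.card_subtype] at h2
    exact (ZMod.natCast_eq_zero_iff _ _).2 ((Nat.modEq_zero_iff_dvd).1 h2)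
  rw [← Finset.sum_fiberwise (g := F)]
  refine Finset.sum_eq_zero fun v _ => ?_
  rw [Finset.sum_congr rfl (g := fun _ => v) (by simp), Finset.sum_const, nsmul_eq_mul]
  rcases eq_or_ne v 0 with rfl | hv
  · simp
  · rw [key v hv, zero_mul]

theorem Subgroup.induction_mul_left_of_sup_eq_top {G : Type} [Group G] {S T : Subgroup G}
    (h : S ⊔ T = ⊤) {motive : G → Prop} (one : motive 1)
    (mul_S : ∀ x ∈ S, ∀ g, motive g → motive (x * g))
    (mul_T : ∀ x ∈ T, ∀ g, motive g → motive (x * g)) (g : G) : motive g := by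
  have hg : g ∈ Subgroup.closure ((S : Set G) ∪ T) := by
    rw [← Subgroup.sup_eq_closure, h]; trivial
  induction hg using Subgroup.closure_induction_left with
  | one => exact one
  | mul_left x hx y _ ih => exact hx.elim (mul_S x · y ih) (mul_T x · y ih)
  | inv_mul_cancel x hx y _ ih =>
    exact hx.elim (fun hx => mul_S _ (inv_mem hx) y ih) (fun hx => mul_T _ (inv_mem hx) y ih)

section Vertex

variable {G P : Type} [Group G] [Group P] {p : ℕ}

/-- The group of `ZMod p`-valued functions on `P ⧸ A`, extended by `P`. -/
abbrev AffineGroup (p : ℕ) {P : Type} [Group P] (A : Subgroup P) : Type :=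
  (P ⧸ A → Multiplicative (ZMod p)) ⋊[mulAutArrow] P

theorem AffineGroup.isPGroup [Fact p.Prime] [Finite P] (hP : IsPGroup p P) (A : Subgroup P) :
    IsPGroup p (AffineGroup p A) := by
  obtain ⟨n, hn⟩ := IsPGroup.iff_card.1 hP
  refine IsPGroup.of_card (n := Nat.card (P ⧸ A) + n) ?_
  rw [SemidirectProduct.card, Nat.card_fun, hn, pow_add,
    Nat.card_congr Multiplicative.toAdd, Nat.card_zmod]

instance AffineGroup.finite [Fact p.Prime] [Finite P] (A : Subgroup P) :
    Finite (AffineGroup p A) :=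
  Finite.of_equiv _ SemidirectProduct.equivProd.symm

/-- The sum of the values of `F` over the chain underlying `x`. -/
noncomputable def AffineGroup.pairing {A : Subgroup P} [Fintype (P ⧸ A)] (x : AffineGroup p A)
    (F : P ⧸ A → ZMod p) : ZMod p :=
  ∑ ω, (x.left ω).toAdd * F ω

namespace AffineGroup

variable {A : Subgroup P}

section Pairing

variable [Fintype (P ⧸ A)]

theorem pairing_mul (x y : AffineGroup p A) (F : P ⧸ A → ZMod p) :
    (x * y).pairing F = x.pairing F + y.pairing fun ω => F (x.right • ω) := by
  simp only [pairing, SemidirectProduct.mul_left, Pi.mul_apply, toAdd_mul, add_mul,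
    Finset.sum_add_distrib, mulAutArrow_apply_apply]
  congr 1
  refine Fintype.sum_equiv (MulAction.toPerm x.right⁻¹) _ _ fun ω => ?_
  simp only [MulAction.toPerm_apply, smul_inv_smul]
  rfl

@[simp]
theorem pairing_inr (g : P) (F : P ⧸ A → ZMod p) :
    pairing (SemidirectProduct.inr g : AffineGroup p A) F = 0 := by
  simp [pairing]

theorem pairing_inv (x : AffineGroup p A) (F : P ⧸ A → ZMod p) :
    x⁻¹.pairing F = - x.pairing fun ω => F (x.right⁻¹ • ω) := by
  have h := pairing_mul x⁻¹ x F
  rw [inv_mul_cancel, ← map_one SemidirectProduct.inr, pairing_inr,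
    SemidirectProduct.inv_right] at h
  exact eq_neg_of_add_eq_zero_left h.symm

end Pairing

open Classical in
/-- The base edge, as a chain. -/
noncomputable def base (p : ℕ) (A : Subgroup P) : AffineGroup p A :=
  SemidirectProduct.inl (Pi.mulSingle ((1 : P) : P ⧸ A) (Multiplicative.ofAdd 1))

theorem pairing_base [Fintype (P ⧸ A)] (F : P ⧸ A → ZMod p) : (base p A).pairing F = F (1 : P) := by
  classical
  rw [pairing, Finset.sum_eq_single ((1 : P) : P ⧸ A)]
  · simp [base]
  · intro ω _ hω
    simp [base, Pi.mulSingle_eq_of_ne hω]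
  · simp

@[simp]
theorem base_right : (base p A).right = 1 := rfl

theorem commute_base_inr {x : P} (hx : x ∈ A) :
    Commute (base p A) (SemidirectProduct.inr x : AffineGroup p A) := by
  classical
  refine SemidirectProduct.ext ?_ (by simp)
  funext ω
  simp only [base, SemidirectProduct.mul_left, SemidirectProduct.left_inl,
    SemidirectProduct.left_inr, SemidirectProduct.right_inr, map_one, mul_one, one_mul,
    mulAutArrow_apply_apply]
  change _ = (Pi.mulSingle ((1 : P) : P ⧸ A) _ : P ⧸ A → Multiplicative (ZMod p)) (x⁻¹ • ω)
  have : x⁻¹ • ω = ((1 : P) : P ⧸ A) ↔ ω = ((1 : P) : P ⧸ A) := by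
    rw [inv_smul_eq_iff]
    have : x • ((1 : P) : P ⧸ A) = ((1 : P) : P ⧸ A) := by
      change ((x * 1 : P) : P ⧸ A) = _
      rw [QuotientGroup.eq]
      simpa using inv_mem hx
    rw [this]
  simp only [Pi.mulSingle_apply, this]

theorem pairing_eq_zero_of_commute [Fintype (P ⧸ A)] [Fact p.Prime] (hP : IsPGroup p P) {b : P}
    {x y : AffineGroup p A}
    (h : x * y = SemidirectProduct.inr b * x) (hy : y.left = 1) (F : P ⧸ A → ZMod p)
    (hF : ∀ ω, F (b • ω) = F ω) (hfix : ∀ ω, b • ω = ω → F ω = 0) : x.pairing F = 0 := by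
  refine sum_eq_zero_of_smul_invariant hP b _ (fun ω => ?_) fun ω hω => by rw [hfix ω hω, mul_zero]
  rw [hF]
  have h1 := congrFun (congrArg SemidirectProduct.left h) (b • ω)
  simp only [SemidirectProduct.mul_left, hy, map_one, mul_one, SemidirectProduct.left_inr, one_mul,
    SemidirectProduct.right_inr, mulAutArrow_apply_apply] at h1
  rw [h1]
  change (x.left (b⁻¹ • b • ω)).toAdd * _ = _
  rw [inv_smul_smul]

/-- The coboundary of a pair of functions on the two types of vertices of the coset graph. -/
noncomputable def coboundary (A : Subgroup P) (f : Bool → P → ZMod p) (ω : P ⧸ A) : ZMod p :=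
  f true ω.out - f false ω.out

theorem coboundary_mk {f : Bool → P → ZMod p} (hf : ∀ i, ∀ y ∈ A, ∀ x, f i (x * y) = f i x)
    (x : P) : coboundary A f x = f true x - f false x := by
  obtain ⟨y, hy⟩ := QuotientGroup.mk_out_eq_mul A x
  rw [coboundary, hy, hf _ _ y.2, hf _ _ y.2]

theorem coboundary_smul {f : Bool → P → ZMod p} (hf : ∀ i, ∀ y ∈ A, ∀ x, f i (x * y) = f i x)
    (g : P) (ω : P ⧸ A) : coboundary A f (g • ω) = coboundary A (fun i x => f i (g * x)) ω := by
  induction ω using QuotientGroup.induction_on with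
  | H x =>
    rw [coboundary_mk fun i y hy x => by rw [← mul_assoc, hf i y hy]]
    exact coboundary_mk hf (g * x)

end AffineGroup

namespace IsTwistable

open AffineGroup

variable {S T : Subgroup G} {θ : G →* P}

theorem exists_mem_of_mem_map_inf (h : IsTwistable S T θ) {x : P} (hx : x ∈ S.map θ ⊓ T.map θ) :
    ∃ d, d ∈ S ∧ d ∈ T ∧ θ d = x := by
  obtain ⟨⟨s, hs, rfl⟩, t, ht, hst⟩ := hx
  have := h.injOn (Or.inr ht) (Or.inl hs) hst
  exact ⟨s, hs, this ▸ ht, rfl⟩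

theorem pairing_coboundary (h : IsTwistable S T θ) [Fintype (P ⧸ (S.map θ ⊓ T.map θ))]
    {ψ : G →* AffineGroup p (S.map θ ⊓ T.map θ)}
    (hS : ∀ s ∈ S, ψ s = base p _ * SemidirectProduct.inr (θ s) * (base p _)⁻¹)
    (hT : ∀ t ∈ T, ψ t = SemidirectProduct.inr (θ t)) (g : G) :
    (ψ g).right = θ g ∧ ∀ f : Bool → P → ZMod p,
      (∀ i, ∀ y ∈ (cond i S T).map θ, ∀ x, f i (x * y) = f i x) →
      (ψ g).pairing (coboundary _ f) = f false (θ g) - f false 1 := by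
  have hA : ∀ f : Bool → P → ZMod p,
      (∀ i, ∀ y ∈ (cond i S T).map θ, ∀ x, f i (x * y) = f i x) →
      ∀ i, ∀ y ∈ S.map θ ⊓ T.map θ, ∀ x, f i (x * y) = f i x := fun f hf i y hy x => by
    cases i
    · exact hf false y hy.2 x
    · exact hf true y hy.1 x
  have step : ∀ x, (ψ x).right = θ x → (∀ f : Bool → P → ZMod p,
      (∀ i, ∀ y ∈ (cond i S T).map θ, ∀ x, f i (x * y) = f i x) →
      (ψ x).pairing (coboundary _ f) = f false (θ x) - f false 1) → ∀ g,
      ((ψ g).right = θ g ∧ ∀ f : Bool → P → ZMod p,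
      (∀ i, ∀ y ∈ (cond i S T).map θ, ∀ x, f i (x * y) = f i x) →
      (ψ g).pairing (coboundary _ f) = f false (θ g) - f false 1) →
      ((ψ (x * g)).right = θ (x * g) ∧ ∀ f : Bool → P → ZMod p,
      (∀ i, ∀ y ∈ (cond i S T).map θ, ∀ x, f i (x * y) = f i x) →
      (ψ (x * g)).pairing (coboundary _ f) = f false (θ (x * g)) - f false 1) := by
    intro x hx1 hx2 g ⟨hg1, hg2⟩
    refine ⟨by rw [map_mul, map_mul, SemidirectProduct.mul_right, hx1, hg1], fun f hf => ?_⟩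
    rw [map_mul, pairing_mul, hx2 f hf]
    simp only [coboundary_smul (hA f hf)]
    rw [hg2 _ fun i y hy z => by rw [← mul_assoc, hf i y hy], hx1, map_mul, mul_one]
    ring
  induction g using Subgroup.induction_mul_left_of_sup_eq_top h.sup_eq_top with
  | one =>
    refine ⟨by simp, fun f _ => ?_⟩
    rw [map_one ψ, map_one θ, sub_self, ← map_one SemidirectProduct.inr, pairing_inr]
  | mul_S s hs g ih =>
    refine step s (by simp [hS s hs]) (fun f hf => ?_) g ih
    rw [hS s hs, pairing_mul, pairing_mul, pairing_inv, pairing_base, pairing_inr, pairing_base]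
    simp only [coboundary_smul (hA f hf), SemidirectProduct.mul_right, base_right, one_mul,
      SemidirectProduct.right_inr]
    rw [inv_one, one_smul, coboundary_mk (hA f hf),
      coboundary_mk (f := fun i x => f i (θ s * x)) fun i y hy z => by
        rw [← mul_assoc, hA f hf i y hy]]
    have := hf true (θ s) ⟨s, hs, rfl⟩ 1
    rw [one_mul] at this
    simp only [mul_one, this]
    ring
  | mul_T t ht g ih =>
    refine step t (by simp [hT t ht]) (fun f hf => ?_) g ih
    have := hf false (θ t) ⟨t, ht, rfl⟩ 1
    rw [one_mul] at this
    rw [hT t ht, pairing_inr, this, sub_self]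

theorem isConj_of_mem [Fact p.Prime] [Finite P] (hP : IsPGroup p P) (h : IsTwistable S T θ)
    {a b : G} {i j : Bool} (ha : a ∈ cond i S T) (hb : b ∈ cond j S T)
    (hab : ConjInPQuotients p a b) : IsConj b a := by
  classical
  have := Fintype.ofFinite (P ⧸ (S.map θ ⊓ T.map θ))
  obtain ⟨ψ, hS, hT⟩ := h.extend (AffineGroup p (S.map θ ⊓ T.map θ)) SemidirectProduct.inr
    (base p _) fun x hx => commute_base_inr hx
  obtain ⟨g, hg⟩ := hab _ ψ inferInstance ((AffineGroup.isPGroup hP _).to_subgroup _)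
  let v : Bool → AffineGroup p (S.map θ ⊓ T.map θ) := fun i => cond i (base p _) 1
  have hv : ∀ i, ∀ x ∈ cond i S T, ψ x = v i * SemidirectProduct.inr (θ x) * (v i)⁻¹ := by
    rintro (_ | _) x hx
    · simpa [v] using hT x hx
    · exact hS x hx
  have hvr : ∀ i, (v i).right = 1 := by rintro (_ | _) <;> rfl
  have hmem : ∀ i, ∀ x ∈ cond i S T, x ∈ (S ∪ T : Set G) := by
    rintro (_ | _) x hx
    exacts [Or.inr hx, Or.inl hx]
  have hright := fun g => (h.pairing_coboundary hS hT g).1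
  have hθ : θ g * θ a = θ b * θ g := by
    have := congrArg SemidirectProduct.right hg
    rw [hright, hright, map_mul, map_mul, map_inv, mul_inv_eq_iff_eq_mul] at this
    exact this
  let f : Bool → P → ZMod p := fun i x =>
    if ∃ c ∈ cond i S T, θ c = x⁻¹ * θ b * x ∧ IsConj c a then 1 else 0
  have hf : ∀ i, ∀ y ∈ (cond i S T).map θ, ∀ x, f i (x * y) = f i x := by
    rintro i _ ⟨y, hy, rfl⟩ x
    refine if_congr ⟨?_, ?_⟩ rfl rfl
    · rintro ⟨c, hc, hcx, hca⟩
      refine ⟨y * c * y⁻¹, mul_mem (mul_mem hy hc) (inv_mem hy), ?_,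
        (isConj_iff.2 ⟨y, rfl⟩ : IsConj c _).symm.trans hca⟩
      rw [map_mul, map_mul, hcx, map_inv]
      group
    · rintro ⟨c, hc, hcx, hca⟩
      refine ⟨y⁻¹ * c * y, mul_mem (mul_mem (inv_mem hy) hc) hy, ?_,
        (isConj_iff.2 ⟨y⁻¹, by simp⟩ : IsConj c _).symm.trans hca⟩
      rw [map_mul, map_mul, hcx, map_inv]
      group
  have hfA : ∀ i, ∀ y ∈ S.map θ ⊓ T.map θ, ∀ x, f i (x * y) = f i x := fun i y hy x => by
    cases i
    · exact hf false y hy.2 x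
    · exact hf true y hy.1 x
  have hfb : ∀ i x, f i (θ b * x) = f i x := fun i x => by
    simp only [f]
    congr! 5
    group
  have hfix : ∀ ω : P ⧸ (S.map θ ⊓ T.map θ), θ b • ω = ω → coboundary _ f ω = 0 := by
    intro ω
    induction ω using QuotientGroup.induction_on with
    | H x =>
      intro hx
      have hx' : x⁻¹ * θ b * x ∈ S.map θ ⊓ T.map θ := by
        have hx1 : ((x : P) : P ⧸ (S.map θ ⊓ T.map θ)) = ((θ b * x : P) : P ⧸ _) := hx.symm
        rw [QuotientGroup.eq] at hx1
        rwa [mul_assoc]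
      obtain ⟨d, hdS, hdT, hd⟩ := h.exists_mem_of_mem_map_inf hx'
      have key : ∀ i, f i x = if IsConj d a then 1 else 0 := by
        intro i
        refine if_congr ⟨?_, fun hda => ⟨d, by cases i <;> assumption, hd, hda⟩⟩ rfl rfl
        rintro ⟨c, hc, hcx, hca⟩
        rwa [h.injOn (Or.inl hdS) (hmem i c hc) (hd.trans hcx.symm)]
      rw [coboundary_mk hfA, key, key, sub_self]
  have hfa : f i (θ g) = 1 := by
    refine if_pos ⟨a, ha, ?_, IsConj.refl a⟩
    rw [mul_assoc, ← hθ, inv_mul_cancel_left]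
  have hpair : ((v j)⁻¹ * ψ g * v i).pairing (coboundary _ f) = 0 := by
    refine pairing_eq_zero_of_commute hP (b := θ b) (y := SemidirectProduct.inr (θ a)) ?_ rfl _
      (fun ω => ?_) hfix
    · rw [map_mul, map_mul, map_inv, hv i a ha, hv j b hb, mul_inv_eq_iff_eq_mul] at hg
      have := congrArg (fun z => (v j)⁻¹ * z * v i) hg
      simpa [mul_assoc] using this
    · rw [coboundary_smul hfA]
      simp only [hfb]
  have hvp : ∀ i, ∀ f : Bool → P → ZMod p, (∀ i, ∀ y ∈ S.map θ ⊓ T.map θ, ∀ x,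
      f i (x * y) = f i x) → (v i).pairing (coboundary _ f) = f i 1 - f false 1 := by
    rintro (_ | _) f hf
    · rw [show v false = SemidirectProduct.inr 1 from rfl, pairing_inr, sub_self]
    · rw [show v true = base p _ from rfl, pairing_base, coboundary_mk hf]
  have hfg : ∀ i, ∀ y ∈ S.map θ ⊓ T.map θ, ∀ x, f i (θ g * (x * y)) = f i (θ g * x) :=
    fun i y hy x => by rw [← mul_assoc, hfA i y hy]
  rw [pairing_mul, pairing_mul, pairing_inv] at hpair
  simp only [SemidirectProduct.mul_right, SemidirectProduct.inv_right, hvr, inv_one, one_mul,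
    one_smul, hright, coboundary_smul hfA] at hpair
  rw [hvp _ _ hfA, hvp _ _ hfg, (h.pairing_coboundary hS hT g).2 f hf, mul_one, hfa] at hpair
  have hfj : f j 1 = 1 := by linear_combination -hpair
  by_contra hba
  refine zero_ne_one (α := ZMod p) ?_
  rw [← hfj]
  refine (if_neg ?_).symm
  rintro ⟨c, hc, hcb, hca⟩
  rw [inv_one, one_mul, mul_one] at hcb
  exact hba (h.injOn (hmem j c hc) (hmem j b hb) hcb ▸ hca)

end IsTwistable

end Vertex

section Alternating

open Polynomial Matrix

theorem one_add_natCast_mul_pow_eq_one {R : Type*} [Ring R] {p s : ℕ} (hR : (p : R) ^ s = 0)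
    (z : R) : (1 + p * z) ^ p ^ s = 1 := by
  have h1 : ((p : ℤ[X]) : ℤ[X]) ∣ (1 + (p : ℤ[X]) * X) - 1 := ⟨X, by ring⟩
  obtain ⟨w, hw⟩ := dvd_sub_pow_of_dvd_sub h1 s
  have h2 := congrArg (aeval z) hw
  simp only [map_sub, map_pow, map_add, map_mul, map_one, map_natCast, aeval_X, one_pow] at h2
  rw [pow_succ, hR, zero_mul, zero_mul] at h2
  exact sub_eq_zero.1 h2

section TraceCoeff

variable {ι : Type} [Fintype ι] [DecidableEq ι]

/-- Evaluation at the scalar `c` of a polynomial with integral matrix coefficients, modulo `N`. -/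
noncomputable def evalMod (ι : Type) [Fintype ι] [DecidableEq ι] (c N : ℕ) :
    (Matrix ι ι ℤ)[X] →+* Matrix ι ι (ZMod N) :=
  eval₂RingHom' (Int.castRingHom (ZMod N)).mapMatrix c fun _ => Nat.commute_cast _ _

theorem trace_evalMod (c N : ℕ) (f : (Matrix ι ι ℤ)[X]) :
    (evalMod ι c N f).trace =
      ((∑ k ∈ Finset.range (f.natDegree + 1), C (f.coeff k).trace * X ^ k : ℤ[X]).eval (c : ℤ) :
        ℤ) := by
  rw [evalMod, eval₂RingHom'_apply, eval₂_eq_sum_range, trace_sum, eval_finsetSum, Int.cast_sum]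
  refine Finset.sum_congr rfl fun k _ => ?_
  rw [eval_mul, eval_C, eval_pow, eval_X, ← Nat.cast_pow, ← nsmul_eq_mul', trace_smul]
  simp [trace, mul_comm]

theorem trace_coeff_eq_zero {p : ℕ} (hp : p.Prime) {f : (Matrix ι ι ℤ)[X]}
    (hf : ∀ j s : ℕ, (evalMod ι (p ^ (j + 1)) (p ^ s) f).trace = 0) (k : ℕ) :
    (f.coeff k).trace = 0 := by
  let t : ℤ[X] := ∑ k ∈ Finset.range (f.natDegree + 1), C (f.coeff k).trace * X ^ k
  have ht : t = 0 := by
    refine eq_of_infinite_eval_eq _ _ (Set.Infinite.mono ?_ (Set.infinite_range_of_injective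
      (f := fun j : ℕ => ((p ^ (j + 1) : ℕ) : ℤ)) fun i j hij => ?_))
    · rintro _ ⟨j, rfl⟩
      have key : ∀ s : ℕ, ((p ^ s : ℕ) : ℤ) ∣ t.eval ((p ^ (j + 1) : ℕ) : ℤ) := fun s => by
        rw [← ZMod.intCast_zmod_eq_zero_iff_dvd, ← trace_evalMod, hf]
      rw [Set.mem_ofPred_eq, eval_zero]
      refine Int.eq_zero_of_abs_lt_dvd (key _) ?_
        (m := ((p ^ (t.eval ((p ^ (j + 1) : ℕ) : ℤ)).natAbs : ℕ) : ℤ))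
      rw [Int.abs_eq_natAbs]
      exact_mod_cast Nat.lt_pow_self hp.one_lt
    · have := Nat.pow_right_injective hp.two_le (Nat.cast_injective hij)
      omega
  have := congrArg (fun t => coeff t k) ht
  simp only [t, finsetSum_coeff, coeff_C_mul_X_pow, coeff_zero, Finset.sum_ite_eq,
    Finset.mem_range] at this
  by_cases hk : k < f.natDegree + 1
  · rwa [if_pos hk] at this
  · rw [coeff_eq_zero_of_natDegree_lt (by omega), trace_zero]

end TraceCoeff

section Twist

variable {P : Type} [Group P] [Fintype P] [DecidableEq P] {Z : Type} [Fintype Z] [DecidableEq Z]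

/-- A multiple of the regular representation of `P`. -/
def regularRep (Z : Type) [Fintype Z] [DecidableEq Z] : P →* Matrix (Z × P) (Z × P) ℤ where
  toFun x := of fun a b => if a = (b.1, x * b.2) then 1 else 0
  map_one' := by
    ext a b
    simp [Matrix.one_apply]
  map_mul' x y := by
    ext a b
    simp [Matrix.mul_apply, mul_assoc]

theorem mul_regularRep_apply (M : Matrix (Z × P) (Z × P) ℤ) (x : P) (a b : Z × P) :
    (M * regularRep Z x) a b = M a (b.1, x * b.2) := by
  simp [Matrix.mul_apply, regularRep]

theorem regularRep_mul_apply (M : Matrix (Z × P) (Z × P) ℤ) (x : P) (a b : Z × P) :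
    (regularRep Z x * M) a b = M (a.1, x⁻¹ * a.2) b := by
  rw [Matrix.mul_apply, Finset.sum_eq_single (a.1, x⁻¹ * a.2)]
  · simp [regularRep]
  · rintro c - hc
    simp only [regularRep, MonoidHom.coe_mk, OneHom.coe_mk, of_apply]
    rw [if_neg, zero_mul]
    rintro rfl
    simp at hc
  · simp

variable {n : ℕ} [NeZero n] {A : Subgroup P} {q : ZMod n → P}

open Classical in
/-- The operator moving from one copy of `A` to the next one along the cyclic word `q`. -/
noncomputable def shiftOp (A : Subgroup P) (q : ZMod n → P) :
    Matrix (ZMod n × P) (ZMod n × P) ℤ :=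
  of fun a b => if a.2 ∈ A ∧ b = (a.1 + 1, a.2 * q a.1) then 1 else 0

theorem shiftOp_mul_self (hq : ∀ s, q s ∉ A) : shiftOp A q * shiftOp A q = 0 := by
  ext a b
  rw [Matrix.mul_apply]
  refine Finset.sum_eq_zero fun c _ => ?_
  simp only [shiftOp, of_apply, mul_ite, mul_one, mul_zero, ← ite_and]
  rw [if_neg]
  rintro ⟨⟨hc, -⟩, ha, rfl⟩
  exact hq _ ((mul_mem_cancel_left ha).1 hc)

theorem commute_shiftOp {x : P} (hx : x ∈ A) : Commute (shiftOp A q) (regularRep _ x) := by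
  ext a b
  rw [mul_regularRep_apply, regularRep_mul_apply]
  have h : (a.2 ∈ A ∧ (b.1, x * b.2) = (a.1 + 1, a.2 * q a.1)) ↔
      (x⁻¹ * a.2 ∈ A ∧ b = (a.1 + 1, x⁻¹ * a.2 * q a.1)) := by
    refine and_congr (mul_mem_cancel_left (inv_mem hx)).symm ?_
    simp only [Prod.ext_iff, mul_assoc, eq_inv_mul_iff_mul_eq]
  classical exact if_congr h rfl rfl

/-- The matrix whose entries count the paths along the cyclic word `q` spelling `L`. -/
noncomputable def pathMatrix (A : Subgroup P) (q : ZMod n → P) (L : List P) :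
    Matrix (ZMod n × P) (ZMod n × P) ℤ :=
  (L.map fun x => shiftOp A q * regularRep _ x).prod

theorem pathMatrix_nil : pathMatrix A q [] = 1 := rfl

theorem pathMatrix_cons (x : P) (L : List P) :
    pathMatrix A q (x :: L) = shiftOp A q * regularRep _ x * pathMatrix A q L := by
  simp [pathMatrix]

theorem shiftOp_mul_regularRep_ne_zero {x : P} {a b : ZMod n × P}
    (h : (shiftOp A q * regularRep (ZMod n) x) a b ≠ 0) :
    a.2 ∈ A ∧ b.1 = a.1 + 1 ∧ x * b.2 = a.2 * q a.1 := by
  rw [mul_regularRep_apply] at h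
  simpa [shiftOp] using h

theorem pathMatrix_nonneg (L : List P) (a b : ZMod n × P) : 0 ≤ pathMatrix A q L a b := by
  induction L generalizing a with
  | nil => rw [pathMatrix_nil, Matrix.one_apply]; positivity
  | cons x L ih =>
    rw [pathMatrix_cons, Matrix.mul_apply]
    refine Finset.sum_nonneg fun c _ => mul_nonneg ?_ (ih c)
    rw [mul_regularRep_apply, shiftOp, of_apply]
    positivity

theorem pathMatrix_range_pos (m : ℕ) (s : ZMod n) :
    0 < pathMatrix A q ((List.range m).map fun i : ℕ => q (s + i)) (s, 1) (s + m, 1) := by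
  induction m generalizing s with
  | zero => simp [pathMatrix_nil]
  | succ m ih =>
    have hs : ∀ i : ℕ, s + ((i + 1 : ℕ) : ZMod n) = s + 1 + i := fun i => by push_cast; ring
    rw [List.range_succ_eq_map, List.map_cons, List.map_map, pathMatrix_cons, Matrix.mul_apply]
    refine lt_of_lt_of_le ?_ (Finset.single_le_sum (fun c _ => ?_) (Finset.mem_univ (s + 1, 1)))
    · refine mul_pos ?_ ?_
      · simp [mul_regularRep_apply, shiftOp]
      · simp only [Function.comp_def, Nat.succ_eq_add_one, hs]
        exact ih (s + 1)
    · refine mul_nonneg ?_ (pathMatrix_nonneg _ _ _)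
      rw [mul_regularRep_apply, shiftOp, of_apply]
      positivity

theorem trace_pathMatrix_range_pos :
    0 < (pathMatrix A q ((List.range n).map fun i : ℕ => q i)).trace := by
  have h := pathMatrix_range_pos (A := A) (q := q) n 0
  simp only [zero_add, CharP.cast_eq_zero] at h
  exact lt_of_lt_of_le h (Finset.single_le_sum (f := fun c => pathMatrix A q _ c c)
    (fun c _ => pathMatrix_nonneg _ _ _) (Finset.mem_univ _))

end Twist

section UnipotentUnit

variable {R : Type} [Ring R]

theorem C_mul_X_mul_self {u : R} (hu : u * u = 0) : C u * X * (C u * X) = 0 := by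
  rw [mul_assoc, ← mul_assoc X, X_mul_C, mul_assoc, ← mul_assoc, ← C_mul, hu, C_0, zero_mul]

/-- The unit `1 + u X`, for `u` of square zero. -/
noncomputable def unipotentUnit (u : R) (hu : u * u = 0) : R[X]ˣ where
  val := 1 + C u * X
  inv := 1 - C u * X
  val_inv := by
    simp [add_mul, mul_sub, C_mul_X_mul_self hu]
  inv_val := by
    simp [sub_mul, mul_add, C_mul_X_mul_self hu]

theorem unipotentUnit_conj_mul (u a b : R) :
    (1 + C u * X) * C a * (1 - C u * X) * C b =
      C (-(u * a * (u * b))) * X ^ 2 + C (u * a * b - a * u * b) * X + C (a * b) := by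
  have hX : ∀ (m : R) (f : R[X]), X * (C m * f) = C m * (X * f) :=
    fun m f => by rw [← mul_assoc, X_mul_C, mul_assoc]
  have hN : ∀ (m : R) (f : R[X]), C (-m) * f = -(C m * f) :=
    fun m f => by rw [C_neg, neg_mul]
  simp only [add_mul, mul_sub, sub_mul, one_mul, mul_one, mul_assoc, hX, X_mul_C, hN, C_sub,
    C_mul, pow_two]
  abel

end UnipotentUnit

namespace IsTwistable

variable {G P : Type} [Group G] [Group P] {S T : Subgroup G} {θ : G →* P}

section Path

variable [Fintype P] [DecidableEq P] {n : ℕ} [NeZero n] {q : ZMod n → G}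

theorem exists_of_pathMatrix_ne_zero (h : IsTwistable S T θ) (hq : ∀ s, q s ∈ (S ∪ T : Set G))
    (L : List G) (hL : ∀ x ∈ L, x ∈ (S ∪ T : Set G)) {a b : ZMod n × P} {d : G}
    (hd : d ∈ S ⊓ T) (hdb : θ d = b.2)
    (hab : pathMatrix (S.map θ ⊓ T.map θ) (fun s => θ (q s)) (L.map θ) a b ≠ 0) :
    ∃ d' ∈ S ⊓ T, θ d' = a.2 ∧
      L.prod * d = d' * ((List.range L.length).map fun i : ℕ => q (a.1 + i)).prod := by
  induction L generalizing a with
  | nil =>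
    obtain rfl : a = b := by
      by_contra hne
      exact hab (Matrix.one_apply_ne hne)
    exact ⟨d, hd, hdb, by simp⟩
  | cons x L ih =>
    rw [List.map_cons, pathMatrix_cons, Matrix.mul_apply] at hab
    obtain ⟨c, -, hc⟩ := Finset.exists_ne_zero_of_sum_ne_zero hab
    obtain ⟨hc1, hc2⟩ := mul_ne_zero_iff.1 hc
    obtain ⟨d₁, hd₁, hdc, hprod⟩ := ih (fun y hy => hL y (List.mem_cons_of_mem _ hy)) hc2
    obtain ⟨haA, hca, hx⟩ := shiftOp_mul_regularRep_ne_zero hc1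
    obtain ⟨d', hdS, hdT, hda⟩ := h.exists_mem_of_mem_map_inf haA
    have hmul : x * d₁ = d' * q a.1 := by
      refine h.injOn ?_ ?_ (by rw [map_mul, map_mul, hdc, hda, hx])
      · exact (hL x List.mem_cons_self).imp (mul_mem · hd₁.1) (mul_mem · hd₁.2)
      · exact (hq a.1).imp (mul_mem hdS ·) (mul_mem hdT ·)
    refine ⟨d', ⟨hdS, hdT⟩, hda, ?_⟩
    have hs : ∀ i : ℕ, a.1 + ((i + 1 : ℕ) : ZMod n) = a.1 + 1 + i := fun i => by push_cast; ring
    rw [List.prod_cons, mul_assoc, hprod, ← mul_assoc, hmul, hca, List.length_cons,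
      List.range_succ_eq_map, List.map_cons, List.map_map, List.prod_cons]
    simp only [Function.comp_def, Nat.succ_eq_add_one, hs, Nat.cast_zero, add_zero, mul_assoc]

theorem isConj_prod_range_add (s : ℕ) :
    IsConj ((List.range n).map fun i : ℕ => q i).prod
      ((List.range n).map fun i : ℕ => q (s + i)).prod := by
  obtain ⟨m, rfl⟩ := Nat.exists_eq_succ_of_ne_zero (NeZero.ne n)
  induction s with
  | zero => simp only [Nat.cast_zero, zero_add, IsConj.refl]
  | succ s ih =>
    refine ih.trans (isConj_iff.2 ⟨(q s)⁻¹, ?_⟩)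
    have hs : ∀ i : ℕ, (s : ZMod (m + 1)) + ((i + 1 : ℕ) : ZMod (m + 1)) = (s + 1 : ℕ) + i :=
      fun i => by push_cast; ring
    have hm : ((s + 1 : ℕ) : ZMod (m + 1)) + m = s := by
      rw [← hs, ZMod.natCast_self, add_zero]
    rw [List.range_succ_eq_map, List.map_cons, List.map_map, List.prod_cons,
      ← List.range_succ_eq_map, List.range_succ, List.map_append, List.prod_append]
    simp only [Function.comp_def, Nat.succ_eq_add_one, hs, List.map_cons, List.map_nil,
      List.prod_cons, List.prod_nil, hm, Nat.cast_zero, add_zero]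
    group

theorem isConj_of_trace_pathMatrix_ne_zero (h : IsTwistable S T θ)
    (hq : ∀ s, q s ∈ (S ∪ T : Set G)) {L : List G} (hL : ∀ x ∈ L, x ∈ (S ∪ T : Set G))
    (hLn : L.length = n)
    (htr : (pathMatrix (S.map θ ⊓ T.map θ) (fun s => θ (q s)) (L.map θ)).trace ≠ 0) :
    IsConj L.prod ((List.range n).map fun i : ℕ => q i).prod := by
  obtain ⟨a, -, ha⟩ := Finset.exists_ne_zero_of_sum_ne_zero htr
  rw [Matrix.diag_apply] at ha
  have haA : a.2 ∈ S.map θ ⊓ T.map θ := by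
    obtain - | ⟨x, L⟩ := L
    · exact absurd hLn.symm (NeZero.ne n)
    · rw [List.map_cons, pathMatrix_cons, Matrix.mul_apply] at ha
      obtain ⟨c, -, hc⟩ := Finset.exists_ne_zero_of_sum_ne_zero ha
      exact (shiftOp_mul_regularRep_ne_zero (mul_ne_zero_iff.1 hc).1).1
  obtain ⟨d, hdS, hdT, hda⟩ := h.exists_mem_of_mem_map_inf haA
  obtain ⟨d', hd', hda', hprod⟩ := h.exists_of_pathMatrix_ne_zero hq L hL ⟨hdS, hdT⟩ hda ha
  obtain rfl : d' = d := h.injOn (Or.inl hd'.1) (Or.inl hdS) (hda'.trans hda.symm)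
  have h1 := isConj_prod_range_add (q := q) a.1.val
  rw [ZMod.natCast_zmod_val] at h1
  rw [hLn] at hprod
  refine (isConj_iff.2 ⟨d'⁻¹, ?_⟩ : IsConj L.prod _).trans h1.symm
  rw [mul_assoc, inv_inv, hprod, inv_mul_cancel_left]

end Path

section Representation

variable {ι : Type} [Fintype ι] [DecidableEq ι] {R : Type} [Ring R]

theorem exists_representation (h : IsTwistable S T θ) (ρ : P →* R) (u : R)
    (hu : u * u = 0) (huρ : ∀ x ∈ S.map θ ⊓ T.map θ, Commute u (ρ x)) :
    ∃ ψ : G →* R[X]ˣ, (∀ g, (ψ g).1.coeff 0 = ρ (θ g)) ∧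
      ∀ s ∈ S, ∀ t ∈ T, (ψ (s * t)).1.natDegree ≤ 2 ∧
        (ψ (s * t)).1.coeff 2 = -(u * ρ (θ s) * (u * ρ (θ t))) := by
  obtain ⟨ψ, hS, hT⟩ := h.extend _ ((Units.map (C : _ →+* R[X]).toMonoidHom).comp ρ.toHomUnits)
    (unipotentUnit u hu) fun x hx => by
      refine Units.ext ?_
      have := congrArg C (huρ x hx).eq
      simp only [C_mul] at this
      simp [unipotentUnit, add_mul, mul_add, mul_assoc, X_mul_C]
      rw [← mul_assoc, this, mul_assoc]
  refine ⟨ψ, fun g => ?_, fun s hs t ht => ?_⟩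
  · induction g using Subgroup.induction_mul_left_of_sup_eq_top h.sup_eq_top with
    | one => simp
    | mul_S x hx g ih =>
      rw [map_mul, Units.val_mul, mul_coeff_zero, ih, hS x hx]
      simp [unipotentUnit, mul_coeff_zero]
    | mul_T x hx g ih =>
      rw [map_mul, Units.val_mul, mul_coeff_zero, ih, hT x hx]
      simp
  · have hst : (ψ (s * t)).1 =
        (1 + C u * X) * C (ρ (θ s)) * (1 - C u * X) * C (ρ (θ t)) := by
      rw [map_mul, hS s hs, hT t ht]
      rfl
    rw [hst, unipotentUnit_conj_mul]
    refine ⟨natDegree_quadratic_le, ?_⟩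
    generalize -(u * ρ (θ s) * (u * ρ (θ t))) = m
    simp

theorem isPGroup_range_evalMod {p : ℕ} (hP : IsPGroup p P) {ρ : P →* Matrix ι ι ℤ}
    {ψ : G →* (Matrix ι ι ℤ)[X]ˣ} (hψ : ∀ g, (ψ g).1.coeff 0 = ρ (θ g)) (j s : ℕ) :
    IsPGroup p ((Units.map (evalMod ι (p ^ (j + 1)) (p ^ s)).toMonoidHom).comp ψ).range := by
  rintro ⟨_, g, rfl⟩
  obtain ⟨m, hm⟩ := hP (θ g)
  have h1 : (ψ (g ^ p ^ m)).1.coeff 0 = 1 := by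
    rw [hψ, map_pow, hm, map_one]
  have h2 := divX_mul_X_add (ψ (g ^ p ^ m)).1
  rw [h1, C_1] at h2
  have h3 : evalMod ι (p ^ (j + 1)) (p ^ s) (ψ (g ^ p ^ m)).1 = 1 + p *
      (p ^ j * evalMod ι (p ^ (j + 1)) (p ^ s) (divX (ψ (g ^ p ^ m)).1)) := by
    have hX : evalMod ι (p ^ (j + 1)) (p ^ s) X = (p : Matrix ι ι (ZMod (p ^ s))) ^ (j + 1) := by
      rw [evalMod, eval₂RingHom'_apply, eval₂_X, Nat.cast_pow]
    conv_lhs => rw [← h2]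
    rw [map_add, map_mul, map_one, add_comm, hX, ← mul_assoc, ← pow_succ',
      ((Nat.cast_commute p _).pow_left _).eq]
  have h4 := one_add_natCast_mul_pow_eq_one (R := Matrix ι ι (ZMod (p ^ s))) (p := p) (s := s) ?_
    (p ^ j * evalMod ι (p ^ (j + 1)) (p ^ s) (divX (ψ (g ^ p ^ m)).1))
  · rw [← h3, ← map_pow, ← Units.val_pow_eq_pow_val, ← map_pow, ← pow_mul, ← pow_add] at h4
    refine ⟨m + s, Subtype.ext ?_⟩
    change (Units.map (evalMod ι (p ^ (j + 1)) (p ^ s)).toMonoidHom).comp ψ g ^ p ^ (m + s) = 1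
    rw [← map_pow]
    exact Units.ext h4
  · rw [← Nat.cast_pow, ← Matrix.diagonal_natCast, ZMod.natCast_self]
    exact Matrix.diagonal_zero

theorem trace_coeff_eq_of_conjInPQuotients {p : ℕ} (hp : p.Prime) (hP : IsPGroup p P)
    {ρ : P →* Matrix ι ι ℤ}
    {ψ : G →* (Matrix ι ι ℤ)[X]ˣ} (hψ : ∀ g, (ψ g).1.coeff 0 = ρ (θ g)) {a b : G}
    (hab : ConjInPQuotients p a b) (k : ℕ) :
    ((ψ a).1.coeff k).trace = ((ψ b).1.coeff k).trace := by
  rw [← sub_eq_zero, ← trace_sub, ← coeff_sub]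
  refine trace_coeff_eq_zero hp (fun j s => ?_) k
  have : NeZero (p ^ s) := ⟨pow_ne_zero s hp.ne_zero⟩
  obtain ⟨g, hg⟩ := hab _ ((Units.map (evalMod ι (p ^ (j + 1)) (p ^ s)).toMonoidHom).comp ψ)
    inferInstance (isPGroup_range_evalMod hP hψ j s)
  rw [map_mul, map_mul, map_inv] at hg
  have := congrArg (fun x => x.1.trace) hg
  simp only [Units.val_mul] at this
  rw [trace_units_conj] at this
  rw [map_sub, trace_sub, sub_eq_zero]
  exact this

end Representation

theorem isConj_of_alternating [Finite P] {p : ℕ} (hp : p.Prime) (hP : IsPGroup p P)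
    (h : IsTwistable S T θ) {L M : List (G × G)} (hL : L ≠ [])
    (hLST : ∀ x ∈ L, (x.1 ∈ S ∧ x.1 ∉ T) ∧ x.2 ∈ T ∧ x.2 ∉ S)
    (hMST : ∀ x ∈ M, x.1 ∈ S ∧ x.2 ∈ T) (hML : M.length ≤ L.length)
    (hab : ConjInPQuotients p (L.map fun x => x.1 * x.2).prod (M.map fun x => x.1 * x.2).prod) :
    IsConj (M.map fun x => x.1 * x.2).prod (L.map fun x => x.1 * x.2).prod := by
  classical
  have := Fintype.ofFinite P
  let W : List (G × G) → List G := fun L => L.flatMap fun x => [x.1, x.2]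
  have hWcons : ∀ x L, W (x :: L) = x.1 :: x.2 :: W L := fun _ _ => rfl
  have hW : ∀ L, (W L).prod = (L.map fun x => x.1 * x.2).prod := fun L => by
    induction L with
    | nil => rfl
    | cons x L ih => simp [hWcons, ih, mul_assoc]
  have hWlen : ∀ L, (W L).length = L.length * 2 := fun L => by
    simp [W]
  have : NeZero (W L).length := ⟨by rw [hWlen]; simpa using hL⟩
  have hWmem : ∀ M y, y ∈ W M → ∃ x ∈ M, y = x.1 ∨ y = x.2 := fun M y hy => by
    simpa [W] using hy
  have hWM : ∀ y ∈ W M, y ∈ (S ∪ T : Set G) := fun y hy => by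
    obtain ⟨x, hx, rfl | rfl⟩ := hWmem M y hy
    exacts [Or.inl (hMST x hx).1, Or.inr (hMST x hx).2]
  have hWL : ∀ y ∈ W L, y ∈ (S ∪ T : Set G) ∧ θ y ∉ S.map θ ⊓ T.map θ := fun y hy => by
    have hyA : y ∈ (S ∪ T : Set G) → y ∉ S ⊓ T → θ y ∉ S.map θ ⊓ T.map θ := fun hy hyST hyA => by
      obtain ⟨d, hdS, hdT, hd⟩ := h.exists_mem_of_mem_map_inf hyA
      exact hyST (h.injOn (Or.inl hdS) hy hd ▸ ⟨hdS, hdT⟩)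
    obtain ⟨x, hx, rfl | rfl⟩ := hWmem L y hy
    · exact ⟨Or.inl (hLST x hx).1.1, hyA (Or.inl (hLST x hx).1.1) fun h => (hLST x hx).1.2 h.2⟩
    · exact ⟨Or.inr (hLST x hx).2.1, hyA (Or.inr (hLST x hx).2.1) fun h => (hLST x hx).2.2 h.1⟩
  let q : ZMod (W L).length → G := fun s => (W L)[s.val]'(ZMod.val_lt s)
  have hq : (List.range (W L).length).map (fun i : ℕ => q i) = W L := by
    refine List.ext_getElem (by simp) fun i h1 h2 => ?_
    simp [q, Nat.mod_eq_of_lt h2]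
  have hqmem : ∀ s, q s ∈ W L := fun s => List.getElem_mem _
  let A := S.map θ ⊓ T.map θ
  let u := shiftOp A fun s => θ (q s)
  obtain ⟨ψ, hψ0, hψ2⟩ := h.exists_representation (regularRep (ZMod (W L).length)) u
    (shiftOp_mul_self fun s => (hWL _ (hqmem s)).2) fun x hx => commute_shiftOp hx
  have hcoeff : ∀ M : List (G × G), (∀ x ∈ M, x.1 ∈ S ∧ x.2 ∈ T) →
      (ψ (M.map fun x => x.1 * x.2).prod).1.natDegree ≤ M.length * 2 ∧
      (ψ (M.map fun x => x.1 * x.2).prod).1.coeff (M.length * 2) =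
        (-1 : ℤ) ^ M.length • pathMatrix A (fun s => θ (q s)) ((W M).map θ) := by
    intro M hM
    induction M with
    | nil => simp [W, pathMatrix_nil]
    | cons x M ih =>
      obtain ⟨h1, h2⟩ := ih fun y hy => hM y (List.mem_cons_of_mem _ hy)
      obtain ⟨hx1, hx2⟩ := hM x List.mem_cons_self
      obtain ⟨h3, h4⟩ := hψ2 x.1 hx1 x.2 hx2
      rw [List.map_cons, List.prod_cons, map_mul, Units.val_mul, List.length_cons, Nat.succ_mul,
        add_comm]
      refine ⟨natDegree_mul_le.trans (add_le_add h3 h1), ?_⟩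
      rw [coeff_mul_add_eq_of_natDegree_le h3 h1, h4, h2]
      rw [hWcons, List.map_cons, List.map_cons, pathMatrix_cons, pathMatrix_cons, pow_succ,
        mul_neg_one, neg_smul, mul_smul_comm, Matrix.neg_mul, smul_neg]
      simp only [mul_assoc, u, A]
  have hLcoeff := (hcoeff L fun x hx => ⟨(hLST x hx).1.1, (hLST x hx).2.1⟩).2
  have htr := trace_coeff_eq_of_conjInPQuotients hp hP hψ0 hab (L.length * 2)
  have hsign : (-1 : ℤ) ^ L.length ≠ 0 := pow_ne_zero _ (by decide)
  have hpos := trace_pathMatrix_range_pos (A := A) (q := fun s => θ (q s))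
  have hq' : (List.range (W L).length).map (fun i : ℕ => θ (q i)) = (W L).map θ := by
    conv_rhs => rw [← hq, List.map_map]
    rfl
  rw [hq'] at hpos
  have htrM : (ψ (M.map fun x => x.1 * x.2).prod).1.coeff (L.length * 2) ≠ 0 := by
    intro h0
    rw [h0, hLcoeff, trace_zero, trace_smul] at htr
    exact smul_ne_zero hsign hpos.ne' htr
  have hlen : M.length = L.length := by
    by_contra hne
    exact htrM (coeff_eq_zero_of_natDegree_lt (lt_of_le_of_lt (hcoeff M hMST).1 (by omega)))
  rw [← hW, ← hW, ← hq]
  refine h.isConj_of_trace_pathMatrix_ne_zero (fun s => (hWL _ (hqmem s)).1) hWM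
    (by rw [hWlen, hWlen, hlen]) fun h0 => ?_
  rw [hLcoeff, ← hlen, (hcoeff M hMST).2, hlen, trace_smul, trace_smul, h0, smul_zero] at htr
  exact smul_ne_zero hsign hpos.ne' htr

end IsTwistable

end Alternating

section Reduction

variable {G : Type} [Group G] {S T : Subgroup G}

/-- `x` and `y` lie in different factors `S` and `T`, and outside of `S ⊓ T`. -/
def IsAlternating (S T : Subgroup G) (x y : G) : Prop :=
  (x ∈ S ∧ x ∉ T) ∧ (y ∈ T ∧ y ∉ S) ∨ (x ∈ T ∧ x ∉ S) ∧ (y ∈ S ∧ y ∉ T)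

theorem exists_pairs_of_isChain : ∀ W : List G, W.IsChain (IsAlternating S T) →
    (∀ x ∈ W.head?, x ∈ S) → (∀ x ∈ W.getLast?, x ∉ S) →
    ∃ L : List (G × G), (∀ x ∈ L, (x.1 ∈ S ∧ x.1 ∉ T) ∧ x.2 ∈ T ∧ x.2 ∉ S) ∧
      (L.map fun x => x.1 * x.2).prod = W.prod ∧ W.length = L.length * 2
  | [], _, _, _ => ⟨[], by simp⟩
  | [x], _, hS, hlast => absurd (hS x rfl) (hlast x rfl)
  | x :: y :: W, hW, hS, hlast => by
    rw [List.isChain_cons_cons] at hW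
    have hx : x ∈ S := hS x rfl
    have hxy : (x ∈ S ∧ x ∉ T) ∧ (y ∈ T ∧ y ∉ S) := hW.1.resolve_right fun h => h.1.2 hx
    obtain ⟨L, hL, hprod, hlen⟩ := exists_pairs_of_isChain W hW.2.of_cons
      (fun z hz => by
        obtain ⟨W, rfl⟩ := List.head?_eq_some_iff.1 hz
        exact ((List.isChain_cons_cons.1 hW.2).1.resolve_left fun h => hxy.2.2 h.1.1).2.1)
      (fun z hz => hlast z (by
        obtain - | ⟨w, W⟩ := W
        · simp at hz
        · simpa [List.getLast?_cons_cons] using hz))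
    refine ⟨(x, y) :: L, ?_, by simp [hprod, mul_assoc], by simp [hlen]; ring⟩
    rintro z (_ | ⟨_, hz⟩)
    exacts [hxy, hL z hz]

theorem exists_isConj_prod_pairs (h : S ⊔ T = ⊤) (g : G) :
    (∃ x ∈ (S ∪ T : Set G), IsConj x g) ∨ ∃ L : List (G × G), L ≠ [] ∧
      (∀ x ∈ L, (x.1 ∈ S ∧ x.1 ∉ T) ∧ x.2 ∈ T ∧ x.2 ∉ S) ∧
      IsConj (L.map fun x => x.1 * x.2).prod g := by
  classical
  let IsWord : List G → Prop := fun W => (∀ x ∈ W, x ∈ (S ∪ T : Set G)) ∧ IsConj W.prod g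
  have hex : ∃ n W, IsWord W ∧ W.length = n := by
    have : ∃ W : List G, (∀ x ∈ W, x ∈ (S ∪ T : Set G)) ∧ W.prod = g := by
      have step : ∀ x ∈ (S ∪ T : Set G), ∀ g,
          (∃ W : List G, (∀ x ∈ W, x ∈ (S ∪ T : Set G)) ∧ W.prod = g) →
          ∃ W : List G, (∀ x ∈ W, x ∈ (S ∪ T : Set G)) ∧ W.prod = x * g := by
        rintro x hx _ ⟨W, hW, rfl⟩
        exact ⟨x :: W, List.forall_mem_cons.2 ⟨hx, hW⟩, rfl⟩
      induction g using Subgroup.induction_mul_left_of_sup_eq_top h with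
      | one => exact ⟨[], by simp⟩
      | mul_S x hx g ih => exact step x (Or.inl hx) g ih
      | mul_T x hx g ih => exact step x (Or.inr hx) g ih
    obtain ⟨W, hW, rfl⟩ := this
    exact ⟨_, W, ⟨hW, IsConj.refl _⟩, rfl⟩
  obtain ⟨W, hW, hWn⟩ := Nat.find_spec hex
  have hmin : ∀ V, IsWord V → W.length ≤ V.length := fun V hV =>
    hWn ▸ Nat.find_min' hex ⟨V, hV, rfl⟩
  have hchain : ∀ V, IsWord V → V.length = W.length → V.IsChain (IsAlternating S T) := by
    intro V hV hVn
    rw [List.isChain_iff_forall_rel_of_append_cons_cons]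
    rintro x y l₁ l₂ rfl
    by_contra hxy
    have hx := hV.1 x (by simp)
    have hy := hV.1 y (by simp)
    have hmul : x * y ∈ (S ∪ T : Set G) := by
      by_contra hmul
      have h1 : ¬ (x ∈ S ∧ y ∈ S) := fun h => hmul (Or.inl (mul_mem h.1 h.2))
      have h2 : ¬ (x ∈ T ∧ y ∈ T) := fun h => hmul (Or.inr (mul_mem h.1 h.2))
      change x ∈ S ∨ x ∈ T at hx
      change y ∈ S ∨ y ∈ T at hy
      unfold IsAlternating at hxy
      tauto
    have := hmin (l₁ ++ (x * y) :: l₂) ⟨fun z hz => ?_, by simpa [mul_assoc] using hV.2⟩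
    · simp at this hVn
      omega
    · rw [List.mem_append, List.mem_cons] at hz
      obtain hz | rfl | hz := hz
      exacts [hV.1 z (by simp [hz]), hmul, hV.1 z (by simp [hz])]
  have hpairs : ∀ V, IsWord V → V.length = W.length → V ≠ [] → (∀ x ∈ V.head?, x ∈ S) →
      (∀ x ∈ V.getLast?, x ∉ S) → ∃ L : List (G × G), L ≠ [] ∧
      (∀ x ∈ L, (x.1 ∈ S ∧ x.1 ∉ T) ∧ x.2 ∈ T ∧ x.2 ∉ S) ∧
      IsConj (L.map fun x => x.1 * x.2).prod g := by
    intro V hV hVn hne hhead hlast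
    obtain ⟨L, hL, hprod, hlen⟩ := exists_pairs_of_isChain V (hchain V hV hVn) hhead hlast
    refine ⟨L, ?_, hL, hprod ▸ hV.2⟩
    rintro rfl
    exact hne (List.length_eq_zero_iff.1 (by simpa using hlen))
  obtain - | ⟨x, W⟩ := W
  · exact Or.inl ⟨1, Or.inl (one_mem S), hW.2⟩
  obtain rfl | ⟨V, z, rfl⟩ := List.eq_nil_or_concat W
  · exact Or.inl ⟨x, hW.1 x (by simp), by simpa using hW.2⟩
  rw [List.concat_eq_append] at *
  have hrot : IsWord (V ++ [z, x]) := by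
    refine ⟨fun y hy => hW.1 y (by simp at hy ⊢; tauto), IsConj.trans ?_ hW.2⟩
    exact isConj_iff.2 ⟨x, by simp [mul_assoc]⟩
  have hzx := (List.isChain_append_cons_cons.1 (hchain _ hrot (by simp))).2.1
  right
  by_cases hx : x ∈ S
  · refine hpairs _ hW rfl (by simp) (by simpa) fun y hy => ?_
    obtain rfl : z = y := by
      rw [← List.cons_append, List.getLast?_concat] at hy
      exact Option.some_inj.1 hy
    exact (hzx.resolve_left fun h => h.2.2 hx).1.2
  · refine hpairs _ hrot (by simp) (by simp) ?_ (by simpa [List.getLast?_append] using hx)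
    have hV := hchain _ hW rfl
    intro y hy
    have hxy : IsAlternating S T x y := by
      obtain - | ⟨w, V⟩ := V
      · obtain rfl : z = y := by simpa using hy
        exact (List.isChain_cons_cons.1 hV).1
      · obtain rfl : w = y := by simpa using hy
        exact (List.isChain_cons_cons.1 hV).1
    exact (hxy.resolve_left fun h => hx h.1.1).2.1

theorem IsTwistable.isConj_of_conjInPQuotients {P : Type} [Group P] [Finite P] {θ : G →* P} {p : ℕ}
    (hp : p.Prime) (hP : IsPGroup p P) (h : IsTwistable S T θ) {a b : G}
    (hab : ConjInPQuotients p a b) : IsConj a b := by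
  have : Fact p.Prime := ⟨hp⟩
  have hyp : ∀ {c : G}, c ∈ (S ∪ T : Set G) → ∃ M : List (G × G), M.length = 1 ∧
      (∀ x ∈ M, x.1 ∈ S ∧ x.2 ∈ T) ∧ (M.map fun x => x.1 * x.2).prod = c := by
    rintro c (hc | hc)
    · exact ⟨[(c, 1)], by simpa using hc⟩
    · exact ⟨[(1, c)], by simpa using hc⟩
  have hcond : ∀ {c : G}, c ∈ (S ∪ T : Set G) → ∃ i, c ∈ cond i S T := by
    rintro c (hc | hc)
    exacts [⟨true, hc⟩, ⟨false, hc⟩]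
  obtain ⟨x, hx, hxa⟩ | ⟨L, hL, hLST, hLa⟩ := exists_isConj_prod_pairs h.sup_eq_top a
  · obtain ⟨y, hy, hyb⟩ | ⟨M, hM, hMST, hMb⟩ := exists_isConj_prod_pairs h.sup_eq_top b
    · obtain ⟨i, hi⟩ := hcond hx
      obtain ⟨j, hj⟩ := hcond hy
      exact hxa.symm.trans ((h.isConj_of_mem hP hi hj (hab.congr hxa hyb)).symm.trans hyb)
    · obtain ⟨N, hN, hNST, rfl⟩ := hyp hx
      exact hxa.symm.trans ((h.isConj_of_alternating hp hP hM hMST hNST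
        (hN ▸ List.length_pos_iff.2 hM) (hab.congr hxa hMb).symm).trans hMb)
  · obtain ⟨M, hMST, hMb, hlt⟩ : ∃ M : List (G × G), (∀ x ∈ M, x.1 ∈ S ∧ x.2 ∈ T) ∧
        IsConj (M.map fun x => x.1 * x.2).prod b ∧ (L.length < M.length →
          M ≠ [] ∧ ∀ x ∈ M, (x.1 ∈ S ∧ x.1 ∉ T) ∧ x.2 ∈ T ∧ x.2 ∉ S) := by
      obtain ⟨y, hy, hyb⟩ | ⟨M, hM, hMST, hMb⟩ := exists_isConj_prod_pairs h.sup_eq_top b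
      · obtain ⟨N, hN, hNST, rfl⟩ := hyp hy
        exact ⟨N, hNST, hyb, fun hlt => absurd (List.length_pos_iff.2 hL) (by omega)⟩
      · exact ⟨M, fun x hx => ⟨(hMST x hx).1.1, (hMST x hx).2.1⟩, hMb, fun _ => ⟨hM, hMST⟩⟩
    have hab' := hab.congr hLa hMb
    refine hLa.symm.trans (IsConj.trans ?_ hMb)
    obtain hML | hLM := le_or_gt M.length L.length
    · exact (h.isConj_of_alternating hp hP hL hLST hMST hML hab').symm
    · exact h.isConj_of_alternating hp hP (hlt hLM).1 (hlt hLM).2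
        (fun x hx => ⟨(hLST x hx).1.1, (hLST x hx).2.1⟩) hLM.le hab'.symm

end Reduction

theorem IsPGroup.prod {p : ℕ} {X Y : Type*} [Group X] [Group Y] (hX : IsPGroup p X)
    (hY : IsPGroup p Y) : IsPGroup p (X × Y) := by
  rintro ⟨x, y⟩
  obtain ⟨m, hm⟩ := hX x
  obtain ⟨n, hn⟩ := hY y
  exact ⟨m + n, by rw [Prod.pow_mk, pow_add, pow_mul, pow_mul', hm, hn, one_pow, one_pow]; rfl⟩

theorem ResidP.exists_ne_one {p : ℕ} {G : Type} [Group G] (h : ResidP p G) (F : Finset G)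
    (hF : 1 ∉ F) : ∃ (P : Type) (_ : Group P), Finite P ∧ IsPGroup p P ∧
      ∃ θ : G →* P, ∀ g ∈ F, θ g ≠ 1 := by
  classical
  induction F using Finset.induction_on with
  | empty => exact ⟨Unit, inferInstance, inferInstance, fun x => ⟨0, rfl⟩, 1, by simp⟩
  | insert g F _ ih =>
    rw [Finset.mem_insert, not_or] at hF
    obtain ⟨P, _, _, hP, θ, hθ⟩ := ih hF.2
    obtain ⟨X, _, _, hX, φ, -, hφ⟩ := h g (Ne.symm hF.1)
    refine ⟨P × X, inferInstance, inferInstance, hP.prod hX, θ.prod φ, fun x hx h => ?_⟩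
    obtain ⟨h1, h2⟩ := Prod.mk.inj h
    obtain rfl | hx := Finset.mem_insert.1 hx
    exacts [hφ h2, hθ x hx h1]

theorem ResidP.exists_injOn {p : ℕ} {G : Type} [Group G] (h : ResidP p G) {s : Set G}
    (hs : s.Finite) : ∃ (P : Type) (_ : Group P), Finite P ∧ IsPGroup p P ∧
      ∃ θ : G →* P, Set.InjOn θ s := by
  classical
  obtain ⟨P, _, hPfin, hP, θ, hθ⟩ := h.exists_ne_one
    (((hs.toFinset ×ˢ hs.toFinset).image fun x => x.1⁻¹ * x.2).erase 1) (by simp)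
  refine ⟨P, _, hPfin, hP, θ, fun x hx y hy hxy => ?_⟩
  by_contra hne
  refine hθ (x⁻¹ * y) ?_ (by rw [map_mul, map_inv, hxy, inv_mul_cancel])
  refine Finset.mem_erase.2
    ⟨fun h => hne (inv_mul_eq_one.1 h), Finset.mem_image.2 ⟨(x, y), ?_, rfl⟩⟩
  simpa using ⟨hx, hy⟩

theorem ConjPSep.residP {p : ℕ} {G : Type} [Group G] (h : ConjPSep p G) : ResidP p G := by
  intro g hg
  obtain ⟨X, _, hXfin, hX, φ, hφ, hconj⟩ := h g 1 fun h => hg (isConj_one_left.1 h)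
  exact ⟨X, _, hXfin, hX, φ, hφ, fun h1 => hconj (by rw [h1, map_one])⟩

theorem conjPSep_of_conjInPQuotients {p : ℕ} {G : Type} [Group G]
    (h : ∀ a b : G, ConjInPQuotients p a b → IsConj a b) : ConjPSep p G := by
  intro a b hab
  by_contra hsep
  refine hab (h a b fun X _ ψ _ hψ => ?_)
  by_contra hne
  refine hsep ⟨ψ.range, inferInstance, inferInstance, hψ, ψ.rangeRestrict,
    ψ.rangeRestrict_surjective, fun hconj => hne ?_⟩
  obtain ⟨⟨_, g, rfl⟩, hg⟩ := isConj_iff.1 hconj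
  exact ⟨g, by simpa using congrArg Subtype.val hg⟩

theorem IsPushout.isTwistable {A H K G P : Type} [Group A] [Group H] [Group K] [Group G] [Group P]
    {f : A →* H} {g : A →* K} {ιH : H →* G} {ιK : K →* G} (h : IsPushout f g ιH ιK) {θ : G →* P}
    (hθ : Set.InjOn θ (ιH.range ∪ ιK.range)) : IsTwistable ιH.range ιK.range θ where
  sup_eq_top := by
    let N := ιH.range ⊔ ιK.range
    have hH : ∀ x, ιH x ∈ N := fun x => Subgroup.mem_sup_left ⟨x, rfl⟩
    have hK : ∀ x, ιK x ∈ N := fun x => Subgroup.mem_sup_right ⟨x, rfl⟩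
    obtain ⟨r, ⟨hrH, hrK⟩, -⟩ := h.2 N (ιH.codRestrict N hH) (ιK.codRestrict N hK)
      fun a => Subtype.ext (h.1 a)
    have hid : N.subtype.comp r = MonoidHom.id G :=
      (h.2 G ιH ιK h.1).unique ⟨by rw [MonoidHom.comp_assoc, hrH]; rfl,
        by rw [MonoidHom.comp_assoc, hrK]; rfl⟩ ⟨rfl, rfl⟩
    refine eq_top_iff.2 fun x _ => ?_
    rw [← MonoidHom.id_apply G x, ← hid]
    exact (r x).2
  injOn := hθ
  extend X _ τ v hv := by
    obtain ⟨ψ, ⟨hψH, hψK⟩, -⟩ := h.2 X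
      ((MulAut.conj v).toMonoidHom.comp (τ.comp (θ.comp ιH))) (τ.comp (θ.comp ιK)) fun a => by
        have ha := hv (θ (ιH (f a)))
          ⟨⟨_, ⟨f a, rfl⟩, rfl⟩, ⟨_, ⟨g a, rfl⟩, by rw [h.1]⟩⟩
        simp [ha.eq, ← h.1]
    refine ⟨ψ, ?_, ?_⟩
    · rintro _ ⟨x, rfl⟩
      exact DFunLike.congr_fun hψH x
    · rintro _ ⟨x, rfl⟩
      exact DFunLike.congr_fun hψK x

/-- Theorem 1: an amalgamated free product of two finite `p`-groups is conjugacy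
`p`-separable if and only if it is a residually finite `p`-group. -/
theorem conjPSep_iff_residP_amalgam_of_finite_pGroups (p : ℕ) (hp : p.Prime)
    {H K G : Type} [Group H] [Group K] [Group G]
    [Finite H] [Finite K] (hHp : IsPGroup p H) (hKp : IsPGroup p K)
    (A : Subgroup H) (B : Subgroup K) (φ : A ≃* B)
    (ιH : H →* G) (ιK : K →* G) (hG : IsAmalgam A B φ ιH ιK) :
    ConjPSep p G ↔ ResidP p G := by
  refine ⟨ConjPSep.residP, fun h => conjPSep_of_conjInPQuotients fun a b hab => ?_⟩
  obtain ⟨P, _, _, hP, θ, hθ⟩ := h.exists_injOn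
    ((Set.finite_range ιH).union (Set.finite_range ιK))
  have hθ' : IsTwistable ιH.range ιK.range θ := IsPushout.isTwistable hG (by simpa using hθ)
  exact hθ'.isConj_of_conjInPQuotients hp hP hab
end

section
/- Suppose H and K are conjugacy p-separable groups, A ≤ Z(H) and B ≤ Z(K) are central subgroups, φ : A → B is an isomorphism, and every subgroup of finite p-power index of A (including A itself) is p-separable in H and similarly for B in K. Then the amalgamated free product G = (H * K; A = B, φ) is conjugacy p-separable. -/
/-- Some finite `p`-quotient of `G` separates the conjugacy classes of `a` and `b`. -/
def PConjSeparated (p : ℕ) {G : Type} [Group G] (a b : G) : Prop :=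
  ∃ (X : Type) (_ : Group X), Finite X ∧ IsPGroup p X ∧
    ∃ φ : G →* X, Function.Surjective φ ∧ ¬ IsConj (φ a) (φ b)

section Separation

variable {p : ℕ} {G : Type} [Group G]

theorem PConjSeparated.of_range {Y : Type} [Group Y] {a b : G} (f : G →* Y) [Finite f.range]
    (hf : IsPGroup p f.range) (h : ¬ IsConj (f a) (f b)) : PConjSeparated p a b :=
  ⟨f.range, inferInstance, inferInstance, hf, f.rangeRestrict, f.rangeRestrict_surjective,
    fun hc => h (f.range.subtype.map_isConj hc)⟩

theorem PConjSeparated.of_hom {Y : Type} [Group Y] [Finite Y] (hY : IsPGroup p Y) {a b : G}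
    (f : G →* Y) (h : ¬ IsConj (f a) (f b)) : PConjSeparated p a b :=
  .of_range f (hY.to_subgroup _) h

theorem PConjSeparated.symm {a b : G} (h : PConjSeparated p a b) : PConjSeparated p b a := by
  obtain ⟨X, _, h1, h2, f, h3, h4⟩ := h
  exact ⟨X, _, h1, h2, f, h3, fun h => h4 h.symm⟩

theorem PConjSeparated.congr {a b a' b' : G} (ha : IsConj a a') (hb : IsConj b b')
    (h : PConjSeparated p a' b') : PConjSeparated p a b := by
  obtain ⟨X, _, h1, h2, f, h3, h4⟩ := h
  exact ⟨X, _, h1, h2, f, h3, fun h => h4 <|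
    ((f.map_isConj ha).symm.trans h).trans (f.map_isConj hb)⟩

/-- Some finite `p`-quotient of `G` maps `d` outside of the image of `S`. -/
def PSeparatedFrom (p : ℕ) {G : Type} [Group G] (d : G) (S : Subgroup G) : Prop :=
  ∃ (X : Type) (_ : Group X), Finite X ∧ IsPGroup p X ∧ ∃ φ : G →* X, φ d ∉ S.map φ

theorem isPGroup_pi [Fact p.Prime] {I : Type} [Finite I] {X : I → Type} [∀ i, Group (X i)]
    [∀ i, Finite (X i)] (h : ∀ i, IsPGroup p (X i)) : IsPGroup p (∀ i, X i) := by
  have := Fintype.ofFinite I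
  choose n hn using fun i => IsPGroup.iff_card.1 (h i)
  exact IsPGroup.of_card (n := ∑ i, n i) (by simp [Nat.card_pi, hn, Finset.prod_pow_eq_pow_sum])

theorem isPGroup_prod [Fact p.Prime] {X Y : Type} [Group X] [Group Y] [Finite X] [Finite Y]
    (hX : IsPGroup p X) (hY : IsPGroup p Y) : IsPGroup p (X × Y) := by
  obtain ⟨n, hn⟩ := IsPGroup.iff_card.1 hX
  obtain ⟨m, hm⟩ := IsPGroup.iff_card.1 hY
  exact IsPGroup.of_card (n := n + m) (by simp [Nat.card_prod, hn, hm, pow_add])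

/-- Finitely many separation conditions can be met in a single finite `p`-quotient. -/
theorem exists_forall_notMem_map [Fact p.Prime] {I : Type} [Finite I] (d : I → G)
    (S : I → Subgroup G) (h : ∀ i, PSeparatedFrom p (d i) (S i)) :
    ∃ (X : Type) (_ : Group X), Finite X ∧ IsPGroup p X ∧
      ∃ φ : G →* X, Function.Surjective φ ∧ ∀ i, φ (d i) ∉ (S i).map φ := by
  choose X hX hfin hp φ hφ using h
  let ψ : G →* ∀ i, X i := MonoidHom.pi φ
  refine ⟨ψ.range, inferInstance, inferInstance, (isPGroup_pi hp).to_subgroup _,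
    ψ.rangeRestrict, ψ.rangeRestrict_surjective, ?_⟩
  rintro i ⟨s, hs, he⟩
  exact hφ i ⟨s, hs, congr_fun (congrArg Subtype.val he) i⟩

theorem PSep.pSeparatedFrom {S : Subgroup G} (h : PSep p (S : Set G)) {d : G} (hd : d ∉ S) :
    PSeparatedFrom p d S := by
  obtain ⟨X, _, h1, h2, f, -, h4⟩ := h d hd
  exact ⟨X, _, h1, h2, f, h4⟩

end Separation

section Amalgam

variable {p : ℕ} {H K G : Type} [Group H] [Group K] [Group G]
  {A : Subgroup H} {B : Subgroup K} {φ : A ≃* B} {ιH : H →* G} {ιK : K →* G}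

theorem IsAmalgam.apply_eq (hG : IsAmalgam A B φ ιH ιK) (a : A) : ιH a = ιK (φ a) := hG.1 a

theorem IsAmalgam.symm (hG : IsAmalgam A B φ ιH ιK) : IsAmalgam B A φ.symm ιK ιH := by
  refine ⟨fun b => ?_, fun X _ fH fK h => ?_⟩
  · have := hG.apply_eq (φ.symm b)
    simpa using this.symm
  · obtain ⟨ρ, h1, h2⟩ := hG.2 X fK fH (fun a => by simpa using (h (φ a)).symm)
    exact ⟨ρ, h1.symm, fun y hy => h2 y hy.symm⟩

theorem IsAmalgam.exists_lift (hG : IsAmalgam A B φ ιH ιK) {X : Type} [Group X] (fH : H →* X)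
    (fK : K →* X) (h : ∀ a : A, fH a = fK (φ a)) :
    ∃ ρ : G →* X, (∀ h, ρ (ιH h) = fH h) ∧ ∀ k, ρ (ιK k) = fK k := by
  obtain ⟨ρ, h1, -⟩ := hG.2 X fH fK h
  exact ⟨ρ, DFunLike.congr_fun h1.1, DFunLike.congr_fun h1.2⟩

/-- The element of an amalgam spelled by a list of pairs of letters. -/
def spell (ιH : H →* G) (ιK : K →* G) (l : List (H × K)) : G :=
  (l.map fun x => ιH x.1 * ιK x.2).prod

@[simp] theorem spell_nil : spell ιH ιK [] = 1 := rfl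

@[simp] theorem spell_cons (x : H × K) (l : List (H × K)) :
    spell ιH ιK (x :: l) = ιH x.1 * ιK x.2 * spell ιH ιK l := by simp [spell]

@[simp] theorem spell_append (l l' : List (H × K)) :
    spell ιH ιK (l ++ l') = spell ιH ιK l * spell ιH ιK l' := by simp [spell]

theorem exists_spell_eq_inv (l : List (H × K)) :
    ∃ l', spell ιH ιK l' = (spell ιH ιK l)⁻¹ := by
  induction l with
  | nil => exact ⟨[], by simp⟩
  | cons x l ih =>
    obtain ⟨l', h⟩ := ih
    exact ⟨l' ++ [(1, x.2⁻¹), (x.1⁻¹, 1)], by simp [h, mul_assoc]⟩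

theorem IsAmalgam.exists_spell (hG : IsAmalgam A B φ ιH ιK) (g : G) :
    ∃ l, spell ιH ιK l = g := by
  let T : Subgroup G :=
    { carrier := {g | ∃ l, spell ιH ιK l = g}
      one_mem' := ⟨[], rfl⟩
      mul_mem' := by
        rintro _ _ ⟨l, rfl⟩ ⟨l', rfl⟩
        exact ⟨l ++ l', by simp⟩
      inv_mem' := by
        rintro _ ⟨l, rfl⟩
        exact exists_spell_eq_inv l }
  have hH : ∀ h, ιH h ∈ T := fun h => ⟨[(h, 1)], by simp⟩
  have hK : ∀ k, ιK k ∈ T := fun k => ⟨[(1, k)], by simp⟩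
  obtain ⟨ρ, h1, h2⟩ := hG.exists_lift (ιH.codRestrict T hH) (ιK.codRestrict T hK)
    (fun a => Subtype.ext (hG.apply_eq a))
  obtain ⟨_, -, hu⟩ := hG.2 G ιH ιK hG.1
  have : T.subtype.comp ρ = MonoidHom.id G :=
    (hu _ ⟨by ext h; simp [h1], by ext k; simp [h2]⟩).trans (hu _ ⟨rfl, rfl⟩).symm
  rw [← MonoidHom.id_apply (M := G) g, ← this]
  exact (ρ g).2

/-- A group element is conjugate into a factor or to a cyclically reduced element. -/
theorem IsAmalgam.isConj_cases (hG : IsAmalgam A B φ ιH ιK) (g : G) :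
    (∃ h, IsConj g (ιH h)) ∨ (∃ k, IsConj g (ιK k)) ∨
      ∃ l, l ≠ [] ∧ (∀ x ∈ l, x.1 ∉ A ∧ x.2 ∉ B) ∧ IsConj g (spell ιH ιK l) := by
  obtain ⟨l, hl⟩ := hG.exists_spell g
  obtain ⟨n, hn⟩ : ∃ n, l.length = n := ⟨_, rfl⟩
  replace hl : IsConj g (spell ιH ιK l) := by rw [hl]
  induction n using Nat.strong_induction_on generalizing l with
  | _ n ih =>
    by_cases hred : ∀ x ∈ l, x.1 ∉ A ∧ x.2 ∉ B
    · by_cases hnil : l = []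
      · exact .inl ⟨1, by simpa [hnil] using hl⟩
      · exact .inr (.inr ⟨l, hnil, hred, hl⟩)
    · push Not at hred
      obtain ⟨x, hx, hbad⟩ := hred
      obtain ⟨s, t, rfl⟩ := List.append_of_mem hx
      have hcyc : IsConj g (ιH x.1 * ιK x.2 * spell ιH ιK (t ++ s)) := by
        refine hl.trans (isConj_iff.2 ⟨(spell ιH ιK s)⁻¹, ?_⟩)
        simp [mul_assoc]
      have hlen : (t ++ s).length + 1 = n := by
        rw [← hn]; simp; omega
      by_cases hxA : x.1 ∈ A
      · have hxA' : ιH x.1 = ιK (φ ⟨x.1, hxA⟩) := hG.apply_eq ⟨x.1, hxA⟩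
        rcases List.eq_nil_or_concat (t ++ s) with h0 | ⟨r, q, hr⟩
        · rw [h0, hxA'] at hcyc
          exact .inr (.inl ⟨φ ⟨x.1, hxA⟩ * x.2, by simpa using hcyc⟩)
        · rw [hr] at hcyc hlen
          refine ih (r ++ [(q.1, q.2 * (φ ⟨x.1, hxA⟩ * x.2))]).length ?_ _ rfl ?_
          · simp at hlen ⊢; omega
          · refine hcyc.trans (isConj_iff.2 ⟨(ιH x.1 * ιK x.2)⁻¹, ?_⟩)
            rw [hxA']
            simp [mul_assoc]
      · have hxB := hbad hxA
        have hxB' : ιK x.2 = ιH (φ.symm ⟨x.2, hxB⟩) := hG.symm.apply_eq ⟨x.2, hxB⟩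
        rcases h0 : t ++ s with _ | ⟨q, r⟩
        · rw [h0, hxB'] at hcyc
          exact .inl ⟨x.1 * φ.symm ⟨x.2, hxB⟩, by simpa using hcyc⟩
        · rw [h0] at hcyc hlen
          refine ih ((x.1 * (φ.symm ⟨x.2, hxB⟩ * q.1), q.2) :: r).length ?_ _ rfl ?_
          · simp at hlen ⊢; omega
          · rw [hxB'] at hcyc
            simpa [mul_assoc] using hcyc

theorem IsAmalgam.commute_left (hG : IsAmalgam A B φ ιH ιK) (hA : A ≤ Subgroup.center H)
    (hB : B ≤ Subgroup.center K) : (A.map ιH) ≤ Subgroup.center G := by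
  rintro _ ⟨a, ha, rfl⟩
  refine Subgroup.mem_center_iff.2 fun g => ?_
  obtain ⟨l, rfl⟩ := hG.exists_spell g
  have h1 : ∀ h, Commute (ιH h) (ιH a) := fun h =>
    Commute.map (Subgroup.mem_center_iff.1 (hA ha) h) ιH
  have h2 : ∀ k, Commute (ιK k) (ιH a) := fun k => by
    rw [show ιH a = ιK (φ ⟨a, ha⟩) from hG.apply_eq ⟨a, ha⟩]
    exact Commute.map (Subgroup.mem_center_iff.1 (hB (φ ⟨a, ha⟩).2) k) ιK
  induction l with
  | nil => simp
  | cons x l ih =>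
    rw [spell_cons]
    exact ((h1 _).mul_left (h2 _)).mul_left ih

theorem IsAmalgam.map_eq (hG : IsAmalgam A B φ ιH ιK) : B.map ιK = A.map ιH := by
  ext x
  constructor
  · rintro ⟨b, hb, rfl⟩
    exact ⟨φ.symm ⟨b, hb⟩, (φ.symm ⟨b, hb⟩).2, (hG.symm.apply_eq ⟨b, hb⟩).symm⟩
  · rintro ⟨a, ha, rfl⟩
    exact ⟨φ ⟨a, ha⟩, (φ ⟨a, ha⟩).2, (hG.apply_eq ⟨a, ha⟩).symm⟩

theorem normal_map_of_le_center {P : Type} [Group P] (hA : A ≤ Subgroup.center H) {ψ : H →* P}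
    (hψ : Function.Surjective ψ) : (A.map ψ).Normal := by
  refine ⟨?_⟩
  rintro _ ⟨a, ha, rfl⟩ x
  obtain ⟨h, rfl⟩ := hψ x
  refine ⟨a, ha, ?_⟩
  rw [← map_mul, ← map_inv, ← map_mul, Subgroup.mem_center_iff.1 (hA ha) h, mul_assoc]
  simp

/-- An element of `H` outside of `A` survives in a finite `p`-quotient of the amalgam which
kills `K`. -/
theorem IsAmalgam.exists_kill_right (hG : IsAmalgam A B φ ιH ιK)
    (hA : A ≤ Subgroup.center H) (hsep : PSep p (A : Set H)) {h : H} (hh : h ∉ A) :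
    ∃ (X : Type) (_ : Group X), Finite X ∧ IsPGroup p X ∧
      ∃ π : G →* X, π (ιH h) ≠ 1 ∧ ∀ k, π (ιK k) = 1 := by
  obtain ⟨P, _, h1, h2, ψ, h3, h4⟩ := hsep h hh
  have : (A.map ψ).Normal := normal_map_of_le_center hA h3
  obtain ⟨ρ, hρH, hρK⟩ := hG.exists_lift ((QuotientGroup.mk' (A.map ψ)).comp ψ) 1 (by
    intro a
    simpa using ⟨a, a.2, rfl⟩)
  refine ⟨P ⧸ A.map ψ, inferInstance, inferInstance, h2.to_quotient _, ρ, ?_, by simp [hρK]⟩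
  rw [hρH]
  intro he
  exact h4 ((QuotientGroup.eq_one_iff _).1 he)

/-- Given a finite `p`-quotient of `A` induced by one of `H`, there is a finite `p`-quotient of
`K` in which `B` has the corresponding kernel. -/
theorem exists_compatible [Fact p.Prime] {P : Type} [Group P] [Finite P] (hP : IsPGroup p P)
    (hB : B ≤ Subgroup.center K)
    (hBsub : ∀ V : Subgroup B, (∃ n : ℕ, V.index = p ^ n) →
      PSep p ((V.map B.subtype : Subgroup K) : Set K)) (χ : B →* P) :
    ∃ (Q : Type) (_ : Group Q), Finite Q ∧ IsPGroup p Q ∧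
      ∃ θ : K →* Q, Function.Surjective θ ∧ ∀ b : B, θ b = 1 ↔ χ b = 1 := by
  set V := χ.ker.map B.subtype with hV
  have hVc : V ≤ Subgroup.center K := (Subgroup.map_subtype_le _).trans hB
  have hidx : ∃ n : ℕ, χ.ker.index = p ^ n := by
    rw [Subgroup.index_ker]
    exact IsPGroup.iff_card.1 (hP.to_subgroup _)
  have hmem : ∀ b : B, (b : K) ∈ V ↔ χ b = 1 := by
    intro b
    simp [hV, MonoidHom.mem_ker]
  choose s hs using fun y : {y : χ.range // y ≠ 1} => y.1.2
  obtain ⟨Q, _, hQ1, hQ2, θ, hθ, hθs⟩ := exists_forall_notMem_map (p := p)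
    (fun y : {y : χ.range // y ≠ 1} => (s y : K)) (fun _ => V) (fun y =>
      (hBsub χ.ker hidx).pSeparatedFrom (by
        rw [hmem, hs]
        simpa using y.2))
  have : (V.map θ).Normal := normal_map_of_le_center hVc hθ
  refine ⟨Q ⧸ V.map θ, inferInstance, inferInstance, hQ2.to_quotient _,
    (QuotientGroup.mk' _).comp θ, (QuotientGroup.mk'_surjective _).comp hθ, fun b => ?_⟩
  have hq : ((QuotientGroup.mk' (V.map θ)).comp θ) b = 1 ↔ θ b ∈ V.map θ :=
    QuotientGroup.eq_one_iff _
  rw [hq]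
  constructor
  · intro hb
    by_contra hne
    let y : {y : χ.range // y ≠ 1} := ⟨⟨χ b, b, rfl⟩, fun h => hne (congrArg Subtype.val h)⟩
    have hsy : χ (s y) = χ b := hs y
    have hd : ((b⁻¹ * s y : B) : K) ∈ V := (hmem _).2 (by simp [hsy])
    refine hθs y ?_
    have : (s y : K) = b * ((b⁻¹ * s y : B) : K) := by simp
    simp only [this, map_mul]
    exact mul_mem hb (Subgroup.mem_map_of_mem θ hd)
  · intro hb
    exact Subgroup.mem_map_of_mem θ ((hmem b).2 hb)

/-- Every finite `p`-quotient of `H` embeds, faithfully for conjugacy, in a finite `p`-quotient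
of the amalgam. -/
theorem IsAmalgam.exists_extension [Fact p.Prime] (hG : IsAmalgam A B φ ιH ιK)
    (hA : A ≤ Subgroup.center H) (hB : B ≤ Subgroup.center K)
    (hBsub : ∀ V : Subgroup B, (∃ n : ℕ, V.index = p ^ n) →
      PSep p ((V.map B.subtype : Subgroup K) : Set K))
    {P : Type} [Group P] [Finite P] (hP : IsPGroup p P) {ψ : H →* P}
    (hψ : Function.Surjective ψ) :
    ∃ (X : Type) (_ : Group X), Finite X ∧ IsPGroup p X ∧
      ∃ π : G →* X, ∀ h h' : H, IsConj (π (ιH h)) (π (ιH h')) → IsConj (ψ h) (ψ h') := by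
  obtain ⟨Q, _, hQ1, hQ2, θ, hθ, hθχ⟩ :=
    exists_compatible hP hB hBsub ((ψ.comp A.subtype).comp φ.symm.toMonoidHom)
  have hcA : ∀ (a : A) (x : P), x * ψ a = ψ a * x := by
    intro a x
    obtain ⟨h, rfl⟩ := hψ x
    rw [← map_mul, Subgroup.mem_center_iff.1 (hA a.2) h, map_mul]
  have hcB : ∀ (b : B) (x : Q), x * θ b = θ b * x := by
    intro b x
    obtain ⟨k, rfl⟩ := hθ x
    rw [← map_mul, Subgroup.mem_center_iff.1 (hB b.2) k, map_mul]
  let D : Subgroup (P × Q) :=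
    { carrier := {x | ∃ a : A, x = (ψ a, (θ (φ a))⁻¹)}
      one_mem' := ⟨1, Prod.ext (by simp) (by simp)⟩
      mul_mem' := by
        rintro _ _ ⟨a, rfl⟩ ⟨a', rfl⟩
        have hcomm : Commute (θ (φ a)) (θ (φ a')) := hcB (φ a') _
        refine ⟨a * a', Prod.ext (by simp) ?_⟩
        simpa only [map_mul, Subgroup.coe_mul, mul_inv_rev, Prod.snd_mul] using hcomm.inv_inv.eq
      inv_mem' := by
        rintro _ ⟨a, rfl⟩
        exact ⟨a⁻¹, by simp⟩ }
  have hD : D.Normal := by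
    refine ⟨?_⟩
    rintro _ ⟨a, rfl⟩ ⟨x, y⟩
    refine ⟨a, Prod.ext ?_ ?_⟩
    · simp [hcA]
    · have hcomm : Commute y (θ (φ a)) := hcB (φ a) y
      exact mul_inv_eq_of_eq_mul hcomm.inv_right.eq
  obtain ⟨ρ, hρH, hρK⟩ := hG.exists_lift
    ((QuotientGroup.mk' D).comp ((MonoidHom.inl P Q).comp ψ))
    ((QuotientGroup.mk' D).comp ((MonoidHom.inr P Q).comp θ)) (by
      intro a
      refine QuotientGroup.eq.2 ⟨a⁻¹, ?_⟩
      simp)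
  refine ⟨(P × Q) ⧸ D, inferInstance, inferInstance, (isPGroup_prod hP hQ2).to_quotient _, ρ,
    fun h h' hc => ?_⟩
  obtain ⟨c, hc⟩ := isConj_iff.1 hc
  obtain ⟨⟨x, y⟩, rfl⟩ := QuotientGroup.mk_surjective c
  rw [hρH, hρH] at hc
  obtain ⟨a, ha⟩ : ((x, y) * (ψ h, 1) * (x, y)⁻¹)⁻¹ * (ψ h', 1) ∈ D := QuotientGroup.eq.1 hc
  have h2 : θ (φ a) = 1 := by simpa using (congrArg Prod.snd ha).symm
  have h3 : ψ a = 1 := by simpa using (hθχ (φ a)).1 h2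
  have h1 := congrArg Prod.fst ha
  simp only [h3, Prod.fst_mul, Prod.fst_inv] at h1
  exact isConj_iff.2 ⟨x, inv_mul_eq_one.1 h1⟩

end Amalgam

section Representation

/-- Powers of an element congruent to `1` modulo a central nilpotent natural number. -/
theorem one_add_natCast_mul_pow {M : Type} [Ring M] (p n : ℕ) (m : M) :
    ∃ m' : M, (1 + (p : M) * m) ^ p ^ n = 1 + (p : M) ^ (n + 1) * m' := by
  have expand : ∀ (x : M) (k : ℕ), ∃ r, (1 + x) ^ k = 1 + (k : M) * x + x * x * r := by
    intro x k
    induction k with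
    | zero => exact ⟨0, by simp⟩
    | succ k ih =>
      obtain ⟨r, hr⟩ := ih
      refine ⟨k + r * (1 + x), ?_⟩
      rw [pow_succ, hr, Nat.cast_succ]
      have h1 : x * x * (k : M) = (k : M) * x * x := by
        rw [← (Nat.cast_commute k (x * x)).eq, mul_assoc]
      rw [mul_add (x * x), h1]
      noncomm_ring
  induction n with
  | zero => exact ⟨m, by simp⟩
  | succ n ih =>
    obtain ⟨m', hm'⟩ := ih
    obtain ⟨r, hr⟩ := expand ((p : M) ^ (n + 1) * m') p
    refine ⟨m' + (p : M) ^ n * m' * m' * r, ?_⟩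
    have hc : m' * (p : M) ^ (n + 1) = (p : M) ^ (n + 1) * m' := by
      have := (Nat.cast_commute (p ^ (n + 1)) m').eq
      push_cast at this
      exact this.symm
    rw [pow_succ p, pow_mul, hm', hr, ← mul_assoc, ← pow_succ' (p : M), add_assoc]
    congr 1
    rw [mul_assoc _ m', ← mul_assoc m', hc]
    simp only [mul_add, ← mul_assoc, ← pow_add]
    rw [show n + 1 + (n + 1) = n + 1 + 1 + n by omega]

/-- In a ring where `p` is nilpotent, a family of units which is congruent modulo `p` to a
homomorphism through a `p`-group forms a `p`-group. -/
theorem isPGroup_range_of_congr {p N : ℕ} {G E M : Type} [Group G] [Group E] [Ring M]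
    (hE : IsPGroup p E) (hM : (p : M) ^ N = 0) (π : G →* E) (σ : E →* M) (ρ : G →* Mˣ)
    (h : ∀ g, ∃ m : M, (ρ g : M) = σ (π g) + p * m) : IsPGroup p ρ.range := by
  rintro ⟨_, g, rfl⟩
  obtain ⟨k, hk⟩ := hE (π g)
  obtain ⟨m, hm⟩ := h (g ^ p ^ k)
  obtain ⟨m', hm'⟩ := one_add_natCast_mul_pow p N m
  refine ⟨k + N, Subtype.ext (Units.ext ?_)⟩
  have h1 : ((ρ g : M) ^ p ^ k) = 1 + p * m := by
    rw [← Units.val_pow_eq_pow_val, ← map_pow, hm, map_pow π, hk, map_one]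
  simp [pow_add, pow_mul, h1, hm', hM]

variable {p : ℕ} {H K G : Type} [Group H] [Group K] [Group G]
  {A : Subgroup H} {B : Subgroup K} {φ : A ≃* B} {ιH : H →* G} {ιK : K →* G}

/-- Twist a representation of an amalgam by conjugating one of the factors by the unipotent
element `1 + n`. -/
theorem IsAmalgam.exists_twist (hG : IsAmalgam A B φ ιH ιK) {M : Type} [Ring M] (σ : G →* M)
    (n : M) (hn : n * n = 0) (hcomm : ∀ a : A, n * σ (ιH a) = σ (ιH a) * n) :
    ∃ ρ : G →* Mˣ, (∀ h, (ρ (ιH h) : M) = σ (ιH h)) ∧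
      ∀ k, (ρ (ιK k) : M) = (1 + n) * σ (ιK k) * (1 - n) := by
  let T : Mˣ := ⟨1 + n, 1 - n, by noncomm_ring; simp [hn], by noncomm_ring; simp [hn]⟩
  obtain ⟨ρ, h1, h2⟩ := hG.exists_lift (σ.toHomUnits.comp ιH)
    ((MulAut.conj T).toMonoidHom.comp (σ.toHomUnits.comp ιK)) (by
      intro a
      refine Units.ext ?_
      change σ (ιH a) = (1 + n) * σ (ιK (φ a)) * (1 - n)
      rw [← hG.apply_eq, (show (1 + n) * σ (ιH a) = σ (ιH a) * (1 + n) by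
        rw [mul_add, add_mul, hcomm, mul_one, one_mul]), mul_assoc]
      have : (1 + n) * (1 - n) = 1 := T.val_inv
      rw [this, mul_one])
  exact ⟨ρ, fun h => by rw [h1]; rfl, fun k => by rw [h2]; rfl⟩

theorem IsAmalgam.isPGroup_range_twist (hG : IsAmalgam A B φ ιH ιK) {N : ℕ} {E M : Type}
    [Group E] [Ring M] (hE : IsPGroup p E) (hM : (p : M) ^ N = 0) (π : G →* E) (σ : E →* M)
    (n : M) (ρ : G →* Mˣ) (h1 : ∀ h, (ρ (ιH h) : M) = σ (π (ιH h)))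
    (h2 : ∀ k, (ρ (ιK k) : M) = (1 + p * n) * σ (π (ιK k)) * (1 - p * n)) :
    IsPGroup p ρ.range := by
  refine isPGroup_range_of_congr hE hM π σ ρ fun g => ?_
  have hp : ∀ x : M, x * (p : M) = p * x := fun x => (Nat.cast_commute p x).eq.symm
  have hmul : ∀ {a b a' b' : M}, (∃ m, a = a' + p * m) → (∃ m, b = b' + p * m) →
      ∃ m, a * b = a' * b' + p * m := by
    rintro _ _ a' b' ⟨m, rfl⟩ ⟨m', rfl⟩
    refine ⟨a' * m' + m * b' + m * (p * m'), ?_⟩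
    simp only [mul_add, add_mul, ← mul_assoc, hp]
    abel
  obtain ⟨l, rfl⟩ := hG.exists_spell g
  induction l with
  | nil => exact ⟨0, by simp⟩
  | cons x l ih =>
    simp only [spell_cons, map_mul, Units.val_mul]
    refine hmul (hmul ⟨0, by simp [h1]⟩ ?_) ih
    rw [h2]
    have := hmul (hmul (a := 1 + p * n) (b := σ (π (ιK x.2))) (a' := 1) (b' := σ (π (ιK x.2)))
      ⟨n, rfl⟩ ⟨0, by simp⟩) (b := 1 - p * n) (b' := 1) ⟨-n, by simp [sub_eq_add_neg]⟩
    simpa using this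

end Representation

section Trace

open Polynomial

variable {ι : Type} [Fintype ι] [DecidableEq ι]

/-- Evaluation of a polynomial with matrix coefficients at an integer. -/
noncomputable def evalInt (t : ℤ) : (Matrix ι ι ℤ)[X] →+* Matrix ι ι ℤ :=
  (evalRingHom t).mapMatrix.comp (matPolyEquiv (R := ℤ) (n := ι)).symm.toRingEquiv.toRingHom

theorem evalInt_C (t : ℤ) (m : Matrix ι ι ℤ) : evalInt t (C m) = m := by
  ext i j
  simp [evalInt]

theorem evalInt_X (t : ℤ) : evalInt t (X : (Matrix ι ι ℤ)[X]) = t • 1 := by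
  ext i j
  by_cases h : i = j <;> simp [evalInt, h]

/-- The trace of a polynomial with matrix coefficients. -/
noncomputable def tracePoly (P : (Matrix ι ι ℤ)[X]) : ℤ[X] :=
  ((matPolyEquiv (R := ℤ) (n := ι)).symm P).trace

theorem tracePoly_coeff (P : (Matrix ι ι ℤ)[X]) (k : ℕ) :
    (tracePoly P).coeff k = (P.coeff k).trace := by
  simp [tracePoly, Matrix.trace]

theorem tracePoly_eval (P : (Matrix ι ι ℤ)[X]) (t : ℤ) :
    (tracePoly P).eval t = (evalInt t P).trace := by
  simp [tracePoly, Matrix.trace, evalInt, eval_finsetSum]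

/-- The generic form of `a * (1 + t • n) * b * (1 - t • n)`. -/
noncomputable def twistPoly (n a b : Matrix ι ι ℤ) : (Matrix ι ι ℤ)[X] :=
  C (-(a * n * b * n)) * X ^ 2 + C (a * (n * b - b * n)) * X + C (a * b)

theorem evalInt_twistPoly (t : ℤ) (n a b : Matrix ι ι ℤ) :
    evalInt t (twistPoly n a b) = a * ((1 + t • n) * b * (1 - t • n)) := by
  simp only [twistPoly, map_add, map_mul, map_pow, evalInt_C, evalInt_X]
  simp only [mul_add, add_mul, mul_sub, smul_mul_assoc, mul_smul_comm, mul_one, one_mul,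
    pow_two, mul_assoc, smul_smul]
  module

theorem twistPoly_natDegree_le (n a b : Matrix ι ι ℤ) : (twistPoly n a b).natDegree ≤ 2 :=
  natDegree_quadratic_le

theorem twistPoly_coeff_two (n a b : Matrix ι ι ℤ) :
    (twistPoly n a b).coeff 2 = -(a * n * b * n) := by
  rw [twistPoly, coeff_add, coeff_add, coeff_C_mul_X_pow, coeff_C_mul_X, coeff_C]
  simp

end Trace

section PartialMap

variable {ι : Type} [DecidableEq ι]

/-- The zero-one matrix of a partial map, acting on row vectors. -/
def partialMatrix (f : ι → Option ι) : Matrix ι ι ℤ :=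
  Matrix.of fun i j => if f i = some j then 1 else 0

theorem partialMatrix_mul [Fintype ι] (f g : ι → Option ι) :
    partialMatrix f * partialMatrix g = partialMatrix fun i => (f i).bind g := by
  ext i j
  rw [Matrix.mul_apply]
  rcases h : f i with _ | k
  · simp [partialMatrix, h]
  · rw [Finset.sum_eq_single k] <;> simp +contextual [partialMatrix, h, eq_comm]

theorem partialMatrix_some : partialMatrix (some : ι → Option ι) = 1 := by
  ext i j
  simp [partialMatrix, Matrix.one_apply]

theorem partialMatrix_none : partialMatrix (fun _ : ι => none) = 0 := by
  ext i j
  simp [partialMatrix]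

theorem partialMatrix_trace_eq_zero [Fintype ι] {f : ι → Option ι} (h : ∀ i, f i ≠ some i) :
    (partialMatrix f).trace = 0 :=
  Finset.sum_eq_zero fun i _ => by simp [partialMatrix, h]

theorem partialMatrix_trace_pos [Fintype ι] {f : ι → Option ι} {i : ι} (h : f i = some i) :
    0 < (partialMatrix f).trace :=
  Finset.sum_pos'
    (fun j _ => by simp only [partialMatrix, Matrix.diag, Matrix.of_apply]; split <;> simp)
    ⟨i, Finset.mem_univ _, by simp [partialMatrix, h]⟩

end PartialMap

section Tracking

open scoped Classical in
/-- The partial map which shifts along the cyclic word `z`, defined at the `j`-th place for the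
elements of `E` congruent to the `j`-th letter modulo `D`. -/
noncomputable def trackShift {E : Type} [Group E] {L : ℕ} (D : Subgroup E) (z : ZMod L → E) :
    E × ZMod L → Option (E × ZMod L) :=
  fun x => if x.1 * (z x.2)⁻¹ ∈ D then some (x.1 * (z x.2)⁻¹, x.2 + 1) else none

/-- Right multiplication, as a partial map. -/
def trackMul {E : Type} [Group E] (L : ℕ) (w : E) : E × ZMod L → Option (E × ZMod L) :=
  fun x => some (x.1 * w, x.2)

/-- Compare the word `l` with the cyclic word `z` modulo `D`. -/
noncomputable def track {E : Type} [Group E] {L : ℕ} (D : Subgroup E) (z : ZMod L → E) :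
    List E → E × ZMod L → Option (E × ZMod L)
  | [] => some
  | w :: l => fun x => (trackShift D z (x.1 * w, x.2)).bind (track D z l)

/-- The segment of length `m` of the cyclic word `z` which starts at the `j`-th place. -/
def cyclicSegment {G : Type} [Group G] {L : ℕ} (z : ZMod L → G) : ZMod L → ℕ → G
  | _, 0 => 1
  | j, m + 1 => z j * cyclicSegment z (j + 1) m

theorem cyclicSegment_succ' {G : Type} [Group G] {L : ℕ} (z : ZMod L → G) (j : ZMod L) (m : ℕ) :
    cyclicSegment z j (m + 1) = cyclicSegment z j m * z (j + m) := by
  induction m generalizing j with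
  | zero => simp [cyclicSegment]
  | succ m ih =>
    rw [cyclicSegment, ih, cyclicSegment, mul_assoc]
    push_cast
    rw [add_assoc, add_comm (1 : ZMod L)]

theorem isConj_cyclicSegment {G : Type} [Group G] {L : ℕ} [NeZero L] (z : ZMod L → G)
    (j : ZMod L) : IsConj (cyclicSegment z 0 L) (cyclicSegment z j L) := by
  rw [← ZMod.natCast_zmod_val j]
  induction j.val with
  | zero => rw [Nat.cast_zero]
  | succ n ih =>
    refine ih.trans (isConj_iff.2 ⟨(z n)⁻¹, ?_⟩)
    have h := cyclicSegment_succ' z n L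
    rw [cyclicSegment, ZMod.natCast_self, add_zero] at h
    push_cast
    rw [inv_inv, mul_assoc, ← h, inv_mul_cancel_left]

theorem cyclicSegment_getD {G : Type} [Group G] (l : List G) :
    cyclicSegment (fun j : ZMod l.length => l.getD j.val 1) 0 l.length = l.prod := by
  have key : ∀ s t : List G, s ++ t = l →
      cyclicSegment (fun j : ZMod l.length => l.getD j.val 1) s.length t.length = t.prod := by
    intro s t
    induction t generalizing s with
    | nil => intro; rfl
    | cons w t ih =>
      intro h
      have h' := ih (s ++ [w]) (by simpa using h)
      have hlt : s.length < l.length := by simp [← h]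
      simp only [List.length_append, List.length_singleton, Nat.cast_add, Nat.cast_one] at h'
      rw [List.length_cons, cyclicSegment, h', List.prod_cons, ZMod.val_natCast_of_lt hlt]
      simp [← h]
  simpa using key [] l rfl

theorem trackShift_mul {E : Type} [Group E] {L : ℕ} {D : Subgroup E} {z : ZMod L → E}
    {d : E} (hd : d ∈ D) (hc : ∀ j, Commute d (z j)) (x : E × ZMod L) :
    trackShift D z (x.1 * d, x.2) = (trackShift D z x).bind (trackMul L d) := by
  have h : x.1 * d * (z x.2)⁻¹ = x.1 * (z x.2)⁻¹ * d := by
    rw [mul_assoc, (hc x.2).inv_right.eq, mul_assoc]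
  by_cases hm : x.1 * (z x.2)⁻¹ ∈ D
  · have hm' := mul_mem hm hd
    simp [trackShift, trackMul, h, hm, hm']
  · have hm' : x.1 * (z x.2)⁻¹ * d ∉ D := by rwa [D.mul_mem_cancel_right hd]
    simp [trackShift, h, hm, hm']

theorem trackShift_bind_self {E : Type} [Group E] {L : ℕ} {D : Subgroup E} {z : ZMod L → E}
    (hz : ∀ j, z j ∉ D) (x : E × ZMod L) :
    (trackShift D z x).bind (trackShift D z) = none := by
  by_cases h : x.1 * (z x.2)⁻¹ ∈ D
  · simp [trackShift, h, D.mul_mem_cancel_left h, hz]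
  · simp [trackShift, h]

theorem track_self {E : Type} [Group E] {L : ℕ} (D : Subgroup E) (z : ZMod L → E) (l : List E)
    (j : ZMod L) (h : ∀ i, (hi : i < l.length) → l[i] = z (j + i)) :
    track D z l (1, j) = some (1, j + l.length) := by
  induction l generalizing j with
  | nil => simp [track]
  | cons w l ih =>
    have hw : w = z j := (h 0 (by simp)).trans (by simp)
    have := ih (j + 1) fun i hi => by
      have := h (i + 1) (by simpa using hi)
      rw [List.getElem_cons_succ] at this
      rw [this]
      push_cast
      ring_nf
    simp only [track, trackShift, hw, one_mul, mul_inv_cancel, D.one_mem, if_true,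
      Option.bind_some, this, List.length_cons]
    push_cast
    ring_nf

theorem mem_of_track_eq_some {E : Type} [Group E] {L : ℕ} {D : Subgroup E} {z : ZMod L → E}
    {l : List E} (hl : l ≠ []) {x y : E × ZMod L} (h : track D z l x = some y) : y.1 ∈ D := by
  induction l generalizing x with
  | nil => exact absurd rfl hl
  | cons w l ih =>
    simp only [track, Option.bind_eq_some_iff] at h
    obtain ⟨u, hu, h⟩ := h
    by_cases hl' : l = []
    · subst hl'
      obtain rfl : u = y := by simpa [track] using h
      simp only [trackShift] at hu
      split at hu <;> simp at hu
      rw [← hu]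
      assumption
    · exact ih hl' h

theorem exists_of_track_eq_some {G E : Type} [Group G] [Group E] {L : ℕ} {S : Subgroup G}
    (hS : S ≤ Subgroup.center G) {z : ZMod L → G} {π : G →* E} {l : List G}
    (hsep : ∀ w ∈ l, ∀ j, π (w * (z j)⁻¹) ∈ S.map π → w * (z j)⁻¹ ∈ S) {a : G} (ha : a ∈ S)
    {j : ZMod L} {y : E × ZMod L}
    (h : track (S.map π) (fun j => π (z j)) (l.map π) (π a, j) = some y) :
    ∃ b ∈ S, y.1 = π b ∧ a * l.prod = b * cyclicSegment z j l.length := by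
  induction l generalizing a j with
  | nil =>
    refine ⟨a, ha, ?_, by simp [cyclicSegment]⟩
    have : (π a, j) = y := by simpa [track] using h
    rw [← this]
  | cons w l ih =>
    simp only [List.map_cons, track, Option.bind_eq_some_iff] at h
    obtain ⟨u, hu, h⟩ := h
    simp only [trackShift] at hu
    split at hu
    case isFalse => simp at hu
    case isTrue hm =>
      have e : π a * π w * (π (z j))⁻¹ = π (a * (w * (z j)⁻¹)) := by simp [mul_assoc]
      have hm' : w * (z j)⁻¹ ∈ S := by
        refine hsep w (by simp) j ?_
        rw [e, map_mul] at hm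
        exact ((S.map π).mul_mem_cancel_left (Subgroup.mem_map_of_mem π ha)).1 hm
      obtain rfl : (π (a * (w * (z j)⁻¹)), j + 1) = u := by simpa [e] using hu
      obtain ⟨b, hb, h1, h2⟩ := ih (fun w hw => hsep w (by simp [hw])) (mul_mem ha hm') h
      refine ⟨b, hb, h1, ?_⟩
      rw [List.prod_cons, List.length_cons, cyclicSegment]
      calc a * (w * l.prod) = (a * (w * (z j)⁻¹)) * z j * l.prod := by group
        _ = z j * (a * (w * (z j)⁻¹)) * l.prod := by
          rw [Subgroup.mem_center_iff.1 (hS (mul_mem ha hm')) (z j)]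
        _ = z j * (b * cyclicSegment z (j + 1) l.length) := by rw [mul_assoc, h2]
        _ = b * (z j * cyclicSegment z (j + 1) l.length) := by
          rw [← mul_assoc, Subgroup.mem_center_iff.1 (hS hb) (z j), mul_assoc]

end Tracking

section Separation

open Polynomial

/-- The matrix of right multiplication. -/
noncomputable def mulMatrix {E : Type} [Group E] [Fintype E] [DecidableEq E] (L : ℕ) [NeZero L] :
    E →* Matrix (E × ZMod L) (E × ZMod L) ℤ where
  toFun u := partialMatrix (trackMul L u)
  map_one' := by
    rw [← partialMatrix_some]
    congr 1
    funext x
    simp [trackMul]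
  map_mul' u v := by
    rw [partialMatrix_mul]
    congr 1
    funext x
    simp [trackMul, mul_assoc]

theorem prod_mulMatrix_mul_trackShift {E : Type} [Group E] [Fintype E] [DecidableEq E] {L : ℕ}
    [NeZero L] (D : Subgroup E) (z : ZMod L → E) (l : List E) :
    (l.map fun w => mulMatrix L w * partialMatrix (trackShift D z)).prod =
      partialMatrix (track D z l) := by
  induction l with
  | nil => exact partialMatrix_some.symm
  | cons w l ih =>
    rw [List.map_cons, List.prod_cons, ih]
    change partialMatrix _ * _ * _ = _
    rw [partialMatrix_mul, partialMatrix_mul]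
    rfl

variable {p : ℕ} {H K G : Type} [Group H] [Group K] [Group G]
  {A : Subgroup H} {B : Subgroup K} {φ : A ≃* B} {ιH : H →* G} {ιK : K →* G}

theorem length_flatMap_pair (ιH : H →* G) (ιK : K →* G) (l : List (H × K)) :
    (l.flatMap fun x => [ιH x.1, ιK x.2]).length = 2 * l.length := by
  induction l with
  | nil => rfl
  | cons x l ih =>
    rw [List.flatMap_cons, List.length_append, ih]
    simp only [List.length_cons, List.length_nil]
    ring

theorem prod_flatMap_pair (ιH : H →* G) (ιK : K →* G) (l : List (H × K)) :
    (l.flatMap fun x => [ιH x.1, ιK x.2]).prod = spell ιH ιK l := by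
  induction l with
  | nil => rfl
  | cons x l ih => simp [ih, mul_assoc]

/-- If `g` and `g'` are not separated in finite `p`-quotients then the traces of their images in
the twist of a representation are equal. -/
theorem IsAmalgam.tracePoly_eq (hp : p.Prime) (hG : IsAmalgam A B φ ιH ιK) {E ι : Type} [Group E]
    [Fintype ι] [DecidableEq ι] (hE : IsPGroup p E) (π : G →* E) (σ : E →* Matrix ι ι ℤ)
    (n : Matrix ι ι ℤ) (hn : n * n = 0)
    (hcomm : ∀ a : A, n * σ (π (ιH a)) = σ (π (ιH a)) * n) (l l' : List (H × K))
    (hs : ¬ PConjSeparated p (spell ιH ιK l) (spell ιH ιK l')) :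
    tracePoly (l.map fun x => twistPoly n (σ (π (ιH x.1))) (σ (π (ιK x.2)))).prod =
      tracePoly (l'.map fun x => twistPoly n (σ (π (ιH x.1))) (σ (π (ιK x.2)))).prod := by
  have key : ∀ m : ℕ, (tracePoly (l.map fun x =>
      twistPoly n (σ (π (ιH x.1))) (σ (π (ιK x.2)))).prod).eval ((p : ℤ) ^ (m + 1)) =
      (tracePoly (l'.map fun x =>
      twistPoly n (σ (π (ιH x.1))) (σ (π (ιK x.2)))).prod).eval ((p : ℤ) ^ (m + 1)) := by
    intro m
    set t : ℤ := (p : ℤ) ^ (m + 1) with ht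
    have hmod : ∀ N : ℕ, (p : ℤ) ^ N ∣ (tracePoly (l.map fun x =>
        twistPoly n (σ (π (ιH x.1))) (σ (π (ιK x.2)))).prod).eval t - (tracePoly (l'.map fun x =>
        twistPoly n (σ (π (ιH x.1))) (σ (π (ιK x.2)))).prod).eval t := by
      intro N
      have : NeZero (p ^ N) := ⟨pow_ne_zero _ hp.ne_zero⟩
      let κ : Matrix ι ι ℤ →+* Matrix ι ι (ZMod (p ^ N)) := (Int.castRingHom _).mapMatrix
      have hM : (p : Matrix ι ι (ZMod (p ^ N))) ^ N = 0 := by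
        rw [← Nat.cast_pow, ← Matrix.diagonal_natCast, ZMod.natCast_self, Matrix.diagonal_zero]
      have hκt : κ (t • n) = p * ((p : Matrix ι ι (ZMod (p ^ N))) ^ m * κ n) := by
        rw [zsmul_eq_mul, map_mul, map_intCast, ht]
        push_cast
        rw [pow_succ', mul_assoc]
      obtain ⟨ρ, h1, h2⟩ := hG.exists_twist ((κ.toMonoidHom.comp σ).comp π) (κ (t • n))
        (by rw [← map_mul, smul_mul_smul_comm, hn, smul_zero, map_zero])
        (fun a => by
          change κ (t • n) * κ (σ (π (ιH a))) = κ (σ (π (ιH a))) * κ (t • n)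
          rw [← map_mul, ← map_mul, smul_mul_assoc, mul_smul_comm, hcomm])
      have hρ : IsPGroup p ρ.range := hG.isPGroup_range_twist hE hM π (κ.toMonoidHom.comp σ)
        ((p : Matrix ι ι (ZMod (p ^ N))) ^ m * κ n) ρ h1 (by rw [← hκt]; exact h2)
      have hval : ∀ l, (ρ (spell ιH ιK l) : Matrix ι ι (ZMod (p ^ N))) =
          κ (evalInt t (l.map fun x => twistPoly n (σ (π (ιH x.1))) (σ (π (ιK x.2)))).prod) := by
        intro l
        induction l with
        | nil => simp
        | cons x l ih =>
          rw [spell_cons, map_mul, map_mul, Units.val_mul, Units.val_mul, ih, h1, h2,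
            List.map_cons, List.prod_cons, map_mul, map_mul, evalInt_twistPoly]
          simp only [map_mul, map_add, map_sub, map_one]
          rfl
      have hconj : IsConj (ρ (spell ιH ιK l)) (ρ (spell ιH ιK l')) := by
        by_contra hc
        exact hs (.of_range ρ hρ hc)
      obtain ⟨c, hc⟩ := isConj_iff.1 hconj
      have htr := congrArg (fun u : (Matrix ι ι (ZMod (p ^ N)))ˣ =>
        (u : Matrix ι ι (ZMod (p ^ N))).trace) hc
      simp only [Units.val_mul, Matrix.trace_units_conj, hval] at htr
      have hκ : ∀ M : Matrix ι ι ℤ, (κ M).trace = ((M.trace : ℤ) : ZMod (p ^ N)) := by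
        intro M
        simp [κ, Matrix.trace]
      rw [hκ, hκ, ← tracePoly_eval, ← tracePoly_eval] at htr
      have := (ZMod.intCast_eq_intCast_iff_dvd_sub _ _ _).1 htr.symm
      exact_mod_cast this
    by_contra hne
    have hne' := sub_ne_zero.2 hne
    obtain ⟨N, hN⟩ := (Int.finiteMultiplicity_iff (a := (p : ℤ))).2
      ⟨by simpa using hp.ne_one, hne'⟩
    exact hN (hmod _)
  refine eq_of_infinite_eval_eq _ _ (Set.infinite_of_injective_forall_mem
    (f := fun m : ℕ => (p : ℤ) ^ (m + 1)) (fun a b hab => ?_) key)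
  exact Nat.succ_injective (Int.pow_right_injective (by simpa using hp.one_lt) hab)

theorem tracePoly_twist_coeff {ι : Type} [Fintype ι] [DecidableEq ι] {E : Type} [Group E]
    (π : G →* E) (σ : E →* Matrix ι ι ℤ) (n : Matrix ι ι ℤ) (l : List (H × K)) :
    (tracePoly (l.map fun x => twistPoly n (σ (π (ιH x.1))) (σ (π (ιK x.2)))).prod).coeff
      (l.length * 2) = (-1) ^ l.length *
        (((l.flatMap fun x => [ιH x.1, ιK x.2]).map π).map fun w => σ w * n).prod.trace := by
  rw [tracePoly_coeff]
  have h := coeff_list_prod_of_natDegree_le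
    (l.map fun x => twistPoly n (σ (π (ιH x.1))) (σ (π (ιK x.2)))) 2 (by
      intro q hq
      obtain ⟨x, -, rfl⟩ := List.mem_map.1 hq
      exact twistPoly_natDegree_le _ _ _)
  rw [List.length_map] at h
  rw [h]
  have : ((l.map fun x => twistPoly n (σ (π (ιH x.1))) (σ (π (ιK x.2)))).map
      fun q => q.coeff 2).prod = ((-1) ^ l.length : ℤ) •
        (((l.flatMap fun x => [ιH x.1, ιK x.2]).map π).map fun w => σ w * n).prod := by
    clear h
    induction l with
    | nil => simp
    | cons x l ih =>
      simp only [List.map_cons, List.prod_cons, ih, twistPoly_coeff_two, List.flatMap_cons,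
        List.cons_append, List.nil_append, List.length_cons, pow_succ]
      simp only [mul_neg, neg_mul, mul_one, neg_smul, smul_neg, mul_smul_comm, mul_assoc]
  rw [this, Matrix.trace_smul, smul_eq_mul]

theorem tracePoly_twist_coeff_eq_zero {ι : Type} [Fintype ι] [DecidableEq ι] {E : Type} [Group E]
    (π : G →* E) (σ : E →* Matrix ι ι ℤ) (n : Matrix ι ι ℤ) (l : List (H × K)) {k : ℕ}
    (hk : l.length < k) :
    (tracePoly (l.map fun x => twistPoly n (σ (π (ιH x.1))) (σ (π (ιK x.2)))).prod).coeff
      (k * 2) = 0 := by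
  rw [tracePoly_coeff, coeff_eq_zero_of_natDegree_lt, Matrix.trace_zero]
  refine (natDegree_list_prod_le _).trans_lt ((List.sum_le_card_nsmul _ 2 ?_).trans_lt ?_)
  · intro d hd
    simp only [List.mem_map] at hd
    obtain ⟨_, ⟨x, -, rfl⟩, rfl⟩ := hd
    exact twistPoly_natDegree_le _ _ _
  · simpa using hk

/-- In a finite `p`-quotient in which nothing relevant degenerates modulo the amalgamated
subgroup, the trace of a twisted regular representation separates a cyclically reduced element
from any element which is not conjugate to it and not longer. -/
theorem IsAmalgam.pConjSeparated_of_quotient (hp : p.Prime) (hG : IsAmalgam A B φ ιH ιK)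
    (hcen : A.map ιH ≤ Subgroup.center G) {E : Type} [Group E] [Finite E] (hE : IsPGroup p E)
    (π : G →* E) {l l' : List (H × K)} {L : ℕ} [NeZero L] {z : ZMod L → G}
    (hL : (l.flatMap fun x => [ιH x.1, ιK x.2]).length = L)
    (hz : ∀ i, (hi : i < (l.flatMap fun x => [ιH x.1, ιK x.2]).length) →
      (l.flatMap fun x => [ιH x.1, ιK x.2])[i] = z i)
    (hlen : l'.length ≤ l.length) (hred : ∀ j, π (z j) ∉ (A.map ιH).map π)
    (hsep : ∀ w ∈ l'.flatMap fun x => [ιH x.1, ιK x.2], ∀ j,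
      π (w * (z j)⁻¹) ∈ (A.map ιH).map π → w * (z j)⁻¹ ∈ A.map ιH)
    (hshift : ∀ j, spell ιH ιK l' * (cyclicSegment z j L)⁻¹ ∈ A.map ιH →
      π (spell ιH ιK l' * (cyclicSegment z j L)⁻¹) ≠ 1) :
    PConjSeparated p (spell ιH ιK l) (spell ιH ιK l') := by
  classical
  by_contra hs
  have := Fintype.ofFinite E
  set D := (A.map ιH).map π with hD
  set n := partialMatrix (trackShift D fun j => π (z j)) with hn
  have hnn : n * n = 0 := by
    rw [hn, partialMatrix_mul, ← partialMatrix_none]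
    congr 1
    funext x
    exact trackShift_bind_self hred x
  have hcomm : ∀ a : A, n * mulMatrix L (π (ιH a)) = mulMatrix L (π (ιH a)) * n := by
    intro a
    have ha : ιH a ∈ A.map ιH := Subgroup.mem_map_of_mem _ a.2
    change partialMatrix _ * partialMatrix _ = partialMatrix _ * partialMatrix _
    rw [partialMatrix_mul, partialMatrix_mul]
    congr 1
    funext x
    refine (trackShift_mul (Subgroup.mem_map_of_mem π ha) (fun j => ?_) x).symm
    exact Commute.map (Subgroup.mem_center_iff.1 (hcen ha) (z j)).symm π
  have htr := congrArg (fun f : ℤ[X] => f.coeff (l.length * 2))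
    (hG.tracePoly_eq hp hE π (mulMatrix L) n hnn hcomm l l' hs)
  beta_reduce at htr
  rw [tracePoly_twist_coeff, prod_mulMatrix_mul_trackShift] at htr
  have hpos := partialMatrix_trace_pos (f := track D (fun j => π (z j))
    ((l.flatMap fun x => [ιH x.1, ιK x.2]).map π)) (i := (1, 0)) (by
      rw [track_self _ _ _ _ (fun i hi => by
        rw [List.getElem_map, hz, zero_add])]
      simp [hL, -List.length_flatMap])
  rcases hlen.lt_or_eq with hlt | heq
  · rw [tracePoly_twist_coeff_eq_zero π _ n l' hlt] at htr
    exact hpos.ne' (by simpa using htr)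
  · have hzero : (partialMatrix (track D (fun j => π (z j))
        ((l'.flatMap fun x => [ιH x.1, ιK x.2]).map π))).trace = 0 := by
      refine partialMatrix_trace_eq_zero ?_
      rintro ⟨u, j⟩ hfix
      have hl'L : (l'.flatMap fun x => [ιH x.1, ιK x.2]).length = L := by
        rw [length_flatMap_pair, heq, ← length_flatMap_pair ιH ιK, hL]
      have hne : (l'.flatMap fun x => [ιH x.1, ιK x.2]).map π ≠ [] := by
        intro h0
        have := congrArg List.length h0
        rw [List.length_map, hl'L] at this
        exact NeZero.ne L this
      obtain ⟨a, ha, rfl⟩ := mem_of_track_eq_some hne hfix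
      obtain ⟨b, hb, h1, h2⟩ := exists_of_track_eq_some hcen hsep ha hfix
      rw [prod_flatMap_pair, hl'L] at h2
      have he : spell ιH ιK l' * (cyclicSegment z j L)⁻¹ = a⁻¹ * b := by
        rw [mul_inv_eq_iff_eq_mul, mul_assoc, ← h2, inv_mul_cancel_left]
      refine hshift j (he ▸ mul_mem (inv_mem ha) hb) ?_
      rw [he, map_mul, map_inv, ← h1, inv_mul_cancel]
    rw [← heq, tracePoly_twist_coeff, prod_mulMatrix_mul_trackShift, hzero, mul_zero] at htr
    exact hpos.ne' (by simpa using htr)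

end Separation

section Main

variable {p : ℕ} {H K G : Type} [Group H] [Group K] [Group G]
  {A : Subgroup H} {B : Subgroup K} {φ : A ≃* B} {ιH : H →* G} {ιK : K →* G}

theorem IsAmalgam.map_map_le_bot (hG : IsAmalgam A B φ ιH ιK) {X : Type} [Group X] {π : G →* X}
    (hπ : ∀ k, π (ιK k) = 1) : (A.map ιH).map π ≤ ⊥ := by
  rintro _ ⟨_, hx, rfl⟩
  rw [SetLike.mem_coe, ← hG.map_eq] at hx
  obtain ⟨b, -, rfl⟩ := hx
  exact hπ b

theorem IsAmalgam.pSeparatedFrom_left (hG : IsAmalgam A B φ ιH ιK)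
    (hA : A ≤ Subgroup.center H) (hsep : PSep p (A : Set H)) {h : H} (hh : h ∉ A) :
    PSeparatedFrom p (ιH h) (A.map ιH) := by
  obtain ⟨X, _, h1, h2, π, h3, h4⟩ := hG.exists_kill_right hA hsep hh
  exact ⟨X, _, h1, h2, π, fun hm => h3 (hG.map_map_le_bot h4 hm)⟩

/-- Modulo the amalgamated subgroup, elements of the factors are separated from those elements
of `H` which are not in `A`. -/
theorem IsAmalgam.pSeparatedFrom_mul_inv (hG : IsAmalgam A B φ ιH ιK)
    (hA : A ≤ Subgroup.center H) (hsep : PSep p (A : Set H)) {h : H} (hh : h ∉ A) {w : G}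
    (hw : (∃ h', w = ιH h') ∨ ∃ k, w = ιK k) (hwh : w * (ιH h)⁻¹ ∉ A.map ιH) :
    PSeparatedFrom p (w * (ιH h)⁻¹) (A.map ιH) := by
  rcases hw with ⟨h', rfl⟩ | ⟨k, rfl⟩
  · rw [← map_inv, ← map_mul] at hwh ⊢
    exact hG.pSeparatedFrom_left hA hsep fun hm => hwh (Subgroup.mem_map_of_mem ιH hm)
  · obtain ⟨X, _, h1, h2, π, h3, h4⟩ := hG.exists_kill_right hA hsep hh
    refine ⟨X, _, h1, h2, π, fun hm => h3 ?_⟩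
    simpa [h4] using hG.map_map_le_bot h4 hm

/-- The image of an element of `A` other than the identity survives in a finite `p`-quotient. -/
theorem IsAmalgam.pSeparatedFrom_bot [Fact p.Prime] (hG : IsAmalgam A B φ ιH ιK)
    (hA : A ≤ Subgroup.center H) (hB : B ≤ Subgroup.center K) (hH : ConjPSep p H)
    (hBsub : ∀ V : Subgroup B, (∃ n : ℕ, V.index = p ^ n) →
      PSep p ((V.map B.subtype : Subgroup K) : Set K)) {g : G} (hg : g ∈ A.map ιH)
    (hg1 : g ≠ 1) : PSeparatedFrom p g ⊥ := by
  obtain ⟨a, -, rfl⟩ := hg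
  obtain ⟨P, _, h1, h2, ψ, h3, h4⟩ := hH a 1 fun h => hg1 (by simp [isConj_one_right.1 h.symm])
  obtain ⟨X, _, h5, h6, π, h7⟩ := hG.exists_extension hA hB hBsub h2 h3
  refine ⟨X, _, h5, h6, π, fun hm => h4 (h7 a 1 ?_)⟩
  rw [Subgroup.map_bot, Subgroup.mem_bot] at hm
  simp [hm]

/-- A cyclically reduced element is separated from every element which is not conjugate to it
and not longer. -/
theorem IsAmalgam.pConjSeparated_of_length_le [Fact p.Prime] (hG : IsAmalgam A B φ ιH ιK)
    (hA : A ≤ Subgroup.center H) (hB : B ≤ Subgroup.center K) (hH : ConjPSep p H)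
    (hAsep : PSep p (A : Set H)) (hBsep : PSep p (B : Set K))
    (hBsub : ∀ V : Subgroup B, (∃ n : ℕ, V.index = p ^ n) →
      PSep p ((V.map B.subtype : Subgroup K) : Set K)) {l l' : List (H × K)} (hne : l ≠ [])
    (hred : ∀ x ∈ l, x.1 ∉ A ∧ x.2 ∉ B) (hlen : l'.length ≤ l.length)
    (hconj : ¬ IsConj (spell ιH ιK l) (spell ιH ιK l')) :
    PConjSeparated p (spell ιH ιK l) (spell ιH ιK l') := by
  set s := l.flatMap fun x => [ιH x.1, ιK x.2] with hs
  set t := l'.flatMap fun x => [ιH x.1, ιK x.2]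
  have hletter : ∀ g ∈ s, (∃ h ∉ A, g = ιH h) ∨ ∃ k ∉ B, g = ιK k := by
    intro g hg
    obtain ⟨x, hx, hg⟩ := List.mem_flatMap.1 hg
    rcases List.mem_pair.1 hg with rfl | rfl
    exacts [.inl ⟨_, (hred x hx).1, rfl⟩, .inr ⟨_, (hred x hx).2, rfl⟩]
  have hpos : 0 < s.length := by
    obtain ⟨x, l, rfl⟩ := List.exists_cons_of_ne_nil hne
    simp [hs]
  have : NeZero s.length := ⟨hpos.ne'⟩
  let z : ZMod s.length → G := fun j => s.getD j.val 1
  have hz : ∀ i, (hi : i < s.length) → s[i] = z i := by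
    intro i hi
    simp [z, ZMod.val_natCast_of_lt hi, hi]
  have hzmem : ∀ j, z j ∈ s := fun j => by
    rw [← ZMod.natCast_zmod_val j, ← hz _ (ZMod.val_lt j)]
    exact List.getElem_mem _
  have hsepz : ∀ w, ((∃ h, w = ιH h) ∨ ∃ k, w = ιK k) → ∀ j, w * (z j)⁻¹ ∉ A.map ιH →
      PSeparatedFrom p (w * (z j)⁻¹) (A.map ιH) := by
    intro w hw j hwj
    rcases hletter _ (hzmem j) with ⟨h, hh, he⟩ | ⟨k, hk, he⟩
    · rw [he] at hwj ⊢
      exact hG.pSeparatedFrom_mul_inv hA hAsep hh hw hwj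
    · rw [he, ← hG.map_eq] at hwj ⊢
      exact hG.symm.pSeparatedFrom_mul_inv hB hBsep hk hw.symm hwj
  have ht' : ∀ w ∈ t, (∃ h, w = ιH h) ∨ ∃ k, w = ιK k := by
    intro w hw
    obtain ⟨x, hx, hw⟩ := List.mem_flatMap.1 hw
    rcases List.mem_pair.1 hw with rfl | rfl
    exacts [.inl ⟨_, rfl⟩, .inr ⟨_, rfl⟩]
  have hspell : cyclicSegment z 0 s.length = spell ιH ιK l :=
    (cyclicSegment_getD s).trans (prod_flatMap_pair ιH ιK l)
  have hstart : ∀ j, ¬ IsConj (cyclicSegment z j s.length) (spell ιH ιK l') := fun j h =>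
    hconj (hspell ▸ (isConj_cyclicSegment z j).trans h)
  have hzsep : ∀ j, PSeparatedFrom p (z j) (A.map ιH) := by
    intro j
    rcases hletter _ (hzmem j) with ⟨h, hh, he⟩ | ⟨k, hk, he⟩
    · rw [he]
      exact hG.pSeparatedFrom_left hA hAsep hh
    · rw [he, ← hG.map_eq]
      exact hG.symm.pSeparatedFrom_left hB hBsep hk
  let I := {x : Fin t.length × ZMod s.length // t[x.1] * (z x.2)⁻¹ ∉ A.map ιH}
  let J := {j // spell ιH ιK l' * (cyclicSegment z j s.length)⁻¹ ∈ A.map ιH}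
  have : Finite (ZMod s.length) := Finite.of_fintype _
  obtain ⟨X, _, hX, hpX, π, -, hπ⟩ := exists_forall_notMem_map (p := p)
    (I := ZMod s.length ⊕ I ⊕ J)
    (Sum.elim z <| Sum.elim (fun x => t[x.1.1] * (z x.1.2)⁻¹)
      fun j => spell ιH ιK l' * (cyclicSegment z j.1 s.length)⁻¹)
    (Sum.elim (fun _ => A.map ιH) <| Sum.elim (fun _ => A.map ιH) fun _ => ⊥) (by
      rintro (j | x | j)
      · exact hzsep j
      · exact hsepz _ (ht' _ (List.getElem_mem _)) _ x.2
      · exact hG.pSeparatedFrom_bot hA hB hH hBsub j.2 fun he =>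
          hstart j.1 (isConj_iff.2 ⟨1, by simpa using (mul_inv_eq_one.1 he).symm⟩))
  refine hG.pConjSeparated_of_quotient Fact.out (hG.commute_left hA hB) hpX π (L := s.length)
    (z := z) rfl hz hlen (fun j => hπ (.inl j)) ?_ fun j hj h1 =>
      hπ (.inr (.inr ⟨j, hj⟩)) ⟨1, rfl, (map_one π).trans h1.symm⟩
  intro w hw j hm
  by_contra hn
  obtain ⟨i, hi, rfl⟩ := List.mem_iff_getElem.1 hw
  exact hπ (.inr (.inl ⟨(⟨i, hi⟩, j), hn⟩)) hm

theorem IsAmalgam.pConjSeparated_left [Fact p.Prime] (hG : IsAmalgam A B φ ιH ιK)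
    (hA : A ≤ Subgroup.center H) (hB : B ≤ Subgroup.center K) (hH : ConjPSep p H)
    (hBsub : ∀ V : Subgroup B, (∃ n : ℕ, V.index = p ^ n) →
      PSep p ((V.map B.subtype : Subgroup K) : Set K)) {h h' : H}
    (hne : ¬ IsConj (ιH h) (ιH h')) : PConjSeparated p (ιH h) (ιH h') := by
  obtain ⟨P, _, h1, h2, ψ, h3, h4⟩ := hH h h' fun hc => hne (ιH.map_isConj hc)
  obtain ⟨X, _, h5, h6, π, h7⟩ := hG.exists_extension hA hB hBsub h2 h3
  exact .of_hom h6 π fun hc => h4 (h7 h h' hc)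

end Main
/-- Theorem 2: an amalgam of conjugacy `p`-separable groups over central subgroups, all
of whose finite `p`-power-index subgroups are `p`-separable in the respective factor,
is conjugacy `p`-separable. -/
theorem conjPSep_amalgam (p : ℕ) (hp : p.Prime)
    {H K G : Type} [Group H] [Group K] [Group G]
    (A : Subgroup H) (B : Subgroup K) (φ : A ≃* B)
    (hA : A ≤ Subgroup.center H) (hB : B ≤ Subgroup.center K)
    (ιH : H →* G) (ιK : K →* G) (hG : IsAmalgam A B φ ιH ιK)
    (hH : ConjPSep p H) (hK : ConjPSep p K)
    (hAsub : ∀ U : Subgroup A, (∃ n : ℕ, U.index = p ^ n) →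
      PSep p ((U.map A.subtype : Subgroup H) : Set H))
    (hBsub : ∀ V : Subgroup B, (∃ n : ℕ, V.index = p ^ n) →
      PSep p ((V.map B.subtype : Subgroup K) : Set K)) :
    ConjPSep p G := by
  have := Fact.mk hp
  have hAsep : PSep p (A : Set H) := by
    have := hAsub ⊤ ⟨0, by simp⟩
    rwa [← MonoidHom.range_eq_map, Subgroup.range_subtype] at this
  have hBsep : PSep p (B : Set K) := by
    have := hBsub ⊤ ⟨0, by simp⟩
    rwa [← MonoidHom.range_eq_map, Subgroup.range_subtype] at this
  have hhyp : ∀ l l' : List (H × K), l ≠ [] → (∀ x ∈ l, x.1 ∉ A ∧ x.2 ∉ B) →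
      l'.length ≤ l.length → ¬ IsConj (spell ιH ιK l) (spell ιH ιK l') →
      PConjSeparated p (spell ιH ιK l) (spell ιH ιK l') := fun _ _ =>
    hG.pConjSeparated_of_length_le hA hB hH hAsep hBsep hBsub
  have hmixed : ∀ h k, ¬ IsConj (ιH h) (ιK k) → PConjSeparated p (ιH h) (ιK k) := by
    intro h k hne
    by_cases hh : h ∈ A
    · rw [show ιH h = ιK (φ ⟨h, hh⟩) from hG.apply_eq ⟨h, hh⟩] at hne ⊢
      exact hG.symm.pConjSeparated_left hB hA hK hAsub hne
    · obtain ⟨X, _, h1, h2, π, h3, h4⟩ := hG.exists_kill_right hA hAsep hh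
      exact .of_hom h2 π fun hc => h3 (isConj_one_right.1 (h4 k ▸ hc).symm)
  have hell : ∀ l : List (H × K), l ≠ [] → (∀ x ∈ l, x.1 ∉ A ∧ x.2 ∉ B) → ∀ h k,
      ¬ IsConj (spell ιH ιK l) (ιH h * ιK k) →
      PConjSeparated p (spell ιH ιK l) (ιH h * ιK k) := by
    intro l hl hred h k hne
    have := hhyp l [(h, k)] hl hred (List.length_pos_of_ne_nil hl)
    simp only [spell_cons, spell_nil, mul_one] at this
    exact this hne
  intro a b hne
  have hcongr : ∀ a' b', IsConj a a' → IsConj b b' →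
      (¬ IsConj a' b' → PConjSeparated p a' b') → PConjSeparated p a b := fun a' b' ha hb h =>
    .congr ha hb (h fun hc => hne (ha.trans (hc.trans hb.symm)))
  rcases hG.isConj_cases a with ⟨h, ha⟩ | ⟨k, ha⟩ | ⟨l, hl, hred, ha⟩ <;>
    rcases hG.isConj_cases b with ⟨h', hb⟩ | ⟨k', hb⟩ | ⟨l', hl', hred', hb⟩ <;>
    refine hcongr _ _ ha hb fun hn => ?_
  · exact hG.pConjSeparated_left hA hB hH hBsub hn
  · exact hmixed h k' hn
  · simpa using (hell l' hl' hred' h 1 (by simpa using fun hc => hn (IsConj.symm hc))).symm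
  · exact (hmixed h' k fun hc => hn hc.symm).symm
  · exact hG.symm.pConjSeparated_left hB hA hK hAsub hn
  · simpa using (hell l' hl' hred' 1 k (by simpa using fun hc => hn (IsConj.symm hc))).symm
  · simpa using hell l hl hred h' 1 (by simpa using hn)
  · simpa using hell l hl hred 1 k' (by simpa using hn)
  · rcases le_total l'.length l.length with hlen | hlen
    · exact hhyp l l' hl hred hlen hn
    · exact (hhyp l' l hl' hred' hlen fun hc => hn hc.symm).symm
end

section
/- Every p'-isolated subgroup of a finitely generated nilpotent group is p-separable. -/
namespace Subgroup

open scoped commutatorElement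

variable {G Q : Type*} [Group G] [Group Q]

theorem FG.exists_finset_le_closure_sup_ker {f : G →* Q} {H : Subgroup G} (h : (H.map f).FG) :
    ∃ T : Finset G, (T : Set G) ⊆ H ∧ H ≤ closure (T : Set G) ⊔ f.ker := by
  classical
  obtain ⟨T', hT'⟩ := h
  have hsub : (T' : Set Q) ⊆ f '' (H : Set G) := by
    rw [← coe_map, ← hT']
    exact subset_closure
  obtain ⟨T, hTH, rfl⟩ := Finset.subset_set_image_iff.mp hsub
  refine ⟨T, hTH, ?_⟩
  rw [← comap_map_eq, ← map_le_iff_le_comap, ← hT', MonoidHom.map_closure, Finset.coe_image]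

theorem FG.of_map_of_inf_ker {f : G →* Q} {H : Subgroup G} (h : (H.map f).FG)
    (hker : (H ⊓ f.ker).FG) : H.FG := by
  obtain ⟨T, hTH, hT⟩ := h.exists_finset_le_closure_sup_ker
  have hle : closure (T : Set G) ≤ H := (closure_le H).mpr hTH
  have : H = closure (T : Set G) ⊔ (H ⊓ f.ker) := by
    refine le_antisymm (fun x hx => ?_) (sup_le hle inf_le_left)
    obtain ⟨y, hy, z, hz, rfl⟩ := mem_sup_of_normal_right.mp (hT hx)
    exact mul_mem_sup hy ⟨(H.mul_mem_cancel_left (hle hy)).mp hx, hz⟩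
  rw [this]
  exact FG.sup ⟨T, rfl⟩ hker

theorem fg_of_le_center {A : Subgroup G} (hA : A.FG) (hc : A ≤ center G) {B : Subgroup G}
    (hB : B ≤ A) : B.FG := by
  let _ : CommGroup A :=
    { (inferInstance : Group A) with
      mul_comm := fun a b => Subtype.ext (mem_center_iff.mp (hc b.2) a) }
  have : Group.FG A := (Group.fg_iff_subgroup_fg A).mpr hA
  have : Module.Finite ℤ (Additive A) := Module.Finite.iff_addGroup_fg.mpr inferInstance
  have h := (Submodule.fg_iff_addSubgroup_fg _).mp
    (IsNoetherian.noetherian (AddSubgroup.toIntSubmodule (Subgroup.toAddSubgroup (B.subgroupOf A))))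
  have h' : (B.subgroupOf A).FG := (fg_iff_add_fg _).mpr h
  have : Group.FG (B.subgroupOf A) := (Group.fg_iff_subgroup_fg _).mpr h'
  have := Group.fg_of_surjective (f := (subgroupOfEquivOfLe hB).toMonoidHom)
    (subgroupOfEquivOfLe hB).surjective
  exact (Group.fg_iff_subgroup_fg B).mp this

theorem fg_commutator_top [Group.FG G] {A L : Subgroup G} {T : Finset G}
    (hT : (T : Set G) ⊆ A) (hA : A ≤ closure (T : Set G) ⊔ L) (hL : L ≤ center G)
    (hc : ⁅A, (⊤ : Subgroup G)⁆ ≤ center G) : ⁅A, (⊤ : Subgroup G)⁆.FG := by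
  classical
  obtain ⟨S, hS⟩ := Group.fg_def.mp ‹Group.FG G›
  let K : Subgroup G := closure (Finset.image₂ (fun a s => ⁅a, s⁆) T S : Finset G)
  have hKA : K ≤ ⁅A, (⊤ : Subgroup G)⁆ := by
    refine (closure_le _).mpr ?_
    rw [Finset.coe_image₂]
    rintro _ ⟨a, ha, s, -, rfl⟩
    exact commutator_mem_commutator (hT ha) (mem_top s)
  have hKc := hKA.trans hc
  have hKn : K.Normal := ⟨fun k hk g => by
    rwa [mem_center_iff.mp (hKc hk) g, mul_inv_cancel_right]⟩
  let π := QuotientGroup.mk' K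
  have hπ : ∀ a ∈ A, ∀ g, π a * π g = π g * π a := by
    suffices h : A ≤ (center (G ⧸ K)).comap π from fun a ha g =>
      (mem_center_iff.mp (h ha) (π g)).symm
    refine hA.trans (sup_le ((closure_le _).mpr fun a ha => ?_) fun a ha => ?_)
    · have h : closure (S : Set G) ≤ (centralizer {π a}).comap π := by
        refine (closure_le _).mpr fun s hs => ?_
        have hk : ⁅a, s⁆ ∈ K := subset_closure (Finset.mem_image₂_of_mem ha hs)
        have : ⁅π a, π s⁆ = 1 := by
          rw [← map_commutatorElement]
          exact (QuotientGroup.eq_one_iff _).mpr hk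
        exact mem_centralizer_singleton_iff.mpr (commutatorElement_eq_one_iff_mul_comm.mp this).symm
      refine mem_center_iff.mpr fun q => ?_
      obtain ⟨g, rfl⟩ := QuotientGroup.mk'_surjective K q
      exact mem_centralizer_singleton_iff.mp (h (hS ▸ mem_top g))
    · refine mem_center_iff.mpr fun q => ?_
      obtain ⟨g, rfl⟩ := QuotientGroup.mk'_surjective K q
      exact congrArg π (mem_center_iff.mp (hL ha) g)
  have : ⁅A, (⊤ : Subgroup G)⁆ = K := by
    refine le_antisymm (commutator_le.mpr fun a ha g _ => ?_) hKA
    rw [← QuotientGroup.eq_one_iff, ← QuotientGroup.mk'_apply, map_commutatorElement]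
    exact commutatorElement_eq_one_iff_mul_comm.mpr (hπ a ha g)
  rw [this]
  exact ⟨_, rfl⟩

theorem lowerCentralSeries_le_center {n : ℕ}
    (h : (⊤ : Subgroup G).lowerCentralSeries (n + 1) = ⊥) :
    (⊤ : Subgroup G).lowerCentralSeries n ≤ center G := fun _ ha =>
  mem_center_iff.mpr fun g =>
    (commutatorElement_eq_one_iff_mul_comm.mp <| mem_bot.mp <| h.le <|
      commutator_mem_commutator ha (mem_top g)).symm

end Subgroup

namespace Group

open Subgroup

open scoped commutatorElement

theorem subgroup_fg_of_lowerCentralSeries_eq_bot (n : ℕ) (G : Type*) [Group G] [Group.FG G]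
    (h : (⊤ : Subgroup G).lowerCentralSeries n = ⊥) (H : Subgroup G) : H.FG := by
  induction n generalizing G with
  | zero =>
    have hH : H = ⊥ := le_bot_iff.mp (le_top.trans h.le)
    rw [hH]
    exact FG.bot
  | succ n ih =>
    have hc := lowerCentralSeries_le_center h
    set L := (⊤ : Subgroup G).lowerCentralSeries n with hL
    let π := QuotientGroup.mk' L
    have hker : π.ker = L := QuotientGroup.ker_mk' L
    have hquot : ∀ B : Subgroup (G ⧸ L), B.FG := fun B => by
      refine ih (G ⧸ L) ?_ B
      rw [← map_top_of_surjective π (QuotientGroup.mk'_surjective L), ← map_lowerCentralSeries,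
        ← hL, Subgroup.map_eq_bot_iff, hker]
    have hLfg : L.FG := by
      cases n with
      | zero => exact Group.fg_def.mp inferInstance
      | succ m =>
        obtain ⟨T, hT, hA⟩ := (hquot
          (((⊤ : Subgroup G).lowerCentralSeries m).map π)).exists_finset_le_closure_sup_ker
        rw [hker] at hA
        exact fg_commutator_top hT hA hc hc
    refine FG.of_map_of_inf_ker (hquot (H.map π)) (fg_of_le_center hLfg hc ?_)
    rw [hker]
    exact inf_le_right

/-- Every subgroup of a finitely generated nilpotent group is finitely generated. -/
theorem IsNilpotent.subgroup_fg (G : Type*) [Group G] [Group.FG G] [Group.IsNilpotent G]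
    (H : Subgroup G) : H.FG :=
  subgroup_fg_of_lowerCentralSeries_eq_bot _ G Subgroup.lowerCentralSeries_nilpotencyClass H

theorem finite_center_of_isOfFinOrder (G : Type*) [Group G] [Group.FG G] [Group.IsNilpotent G]
    (h : ∀ c ∈ center G, IsOfFinOrder c) : Finite (center G) := by
  have : Group.FG (center G) := (Group.fg_iff_subgroup_fg _).mpr (IsNilpotent.subgroup_fg G _)
  let _ : CommGroup (center G) :=
    { (inferInstance : Group (center G)) with
      mul_comm := fun a b => Subtype.ext (mem_center_iff.mp b.2 a) }
  exact CommGroup.finite_of_fg_isMulTorsion _ fun c =>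
    Submonoid.isOfFinOrder_coe.mp (h c c.2)

theorem IsNilpotent.finite_of_isOfFinOrder (G : Type*) [Group G] [Group.IsNilpotent G]
    [Group.FG G] (h : ∀ g : G, IsOfFinOrder g) : Finite G := by
  suffices H : Group.FG G → (∀ g : G, IsOfFinOrder g) → Finite G from H ‹_› h
  clear h
  refine nilpotent_center_quotient_ind
    (P := fun G _ _ => Group.FG G → (∀ g : G, IsOfFinOrder g) → Finite G) G ?_ ?_
  · intro G _ _ _ _
    infer_instance
  · intro G _ _ ih _ h
    have := finite_center_of_isOfFinOrder G fun c _ => h c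
    have : Finite (G ⧸ center G) := ih inferInstance fun q => by
      obtain ⟨g, rfl⟩ := QuotientGroup.mk_surjective q
      exact MonoidHom.isOfFinOrder (QuotientGroup.mk' _) (h g)
    exact Finite.of_subgroup_quotient (center G)

/-- In a nilpotent group whose centre has exponent dividing `m`, every element has order dividing
a power of `m`. -/
theorem IsNilpotent.exists_pow_pow_eq_one {m : ℕ} (G : Type*) [Group G] [Group.IsNilpotent G]
    (h : ∀ c ∈ center G, c ^ m = 1) (g : G) : ∃ k, g ^ m ^ k = 1 := by
  revert h g
  refine nilpotent_center_quotient_ind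
    (P := fun G _ _ => (∀ c ∈ center G, c ^ m = 1) → ∀ g : G, ∃ k, g ^ m ^ k = 1) G ?_ ?_
  · intro G _ _ _ g
    exact ⟨0, Subsingleton.elim _ _⟩
  · intro G _ _ ih h g
    have hquot : ∀ q ∈ center (G ⧸ center G), q ^ m = 1 := by
      intro q hq
      obtain ⟨x, rfl⟩ := QuotientGroup.mk_surjective q
      refine (QuotientGroup.eq_one_iff (x ^ m)).mpr (mem_center_iff.mpr fun y => ?_)
      have hz : ⁅y, x⁆ ∈ center G := by
        rw [← QuotientGroup.eq_one_iff]
        exact commutatorElement_eq_one_iff_mul_comm.mpr (mem_center_iff.mp hq y)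
      have hconj : y * x * y⁻¹ = ⁅y, x⁆ * x := by
        rw [commutatorElement_def, inv_mul_cancel_right]
      have hcomm : Commute ⁅y, x⁆ x := (mem_center_iff.mp hz x).symm
      have : y * x ^ m * y⁻¹ = x ^ m := by
        rw [← conj_pow, hconj, hcomm.mul_pow, h _ hz, one_mul]
      exact mul_inv_eq_iff_eq_mul.mp this
    obtain ⟨k, hk⟩ := ih hquot (g : G ⧸ center G)
    refine ⟨k + 1, ?_⟩
    rw [pow_succ, pow_mul]
    exact h _ ((QuotientGroup.eq_one_iff _).mp hk)

end Group

section

open Subgroup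

variable {G : Type*} [Group G] {p : ℕ}

/-- If `H` meets the centre trivially and is maximal among the subgroups containing no `p'`-power
of `y`, then the centre is a `p`-group. -/
theorem exists_pow_prime_pow_eq_one_of_mem_center (hp : p.Prime) {H : Subgroup G} {y : G}
    (hdisj : ∀ c ∈ center G, c ∈ H → c = 1)
    (hy : ∀ m : ℕ, m.Coprime p → y ^ m ∉ H)
    (hmax : ∀ K : Subgroup G, H < K → ∃ m : ℕ, m.Coprime p ∧ y ^ m ∈ K)
    {c : G} (hc : c ∈ center G) : ∃ k, c ^ p ^ k = 1 := by
  by_contra! hne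
  have hcomm : ∀ (i : ℤ) (g : G), Commute g (c ^ i) := fun i g =>
    Commute.zpow_right (mem_center_iff.mp hc g) i
  have key : ∀ k : ℕ, ∃ m : ℕ, m.Coprime p ∧ ∃ i : ℤ, ∃ h ∈ H,
      y ^ m = h * c ^ ((p : ℤ) ^ k * i) := by
    intro k
    have hck : c ^ p ^ k ∈ center G := pow_mem hc _
    have hn : (zpowers (c ^ p ^ k)).Normal := ⟨fun x hx g => by
      have : x ∈ center G := zpowers_le.mpr hck hx
      rwa [mem_center_iff.mp this g, mul_inv_cancel_right]⟩
    obtain ⟨m, hm, hmem⟩ := hmax (H ⊔ zpowers (c ^ p ^ k)) <| left_lt_sup.mpr fun hle =>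
      hne k (hdisj _ hck (hle (mem_zpowers _)))
    obtain ⟨h, hh, z, hz, hhz⟩ := mem_sup_of_normal_right.mp hmem
    obtain ⟨i, rfl⟩ := mem_zpowers_iff.mp hz
    refine ⟨m, hm, i, h, hh, ?_⟩
    rw [← hhz, zpow_mul]
    norm_cast
  have hfin : ∃ r : ℕ, r ≠ 0 ∧ c ^ r = 1 := by
    obtain ⟨m, hm, i, h, hh, hmi⟩ := key 0
    rw [pow_zero, one_mul] at hmi
    have hi : i ≠ 0 := by
      rintro rfl
      exact hy m hm (by simpa [hmi] using hh)
    obtain ⟨k, hk⟩ : ∃ k : ℕ, ¬ (p : ℤ) ^ k ∣ i := by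
      have hfm : FiniteMultiplicity (p : ℤ) i :=
        Int.finiteMultiplicity_iff.mpr ⟨by simpa using hp.ne_one, hi⟩
      obtain ⟨k, hk⟩ := hfm
      exact ⟨_, hk⟩
    obtain ⟨m', hm', i', h', hh', hmi'⟩ := key k
    set r : ℤ := i * m' - (p : ℤ) ^ k * i' * m with hr
    have hr0 : r ≠ 0 := by
      intro h0
      have hdvd : (p : ℤ) ^ k ∣ i * m' := ⟨i' * m, by linarith⟩
      refine hk (IsCoprime.dvd_of_dvd_mul_right ?_ hdvd)
      exact (Nat.isCoprime_iff_coprime.mpr hm'.symm).pow_left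
    have e1 : y ^ (m * m') = h ^ m' * c ^ (i * m') := by
      rw [pow_mul, hmi, (hcomm i h).mul_pow, zpow_mul, zpow_natCast]
    have e2 : y ^ (m * m') = h' ^ m * c ^ ((p : ℤ) ^ k * i' * m) := by
      rw [mul_comm m m', pow_mul, hmi', (hcomm _ h').mul_pow, zpow_mul c _ (m : ℤ), zpow_natCast]
    have hcr : c ^ r = 1 := by
      refine hdisj _ (zpow_mem hc _) ?_
      have : c ^ r = (h ^ m')⁻¹ * h' ^ m := by
        rw [hr, zpow_sub, eq_inv_mul_iff_mul_eq, ← mul_assoc, ← e1, e2, mul_inv_cancel_right]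
      rw [this]
      exact mul_mem (inv_mem (pow_mem hh _)) (pow_mem hh' _)
    exact ⟨r.natAbs, Int.natAbs_ne_zero.mpr hr0, pow_natAbs_eq_one.mpr hcr⟩
  obtain ⟨r, hr0, hr⟩ := hfin
  obtain ⟨a, s, hs, rfl⟩ := Nat.exists_eq_pow_mul_and_not_dvd hr0 p hp.ne_one
  obtain ⟨m, hm, i, h, hh, hmi⟩ := key a
  have hsc : s.Coprime p := ((Nat.Prime.coprime_iff_not_dvd hp).mpr hs).symm
  refine hy (m * s) (hm.mul_left hsc) ?_
  have : (c ^ ((p : ℤ) ^ a * i)) ^ s = 1 := by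
    rw [← zpow_natCast, ← zpow_mul, mul_right_comm, zpow_mul]
    have : c ^ ((p : ℤ) ^ a * s) = 1 := by exact_mod_cast hr
    rw [this, one_zpow]
  rw [pow_mul, hmi, (hcomm _ h).mul_pow, this, mul_one]
  exact pow_mem hh _

theorem exists_maximal_subgroup_forall_pow_notMem {X : Subgroup G} {y : G}
    (hy : ∀ m : ℕ, m.Coprime p → y ^ m ∉ X) :
    ∃ H : Subgroup G, X ≤ H ∧ (∀ m : ℕ, m.Coprime p → y ^ m ∉ H) ∧
      ∀ K : Subgroup G, H < K → ∃ m : ℕ, m.Coprime p ∧ y ^ m ∈ K := by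
  obtain ⟨H, hXH, hH⟩ := zorn_le_nonempty₀
    {H : Subgroup G | ∀ m : ℕ, m.Coprime p → y ^ m ∉ H} (fun c hc hchain K hK => by
      refine ⟨sSup c, fun m hm hmem => ?_, fun z hz => le_sSup hz⟩
      obtain ⟨B, hB, hyB⟩ := (mem_sSup_of_directedOn ⟨K, hK⟩ hchain.directedOn).mp hmem
      exact hc hB m hm hyB) X hy
  refine ⟨H, hXH, hH.1, fun K hK => ?_⟩
  by_contra! hcon
  exact hK.not_ge (hH.2 hcon hK.le)

/-- In a finitely generated nilpotent group, an element none of whose `p'`-powers lies in `X` is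
separated from `X` by a normal subgroup whose quotient is a finite `p`-group. -/
theorem exists_normal_finite_isPGroup_quotient [Group.FG G] [Group.IsNilpotent G] (hp : p.Prime)
    {X : Subgroup G} {y : G} (hy : ∀ m : ℕ, m.Coprime p → y ^ m ∉ X) :
    ∃ M : Subgroup G, ∃ _ : M.Normal, Finite (G ⧸ M) ∧ IsPGroup p (G ⧸ M) ∧ y ∉ X ⊔ M := by
  obtain ⟨H, hXH, hyH, hmax⟩ := exists_maximal_subgroup_forall_pow_notMem hy
  let M := H.normalCore
  let π := QuotientGroup.mk' M
  have hπ : Function.Surjective π := QuotientGroup.mk'_surjective M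
  have hMH : M ≤ H := H.normalCore_le
  have hker : π.ker = M := QuotientGroup.ker_mk' M
  have hcomap : (H.map π).comap π = H := comap_map_eq_self (hker.trans_le hMH)
  have hcenter : ∀ c ∈ center (G ⧸ M), ∃ k, c ^ p ^ k = 1 := by
    intro c hc
    refine exists_pow_prime_pow_eq_one_of_mem_center hp (H := H.map π) (y := π y) ?_ ?_ ?_ hc
    · intro c hc hcH
      obtain ⟨g, rfl⟩ := hπ c
      have hn : (zpowers (π g)).Normal := ⟨fun x hx q => by
        have : x ∈ center (G ⧸ M) := zpowers_le.mpr hc hx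
        rwa [mem_center_iff.mp this q, mul_inv_cancel_right]⟩
      have hle : (zpowers (π g)).comap π ≤ M := by
        refine normal_le_normalCore.mpr ?_
        exact (comap_mono (zpowers_le.mpr hcH)).trans hcomap.le
      exact (QuotientGroup.eq_one_iff g).mpr (hle (mem_zpowers (π g)))
    · intro m hm hmem
      rw [← map_pow, ← mem_comap, hcomap] at hmem
      exact hyH m hm hmem
    · intro K hK
      obtain ⟨m, hm, hmem⟩ := hmax (K.comap π) <|
        hcomap.symm.trans_lt ((comap_lt_comap_of_surjective hπ).mpr hK)
      exact ⟨m, hm, by rwa [mem_comap, map_pow] at hmem⟩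
  have : Fact p.Prime := ⟨hp⟩
  have : Finite (center (G ⧸ M)) := Group.finite_center_of_isOfFinOrder _ fun c hc => by
    obtain ⟨k, hk⟩ := hcenter c hc
    exact isOfFinOrder_iff_pow_eq_one.mpr ⟨_, pow_pos hp.pos k, hk⟩
  have hZ : IsPGroup p (center (G ⧸ M)) := fun c => by
    obtain ⟨k, hk⟩ := hcenter c c.2
    exact ⟨k, Subtype.ext hk⟩
  obtain ⟨e, he⟩ := IsPGroup.iff_card.mp hZ
  have hP : IsPGroup p (G ⧸ M) := fun g => by
    obtain ⟨k, hk⟩ := Group.IsNilpotent.exists_pow_pow_eq_one (m := p ^ e) (G ⧸ M)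
      (fun c hc => by
        rw [← he]
        exact congrArg Subtype.val (pow_card_eq_one' (x := (⟨c, hc⟩ : center (G ⧸ M))))) g
    exact ⟨e * k, by rwa [pow_mul]⟩
  refine ⟨M, inferInstance, Group.IsNilpotent.finite_of_isOfFinOrder _ fun g => ?_, hP, ?_⟩
  · obtain ⟨k, hk⟩ := hP g
    exact isOfFinOrder_iff_pow_eq_one.mpr ⟨_, pow_pos hp.pos k, hk⟩
  · intro hmem
    exact hyH 1 (Nat.coprime_one_left p) (by simpa using sup_le hXH hMH hmem)

theorem mem_of_pow_mem_of_coprime (hp : p.Prime) {X : Subgroup G}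
    (hiso : ∀ q : ℕ, q.Prime → q ≠ p → ∀ y : G, y ^ q ∈ X → y ∈ X) {m : ℕ} (hm : m.Coprime p)
    {y : G} (h : y ^ m ∈ X) : y ∈ X := by
  induction m using Nat.recOnMul generalizing y with
  | zero => exact absurd (Nat.coprime_zero_left p |>.mp hm) hp.ne_one
  | one => simpa using h
  | prime q hq => exact hiso q hq ((Nat.coprime_primes hq hp).mp hm) y h
  | mul a b ha hb =>
    rw [pow_mul] at h
    exact ha hm.coprime_mul_right (hb hm.coprime_mul_left h)

end

/-- Every `p'`-isolated subgroup of a finitely generated nilpotent group is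
`p`-separable. -/
theorem pSep_of_pPrimeIsolated (p : ℕ) (hp : p.Prime)
    (Y : Type) [Group Y] [Group.FG Y] [Group.IsNilpotent Y]
    (X : Subgroup Y)
    (hiso : ∀ q : ℕ, q.Prime → q ≠ p → ∀ y : Y, y ^ q ∈ X → y ∈ X) :
    PSep p (X : Set Y) := by
  intro y hy
  obtain ⟨M, _, hfin, hP, hyM⟩ := exists_normal_finite_isPGroup_quotient hp
    (X := X) (y := y) fun m hm h => hy (mem_of_pow_mem_of_coprime hp hiso hm h)
  refine ⟨Y ⧸ M, inferInstance, hfin, hP, QuotientGroup.mk' M, QuotientGroup.mk'_surjective M, ?_⟩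
  intro hmem
  refine hyM ?_
  rwa [← Subgroup.coe_map, SetLike.mem_coe, ← Subgroup.mem_comap, Subgroup.comap_map_eq,
    QuotientGroup.ker_mk'] at hmem
end
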